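/- arXiv:2505.10667 — 10 statements merged into one kernel-verified Lean document; each statement's English description precedes it below -/
import Mathlib

section
/- Let p₁ ∈ Δ^{n₁}, p₂ ∈ Δ^{n₂} (n₁,n₂ > 1) be probability vectors with all entries positive, P = (p₁,p₂), C ∈ ℝ^{n₁×n₂}, and ε > 0. The minimizer U of the entropic relaxation τ(C,P,ε) over V(P) is unique, lies in the relative interior of V(P) (i.e. has all entries positive), and has the form U = exp(∘(u₁𝟙_{n₂}ᵀ + 𝟙_{n₁}u₂ᵀ − C/ε)) (entry-wise exponential), where u₁ ∈ ℝ^{n₁}, u₂ ∈ ℝ^{n₂} satisfy 𝟙_{n₁}ᵀu₁ = 𝟙_{n₂}ᵀu₂, and the vectors u₁, u₂ satisfying this normalization are unique. -/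
open Finset

section EntropicTransport

variable {ι κ : Type*} [Fintype ι] [Fintype κ]

/-- The transport polytope of nonnegative matrices with row sums `p` and column sums `q`. -/
def transportPolytope (p : ι → ℝ) (q : κ → ℝ) : Set (ι → κ → ℝ) :=
  {V | (∀ i j, 0 ≤ V i j) ∧ (∀ i, ∑ j, V i j = p i) ∧ (∀ j, ∑ i, V i j = q j)}

/-- The entropically regularized transport cost. -/
noncomputable def entropicCost (C : ι → κ → ℝ) (ε : ℝ) (V : ι → κ → ℝ) : ℝ :=
  ∑ i, ∑ j, (C i j * V i j + ε * (V i j * Real.log (V i j)))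

lemma continuous_entropicCost (C : ι → κ → ℝ) (ε : ℝ) : Continuous (entropicCost C ε) := by
  unfold entropicCost
  refine continuous_finsetSum _ fun i _ => continuous_finsetSum _ fun j _ => ?_
  have h : Continuous fun V : ι → κ → ℝ => V i j := by fun_prop
  exact (continuous_const.mul h).add (continuous_const.mul (Real.continuous_mul_log.comp h))

lemma isCompact_transportPolytope (p : ι → ℝ) (q : κ → ℝ) :
    IsCompact (transportPolytope p q) := by
  refine (isCompact_Icc (a := (0 : ι → κ → ℝ)) (b := fun i _ => p i)).of_isClosed_subset ?_ ?_
  · simp only [transportPolytope, Set.ofPred_and, Set.ofPred_forall]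
    refine IsClosed.inter ?_ (IsClosed.inter ?_ ?_)
    · exact isClosed_iInter fun i => isClosed_iInter fun j =>
        isClosed_le continuous_const (by fun_prop)
    · exact isClosed_iInter fun i => isClosed_eq (by fun_prop) continuous_const
    · exact isClosed_iInter fun j => isClosed_eq (by fun_prop) continuous_const
  · rintro V ⟨h0, hr, -⟩
    refine ⟨fun i j => h0 i j, fun i j => ?_⟩
    refine le_of_le_of_eq ?_ (hr i)
    exact single_le_sum (f := V i) (fun j _ => h0 i j) (mem_univ j)

lemma convex_transportPolytope (p : ι → ℝ) (q : κ → ℝ) : Convex ℝ (transportPolytope p q) := by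
  rintro V ⟨hV, hVr, hVc⟩ W ⟨hW, hWr, hWc⟩ a b ha hb hab
  refine ⟨fun i j => ?_, fun i => ?_, fun j => ?_⟩
  · exact add_nonneg (mul_nonneg ha (hV i j)) (mul_nonneg hb (hW i j))
  · simp only [Pi.add_apply, Pi.smul_apply, smul_eq_mul, sum_add_distrib, ← mul_sum, hVr, hWr,
      ← add_mul, hab, one_mul]
  · simp only [Pi.add_apply, Pi.smul_apply, smul_eq_mul, sum_add_distrib, ← mul_sum, hVc, hWc,
      ← add_mul, hab, one_mul]

lemma product_mem_transportPolytope {p : ι → ℝ} {q : κ → ℝ} (hp : ∀ i, 0 < p i)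
    (hq : ∀ j, 0 < q j) (hp1 : ∑ i, p i = 1) (hq1 : ∑ j, q j = 1) :
    (fun i j => p i * q j) ∈ transportPolytope p q :=
  ⟨fun i j => (mul_pos (hp i) (hq j)).le, fun i => by rw [← mul_sum, hq1, mul_one],
    fun j => by rw [← sum_mul, hp1, one_mul]⟩

lemma strictConvexOn_entropicCost (C : ι → κ → ℝ) {ε : ℝ} (hε : 0 < ε) :
    StrictConvexOn ℝ {V : ι → κ → ℝ | ∀ i j, 0 ≤ V i j} (entropicCost C ε) := by
  refine ⟨fun V hV W hW a b ha hb _ i j =>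
    add_nonneg (mul_nonneg ha (hV i j)) (mul_nonneg hb (hW i j)), ?_⟩
  intro V hV W hW hne a b ha hb hab
  have hle (i : ι) (j : κ) := Real.convexOn_mul_log.2 (Set.mem_Ici.2 (hV i j))
    (Set.mem_Ici.2 (hW i j)) ha.le hb.le hab
  obtain ⟨i, hi⟩ := Function.ne_iff.1 hne
  obtain ⟨j, hij⟩ := Function.ne_iff.1 hi
  have hlt := Real.strictConvexOn_mul_log.2 (Set.mem_Ici.2 (hV i j))
    (Set.mem_Ici.2 (hW i j)) hij ha hb hab
  simp only [entropicCost, smul_eq_mul, mul_sum, ← sum_add_distrib, Pi.add_apply,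
    Pi.smul_apply] at hle hlt ⊢
  have hle' (i : ι) (j : κ) := mul_le_mul_of_nonneg_left (hle i j) hε.le
  have hlt' := mul_lt_mul_of_pos_left hlt hε
  refine sum_lt_sum (fun i _ => sum_le_sum fun j _ => ?_)
    ⟨i, mem_univ i, sum_lt_sum (fun j _ => ?_) ⟨j, mem_univ j, ?_⟩⟩
  · linarith [hle' i j]
  · linarith [hle' i j]
  · linarith

/-- Along a segment leaving a zero entry, the entropic cost beats convexity by a `t log t` term. -/
lemma entropicCost_segment_le (C : ι → κ → ℝ) {ε : ℝ} (hε : 0 < ε) {U W : ι → κ → ℝ}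
    (hU : ∀ i j, 0 ≤ U i j) (hW : ∀ i j, 0 < W i j) {i₀ : ι} {j₀ : κ} (h0 : U i₀ j₀ = 0)
    {t : ℝ} (ht : 0 < t) (ht1 : t < 1) :
    entropicCost C ε ((1 - t) • U + t • W) ≤
      (1 - t) * entropicCost C ε U + t * entropicCost C ε W
        + ε * (t * W i₀ j₀ * Real.log t) := by
  classical
  have key (i : ι) (j : κ) :
      ((1 - t) * U i j + t * W i j) * Real.log ((1 - t) * U i j + t * W i j) ≤
      (1 - t) * (U i j * Real.log (U i j)) + t * (W i j * Real.log (W i j))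
        + if i = i₀ then (if j = j₀ then t * W i₀ j₀ * Real.log t else 0) else 0 := by
    by_cases h : i = i₀ ∧ j = j₀
    · obtain ⟨rfl, rfl⟩ := h
      simp only [h0, if_true, mul_zero, zero_mul, zero_add]
      rw [Real.log_mul ht.ne' (hW i j).ne']
      exact le_of_eq (by ring)
    · have hz : (if i = i₀ then (if j = j₀ then t * W i₀ j₀ * Real.log t else 0) else 0) = 0 := by
        grind
      rw [hz, add_zero]
      exact Real.convexOn_mul_log.2 (Set.mem_Ici.2 (hU i j)) (Set.mem_Ici.2 (hW i j).le)
        (by linarith) ht.le (by ring)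
  have hsum : t * W i₀ j₀ * Real.log t = ∑ i, ∑ j,
      if i = i₀ then (if j = j₀ then t * W i₀ j₀ * Real.log t else 0) else 0 := by
    simp [sum_ite_irrel]
  rw [hsum]
  simp only [entropicCost, mul_sum, ← sum_add_distrib, Pi.add_apply, Pi.smul_apply, smul_eq_mul]
  refine sum_le_sum fun i _ => sum_le_sum fun j _ => ?_
  linarith [mul_le_mul_of_nonneg_left (key i j) hε.le]

lemma pos_of_isMinOn_entropicCost {C : ι → κ → ℝ} {ε : ℝ} (hε : 0 < ε) {p : ι → ℝ} {q : κ → ℝ}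
    {U W : ι → κ → ℝ} (hU : U ∈ transportPolytope p q)
    (hmin : IsMinOn (entropicCost C ε) (transportPolytope p q) U)
    (hW : W ∈ transportPolytope p q) (hWpos : ∀ i j, 0 < W i j) (i : ι) (j : κ) :
    0 < U i j := by
  refine (hU.1 i j).lt_of_ne' fun h0 => ?_
  set a := entropicCost C ε U
  set b := entropicCost C ε W
  have hc : 0 < ε * W i j := mul_pos hε (hWpos i j)
  set K := (|a - b| + 1) / (ε * W i j)
  have hKpos : 0 < K := by positivity
  have ht := Real.exp_pos (-K)
  have ht1 : Real.exp (-K) < 1 := Real.exp_zero ▸ Real.exp_lt_exp.2 (neg_neg_of_pos hKpos)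
  have h1 := entropicCost_segment_le C hε hU.1 hWpos h0 ht ht1
  have h2 : a ≤ entropicCost C ε ((1 - Real.exp (-K)) • U + Real.exp (-K) • W) :=
    isMinOn_iff.1 hmin _ (convex_transportPolytope p q hU hW (by linarith) ht.le
      (by ring))
  rw [Real.log_exp] at h1
  have hKc : K * (ε * W i j) = |a - b| + 1 := div_mul_cancel₀ _ hc.ne'
  have h3 : 0 ≤ Real.exp (-K) * (b - a - K * (ε * W i j)) := by linarith
  rw [hKc] at h3
  have := nonneg_of_mul_nonneg_right h3 ht
  linarith [neg_abs_le (a - b)]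

/-- First-order optimality at a positive minimizer, along directions with zero marginals. -/
lemma sum_mul_eq_zero_of_isMinOn_entropicCost {C : ι → κ → ℝ} {ε : ℝ} {p : ι → ℝ} {q : κ → ℝ}
    {U D : ι → κ → ℝ} (hU : U ∈ transportPolytope p q)
    (hmin : IsMinOn (entropicCost C ε) (transportPolytope p q) U) (hpos : ∀ i j, 0 < U i j)
    (hDr : ∀ i, ∑ j, D i j = 0) (hDc : ∀ j, ∑ i, D i j = 0) :
    ∑ i, ∑ j, D i j * (C i j + ε * Real.log (U i j)) = 0 := by
  have hderiv : HasDerivAt (fun t : ℝ => entropicCost C ε fun i j => U i j + t * D i j)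
      (∑ i, ∑ j, (C i j * D i j + ε * ((Real.log (U i j) + 1) * D i j))) 0 := by
    unfold entropicCost
    refine HasDerivAt.fun_sum fun i _ => HasDerivAt.fun_sum fun j _ => ?_
    have hl : HasDerivAt (fun t : ℝ => U i j + t * D i j) (D i j) 0 := by
      simpa using ((hasDerivAt_id (0 : ℝ)).mul_const (D i j)).const_add (U i j)
    have hφ : HasDerivAt (fun x : ℝ => x * Real.log x) (Real.log (U i j) + 1)
        (U i j + 0 * D i j) := by
      simpa using Real.hasDerivAt_mul_log (hpos i j).ne'
    exact (hl.const_mul _).add ((HasDerivAt.comp (h₂ := fun x : ℝ => x * Real.log x) (0 : ℝ) hφ hl).const_mul ε)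
  have hmem : ∀ᶠ t in nhds (0 : ℝ), (fun i j => U i j + t * D i j) ∈ transportPolytope p q := by
    have hev : ∀ᶠ t in nhds (0 : ℝ), ∀ i j, 0 < U i j + t * D i j := by
      refine Filter.eventually_all.2 fun i => Filter.eventually_all.2 fun j => ?_
      have hcont : Continuous fun t : ℝ => U i j + t * D i j := by fun_prop
      exact hcont.continuousAt.eventually_const_lt (by simpa using hpos i j)
    filter_upwards [hev] with t ht
    exact ⟨fun i j => (ht i j).le,
      fun i => by rw [sum_add_distrib, ← mul_sum, hDr, mul_zero, add_zero, hU.2.1],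
      fun j => by rw [sum_add_distrib, ← mul_sum, hDc, mul_zero, add_zero, hU.2.2]⟩
  have hloc : IsLocalMin (fun t : ℝ => entropicCost C ε fun i j => U i j + t * D i j) 0 := by
    filter_upwards [hmem] with t ht
    simpa using isMinOn_iff.1 hmin _ ht
  rw [← hloc.hasDerivAt_eq_zero hderiv]
  have hD : ∑ i, ∑ j, ε * D i j = 0 := by simp [← mul_sum, hDr]
  rw [← add_zero (∑ i, ∑ j, _), ← hD]
  simp only [← sum_add_distrib]
  exact sum_congr rfl fun i _ => sum_congr rfl fun j _ => by ring

/-- A matrix orthogonal to all matrices with zero marginals has the form `x i + y j`. -/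
lemma exists_add_of_orthogonal_zero_marginals [Nonempty ι] [Nonempty κ] {M : ι → κ → ℝ}
    (hM : ∀ D : ι → κ → ℝ, (∀ i, ∑ j, D i j = 0) → (∀ j, ∑ i, D i j = 0) →
      ∑ i, ∑ j, D i j * M i j = 0) :
    ∃ (x : ι → ℝ) (y : κ → ℝ), ∀ i j, M i j = x i + y j := by
  classical
  obtain ⟨i₀⟩ := ‹Nonempty ι›
  obtain ⟨j₀⟩ := ‹Nonempty κ›
  refine ⟨fun i => M i j₀, fun j => M i₀ j - M i₀ j₀, fun i j => ?_⟩
  have h := hM (fun k l => ((Pi.single i 1 : ι → ℝ) k - (Pi.single i₀ 1 : ι → ℝ) k) *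
      ((Pi.single j 1 : κ → ℝ) l - (Pi.single j₀ 1 : κ → ℝ) l))
    (fun k => by simp [← mul_sum]) (fun l => by simp [← sum_mul])
  simp only [mul_assoc, ← mul_sum] at h
  simp only [sub_mul, sum_sub_distrib, Pi.single_apply, ite_mul, one_mul, zero_mul, sum_ite_eq',
    mem_univ, if_true] at h
  linarith

/-- Additive decompositions `x i + y j` have a unique normalization with equal total sums. -/
lemma existsUnique_balanced_add [Nonempty ι] [Nonempty κ] (x : ι → ℝ) (y : κ → ℝ) :
    ∃! u : (ι → ℝ) × (κ → ℝ), (∑ i, u.1 i = ∑ j, u.2 j) ∧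
      ∀ i j, x i + y j = u.1 i + u.2 j := by
  have hι : (0 : ℝ) < Fintype.card ι := by exact_mod_cast Fintype.card_pos
  have hκ : (0 : ℝ) < Fintype.card κ := by exact_mod_cast Fintype.card_pos
  set c : ℝ := (∑ j, y j - ∑ i, x i) / (Fintype.card ι + Fintype.card κ) with hc
  have hcmul : c * (Fintype.card ι + Fintype.card κ) = ∑ j, y j - ∑ i, x i :=
    div_mul_cancel₀ _ (by positivity)
  refine ⟨(fun i => x i + c, fun j => y j - c), ⟨?_, fun i j => by ring⟩, ?_⟩
  · simp only [sum_add_distrib, sum_sub_distrib, sum_const, card_univ, nsmul_eq_mul]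
    linarith
  · rintro ⟨a, b⟩ ⟨hsum, hab⟩
    obtain ⟨i₀⟩ := ‹Nonempty ι›
    obtain ⟨j₀⟩ := ‹Nonempty κ›
    dsimp only at hsum hab
    have ha (i : ι) : a i = x i + (y j₀ - b j₀) := by linarith [hab i j₀]
    have hb (j : κ) : b j = y j - (y j₀ - b j₀) := by linarith [hab i₀ j, hab i₀ j₀]
    set d := y j₀ - b j₀
    have hd : d = c := by
      simp only [ha, hb, sum_add_distrib, sum_sub_distrib, sum_const, card_univ,
        nsmul_eq_mul] at hsum
      rw [hc, eq_div_iff (by positivity)]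
      linarith
    rw [hd] at ha hb
    exact Prod.ext (funext ha) (funext hb)

lemma existsUnique_scaling_of_isMinOn_entropicCost [Nonempty ι] [Nonempty κ] {C : ι → κ → ℝ}
    {ε : ℝ} (hε : 0 < ε) {p : ι → ℝ} {q : κ → ℝ} {U : ι → κ → ℝ}
    (hU : U ∈ transportPolytope p q)
    (hmin : IsMinOn (entropicCost C ε) (transportPolytope p q) U) (hpos : ∀ i j, 0 < U i j) :
    ∃! u : (ι → ℝ) × (κ → ℝ), (∑ i, u.1 i = ∑ j, u.2 j) ∧
      ∀ i j, U i j = Real.exp (u.1 i + u.2 j - C i j / ε) := by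
  obtain ⟨x, y, hxy⟩ := exists_add_of_orthogonal_zero_marginals fun D hr hc =>
    sum_mul_eq_zero_of_isMinOn_entropicCost (D := D) hU hmin hpos hr hc
  have hiff (u : (ι → ℝ) × (κ → ℝ)) (i : ι) (j : κ) :
      U i j = Real.exp (u.1 i + u.2 j - C i j / ε) ↔
        x i / ε + y j / ε = u.1 i + u.2 j := by
    have hlog : Real.log (U i j) = x i / ε + y j / ε - C i j / ε := by
      field_simp
      linarith [hxy i j]
    rw [← Real.exp_log (hpos i j), Real.exp_eq_exp, hlog, sub_left_inj]
  simp only [hiff]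
  exact existsUnique_balanced_add (fun i => x i / ε) (fun j => y j / ε)

end EntropicTransport

/-- The minimizer of the entropic relaxation of the bi-partite OTP is unique, has all
entries positive, and is of the form `U = exp∘(u₁𝟙ᵀ + 𝟙u₂ᵀ − C/ε)` with the normalized
potentials `u₁, u₂` (satisfying `𝟙ᵀu₁ = 𝟙ᵀu₂`) unique. -/
theorem stmt_1 (n₁ n₂ : ℕ) (hn₁ : 1 < n₁) (hn₂ : 1 < n₂)
    (p₁ : Fin n₁ → ℝ) (p₂ : Fin n₂ → ℝ)
    (hp₁ : ∀ i, 0 < p₁ i) (hp₂ : ∀ j, 0 < p₂ j)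
    (hs₁ : ∑ i, p₁ i = 1) (hs₂ : ∑ j, p₂ j = 1)
    (C : Matrix (Fin n₁) (Fin n₂) ℝ) (ε : ℝ) (hε : 0 < ε) :
    let couplings : Set (Matrix (Fin n₁) (Fin n₂) ℝ) :=
      {V | (∀ i j, 0 ≤ V i j) ∧ (∀ i, ∑ j, V i j = p₁ i) ∧ (∀ j, ∑ i, V i j = p₂ j)}
    let obj : Matrix (Fin n₁) (Fin n₂) ℝ → ℝ := fun V =>
      (∑ i, ∑ j, C i j * V i j) - ε * (-∑ i, ∑ j, V i j * Real.log (V i j))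
    ∃! U : Matrix (Fin n₁) (Fin n₂) ℝ,
      U ∈ couplings ∧ (∀ V ∈ couplings, obj U ≤ obj V) ∧
      (∀ i j, 0 < U i j) ∧
      ∃! u : (Fin n₁ → ℝ) × (Fin n₂ → ℝ),
        (∑ i, u.1 i = ∑ j, u.2 j) ∧
        ∀ i j, U i j = Real.exp (u.1 i + u.2 j - C i j / ε) := by
  intro couplings obj
  have : Nonempty (Fin n₁) := ⟨⟨0, by omega⟩⟩
  have : Nonempty (Fin n₂) := ⟨⟨0, by omega⟩⟩
  have hobj (V : Matrix (Fin n₁) (Fin n₂) ℝ) : obj V = entropicCost C ε V := by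
    simp only [obj, entropicCost, sum_add_distrib, ← mul_sum]
    ring
  have hW := product_mem_transportPolytope hp₁ hp₂ hs₁ hs₂
  obtain ⟨U, hU, hmin⟩ := (isCompact_transportPolytope p₁ p₂).exists_isMinOn ⟨_, hW⟩
    (continuous_entropicCost C ε).continuousOn
  have hpos := pos_of_isMinOn_entropicCost hε hU hmin hW fun i j => mul_pos (hp₁ i) (hp₂ j)
  refine ⟨U, ⟨hU, fun V hV => ?_, hpos,
    existsUnique_scaling_of_isMinOn_entropicCost hε hU hmin hpos⟩, ?_⟩
  · exact (hobj U).trans_le ((isMinOn_iff.1 hmin V hV).trans_eq (hobj V).symm)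
  · rintro V ⟨hV, hVmin, -⟩
    have hVmin' : IsMinOn (entropicCost C ε) (transportPolytope p₁ p₂) V :=
      isMinOn_iff.2 fun W hW =>
        (hobj V).symm.trans_le ((hVmin W hW).trans_eq (hobj W))
    exact ((strictConvexOn_entropicCost C hε).subset (fun _ h => h.1)
      (convex_transportPolytope p₁ p₂)).eq_of_isMinOn hVmin' hmin hV hU
end

section
/- Let p₁ ∈ ℝ^{n₁}, p₂ ∈ ℝ^{n₂} be positive vectors with 𝟙_{n₁}ᵀp₁ = 𝟙_{n₂}ᵀp₂, P = (p₁,p₂), C ∈ ℝ^{n₁×n₂}, and ε > 0. The barrier relaxation τ_β(C,P,ε) is achieved at a unique matrix U = [u_{j₁,j₂}] ∈ V_o(P), and this U has the form u_{j₁,j₂} = ε/(c_{j₁,j₂} − u_{j₁,1} − u_{j₂,2}) for vectors u₁ = (u_{1,1},…,u_{n₁,1}) ∈ ℝ^{n₁}, u₂ = (u_{1,2},…,u_{n₂,2}) ∈ ℝ^{n₂} with Σ_{j₁} u_{j₁,1} = Σ_{j₂} u_{j₂,2}; moreover u₁ and u₂ satisfying this normalization are unique. -/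
/-- The entrywise positive matrices with row sums `p` and column sums `q`. -/
def positiveCouplings {ι κ : Type*} [Fintype ι] [Fintype κ] (p : ι → ℝ) (q : κ → ℝ) :
    Set (ι → κ → ℝ) :=
  {V | (∀ i j, 0 < V i j) ∧ (∀ i, ∑ j, V i j = p i) ∧ (∀ j, ∑ i, V i j = q j)}

/-- The linear cost of `V` plus `ε` times its logarithmic barrier. -/
noncomputable def barrierObjective {ι κ : Type*} [Fintype ι] [Fintype κ] (C : ι → κ → ℝ) (ε : ℝ)
    (V : ι → κ → ℝ) : ℝ :=
  (∑ i, ∑ j, C i j * V i j) + ε * (-∑ i, ∑ j, Real.log (V i j))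

section BarrierRelaxation

variable {ι κ : Type*} [Fintype ι] [Fintype κ] {p : ι → ℝ} {q : κ → ℝ} {C : ι → κ → ℝ} {ε : ℝ}

theorem barrierObjective_eq_sum (C : ι → κ → ℝ) (ε : ℝ) (V : ι → κ → ℝ) :
    barrierObjective C ε V = ∑ i, ∑ j, (C i j * V i j - ε * Real.log (V i j)) := by
  simp only [barrierObjective, Finset.sum_sub_distrib, ← Finset.mul_sum]
  ring

theorem mul_div_sum_mem_positiveCouplings [Nonempty ι] (hp : ∀ i, 0 < p i) (hq : ∀ j, 0 < q j)
    (hbal : ∑ i, p i = ∑ j, q j) :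
    (fun i j => p i * q j / ∑ i, p i) ∈ positiveCouplings p q := by
  have hs : 0 < ∑ i, p i := Finset.sum_pos (fun i _ => hp i) Finset.univ_nonempty
  refine ⟨fun i j => div_pos (mul_pos (hp i) (hq j)) hs, fun i => ?_, fun j => ?_⟩
  · rw [← Finset.sum_div, ← Finset.mul_sum, ← hbal, mul_div_cancel_right₀ _ hs.ne']
  · rw [← Finset.sum_div, ← Finset.sum_mul, mul_div_cancel_left₀ _ hs.ne']

theorem le_sum_of_mem_positiveCouplings (hp : ∀ i, 0 < p i) {V : ι → κ → ℝ}
    (hV : V ∈ positiveCouplings p q) (i : ι) (j : κ) : V i j ≤ ∑ i, p i :=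
  calc V i j ≤ ∑ j, V i j :=
        Finset.single_le_sum (fun j _ => (hV.1 i j).le) (Finset.mem_univ j)
    _ = p i := hV.2.1 i
    _ ≤ ∑ i, p i := Finset.single_le_sum (fun i _ => (hp i).le) (Finset.mem_univ i)

/-- On a sublevel set of the objective the entries are bounded away from zero. -/
theorem exists_pos_le_of_barrierObjective_le [Nonempty ι] (hp : ∀ i, 0 < p i) (hε : 0 < ε)
    (C : ι → κ → ℝ) (q : κ → ℝ) (A : ℝ) :
    ∃ δ, 0 < δ ∧ ∀ V ∈ positiveCouplings p q, barrierObjective C ε V ≤ A → ∀ i j, δ ≤ V i j := by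
  set S := ∑ i, p i
  have hS0 : 0 < S := Finset.sum_pos (fun i _ => hp i) Finset.univ_nonempty
  set m : ι → κ → ℝ := fun i j => -(|C i j| * S) - ε * Real.log S with hm
  set R := A - ∑ i, ∑ j, m i j with hR
  refine ⟨S * Real.exp (-(R / ε)), by positivity, fun V hV hVA i j => ?_⟩
  have hpos := hV.1
  have hle := le_sum_of_mem_positiveCouplings hp hV
  have hCV : ∀ i j, -(|C i j| * S) ≤ C i j * V i j := fun i j => by
    have h₁ : |C i j * V i j| ≤ |C i j| * S := by
      rw [abs_mul, abs_of_pos (hpos i j)]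
      exact mul_le_mul_of_nonneg_left (hle i j) (abs_nonneg _)
    exact (abs_le.1 h₁).1
  have hterm : ∀ i j, 0 ≤ C i j * V i j - ε * Real.log (V i j) - m i j := fun i j => by
    have h₁ := mul_le_mul_of_nonneg_left (Real.log_le_log (hpos i j) (hle i j)) hε.le
    have h₂ := hCV i j
    simp only [hm]
    linarith
  have hsum : ∑ i, ∑ j, (C i j * V i j - ε * Real.log (V i j) - m i j) ≤ R := by
    rw [barrierObjective_eq_sum] at hVA
    simp only [Finset.sum_sub_distrib] at hVA ⊢
    linarith
  have hij : C i j * V i j - ε * Real.log (V i j) - m i j ≤ R :=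
    calc _ ≤ ∑ j, (C i j * V i j - ε * Real.log (V i j) - m i j) :=
          Finset.single_le_sum (f := fun j => C i j * V i j - ε * Real.log (V i j) - m i j)
            (fun j _ => hterm i j) (Finset.mem_univ j)
      _ ≤ ∑ i, ∑ j, (C i j * V i j - ε * Real.log (V i j) - m i j) :=
          Finset.single_le_sum
            (f := fun i => ∑ j, (C i j * V i j - ε * Real.log (V i j) - m i j))
            (fun i _ => Finset.sum_nonneg fun j _ => hterm i j) (Finset.mem_univ i)
      _ ≤ R := hsum
  have hlog : Real.log S - R / ε ≤ Real.log (V i j) := by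
    have h₂ := hCV i j
    have h₃ : (Real.log S - Real.log (V i j)) * ε ≤ R := by
      simp only [hm] at hij
      linarith
    have := (le_div_iff₀ hε).2 h₃
    linarith
  rw [← Real.log_le_log_iff (by positivity) (hpos i j), Real.log_mul hS0.ne' (Real.exp_pos _).ne',
    Real.log_exp]
  linarith

theorem exists_isMinOn_barrierObjective [Nonempty ι] (hp : ∀ i, 0 < p i) (hq : ∀ j, 0 < q j)
    (hbal : ∑ i, p i = ∑ j, q j) (hε : 0 < ε) (C : ι → κ → ℝ) :
    ∃ U ∈ positiveCouplings p q, IsMinOn (barrierObjective C ε) (positiveCouplings p q) U := by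
  have hW := mul_div_sum_mem_positiveCouplings hp hq hbal
  set W : ι → κ → ℝ := fun i j => p i * q j / ∑ i, p i
  obtain ⟨δ, hδ, hδV⟩ :=
    exists_pos_le_of_barrierObjective_le hp hε C q (barrierObjective C ε W)
  set K : Set (ι → κ → ℝ) := Set.Icc (fun _ _ => δ) (fun _ _ => ∑ i, p i) ∩
    {V | (∀ i, ∑ j, V i j = p i) ∧ (∀ j, ∑ i, V i j = q j)}
  have hKpos : ∀ V ∈ K, V ∈ positiveCouplings p q := fun V hV =>
    ⟨fun i j => hδ.trans_le (hV.1.1 i j), hV.2⟩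
  have hmemK : ∀ V ∈ positiveCouplings p q, barrierObjective C ε V ≤ barrierObjective C ε W →
      V ∈ K := fun V hV hVW =>
    ⟨⟨hδV V hV hVW, le_sum_of_mem_positiveCouplings hp hV⟩, hV.2⟩
  have hclosed : IsClosed {V : ι → κ → ℝ | (∀ i, ∑ j, V i j = p i) ∧ (∀ j, ∑ i, V i j = q j)} := by
    simp only [Set.ofPred_and, Set.ofPred_forall]
    exact (isClosed_iInter fun i => isClosed_eq (by fun_prop) continuous_const).inter
      (isClosed_iInter fun j => isClosed_eq (by fun_prop) continuous_const)
  have hcompact : IsCompact K := isCompact_Icc.inter_right hclosed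
  have hcont : ContinuousOn (barrierObjective C ε) K := by
    rw [funext (barrierObjective_eq_sum C ε)]
    refine continuousOn_finsetSum _ fun i _ => continuousOn_finsetSum _ fun j _ => ?_
    have hentry : ContinuousOn (fun V : ι → κ → ℝ => V i j) K := by fun_prop
    exact (hentry.const_mul (C i j)).sub
      ((hentry.log fun V hV => ((hKpos V hV).1 i j).ne').const_mul ε)
  obtain ⟨U, hUK, hU⟩ := hcompact.exists_isMinOn ⟨W, hmemK W hW le_rfl⟩ hcont
  refine ⟨U, hKpos U hUK, fun V hV => ?_⟩
  rcases le_total (barrierObjective C ε V) (barrierObjective C ε W) with h | h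
  · exact hU (hmemK V hV h)
  · exact (hU (hmemK W hW le_rfl)).trans h

theorem convex_positiveCouplings (p : ι → ℝ) (q : κ → ℝ) : Convex ℝ (positiveCouplings p q) := by
  intro V hV W hW a b ha hb hab
  refine ⟨fun i j => ?_, fun i => ?_, fun j => ?_⟩
  · exact (convex_Ioi (0 : ℝ)) (hV.1 i j) (hW.1 i j) ha hb hab
  · simp only [Pi.add_apply, Pi.smul_apply, smul_eq_mul, Finset.sum_add_distrib, ← Finset.mul_sum,
      hV.2.1, hW.2.1, ← add_mul, hab, one_mul]
  · simp only [Pi.add_apply, Pi.smul_apply, smul_eq_mul, Finset.sum_add_distrib, ← Finset.mul_sum,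
      hV.2.2, hW.2.2, ← add_mul, hab, one_mul]

theorem strictConvexOn_barrierObjective (hε : 0 < ε) (C : ι → κ → ℝ) (p : ι → ℝ) (q : κ → ℝ) :
    StrictConvexOn ℝ (positiveCouplings p q) (barrierObjective C ε) := by
  refine ⟨convex_positiveCouplings p q, fun V hV W hW hVW a b ha hb hab => ?_⟩
  obtain ⟨i₀, hi₀⟩ := Function.ne_iff.1 hVW
  obtain ⟨j₀, hj₀⟩ := Function.ne_iff.1 hi₀
  have hle : ∀ i j, a * Real.log (V i j) + b * Real.log (W i j)
      ≤ Real.log (a * V i j + b * W i j) := fun i j =>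
    strictConcaveOn_log_Ioi.concaveOn.2 (hV.1 i j) (hW.1 i j) ha.le hb.le hab
  have hlt : a * Real.log (V i₀ j₀) + b * Real.log (W i₀ j₀)
      < Real.log (a * V i₀ j₀ + b * W i₀ j₀) :=
    strictConcaveOn_log_Ioi.2 (hV.1 i₀ j₀) (hW.1 i₀ j₀) hj₀ ha hb hab
  have hsum : ∑ i, ∑ j, (a * Real.log (V i j) + b * Real.log (W i j))
      < ∑ i, ∑ j, Real.log (a * V i j + b * W i j) :=
    Finset.sum_lt_sum (fun i _ => Finset.sum_le_sum fun j _ => hle i j)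
      ⟨i₀, Finset.mem_univ _, Finset.sum_lt_sum (fun j _ => hle i₀ j)
        ⟨j₀, Finset.mem_univ _, hlt⟩⟩
  have hmul := mul_lt_mul_of_pos_left hsum hε
  simp only [Finset.sum_add_distrib, ← Finset.mul_sum] at hmul
  simp only [barrierObjective, Pi.add_apply, Pi.smul_apply, smul_eq_mul, mul_add,
    Finset.sum_add_distrib, mul_left_comm _ a, mul_left_comm _ b, ← Finset.mul_sum]
  linarith

/-- The gradient of the objective at a minimizer is orthogonal to every direction with vanishing
row and column sums. -/
theorem sum_gradient_mul_eq_zero {U D : ι → κ → ℝ} (hU : U ∈ positiveCouplings p q)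
    (hmin : IsMinOn (barrierObjective C ε) (positiveCouplings p q) U)
    (hrow : ∀ i, ∑ j, D i j = 0) (hcol : ∀ j, ∑ i, D i j = 0) :
    ∑ i, ∑ j, (C i j - ε / U i j) * D i j = 0 := by
  have hderiv : HasDerivAt (fun t : ℝ => barrierObjective C ε fun i j => U i j + t * D i j)
      (∑ i, ∑ j, (C i j - ε / U i j) * D i j) 0 := by
    simp only [barrierObjective_eq_sum]
    refine HasDerivAt.fun_sum fun i _ => HasDerivAt.fun_sum fun j _ => ?_
    have hline : HasDerivAt (fun t : ℝ => U i j + t * D i j) (D i j) 0 := by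
      simpa using ((hasDerivAt_id (0 : ℝ)).mul_const (D i j)).const_add (U i j)
    have hne : U i j + 0 * D i j ≠ 0 := by simpa using (hU.1 i j).ne'
    refine ((hline.const_mul (C i j)).sub ((hline.log hne).const_mul ε)).congr_deriv ?_
    simp only [zero_mul, add_zero]
    ring
  refine IsLocalMin.hasDerivAt_eq_zero ?_ hderiv
  have hpos : ∀ᶠ t : ℝ in nhds 0, ∀ i j, 0 < U i j + t * D i j := by
    simp only [Filter.eventually_all]
    intro i j
    have hc : ContinuousAt (fun t : ℝ => U i j + t * D i j) 0 := by fun_prop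
    exact hc.eventually (lt_mem_nhds (by simpa using hU.1 i j))
  filter_upwards [hpos] with t ht
  have hmem : (fun i j => U i j + t * D i j) ∈ positiveCouplings p q := by
    refine ⟨ht, fun i => ?_, fun j => ?_⟩
    · rw [Finset.sum_add_distrib, ← Finset.mul_sum, hrow, mul_zero, add_zero, hU.2.1]
    · rw [Finset.sum_add_distrib, ← Finset.mul_sum, hcol, mul_zero, add_zero, hU.2.2]
  simpa using hmin hmem

theorem gradient_exchange {U : ι → κ → ℝ} (hU : U ∈ positiveCouplings p q)
    (hmin : IsMinOn (barrierObjective C ε) (positiveCouplings p q) U) (i i' : ι) (j j' : κ) :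
    C i j - ε / U i j =
      (C i j' - ε / U i j') + (C i' j - ε / U i' j) - (C i' j' - ε / U i' j') := by
  classical
  have h := sum_gradient_mul_eq_zero
    (D := fun k l => (Pi.single i 1 - Pi.single i' 1 : ι → ℝ) k *
      (Pi.single j 1 - Pi.single j' 1 : κ → ℝ) l) hU hmin
    (fun k => by simp [← Finset.mul_sum])
    (fun l => by simp [← Finset.sum_mul])
  simp only [Pi.sub_apply, Pi.single_apply, mul_sub, mul_ite, mul_one, mul_zero,
    Finset.sum_sub_distrib, Finset.sum_ite_eq', Finset.mem_univ, if_true] at h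
  linarith

end BarrierRelaxation

/-- A matrix satisfying the exchange identity is a sum of a row potential and a column potential,
and these are unique when their sums are required to agree. -/
theorem existsUnique_balanced_potentials {ι κ : Type*} [Fintype ι] [Fintype κ] [Nonempty ι]
    [Nonempty κ] {G : ι → κ → ℝ}
    (hG : ∀ i i' j j', G i j = G i j' + G i' j - G i' j') :
    ∃! u : (ι → ℝ) × (κ → ℝ), ∑ i, u.1 i = ∑ j, u.2 j ∧ ∀ i j, G i j = u.1 i + u.2 j := by
  obtain ⟨i₀⟩ := ‹Nonempty ι›
  obtain ⟨j₀⟩ := ‹Nonempty κ›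
  have hι : 0 < (Fintype.card ι : ℝ) := by exact_mod_cast Fintype.card_pos_iff.2 ⟨i₀⟩
  have hκ : 0 < (Fintype.card κ : ℝ) := by exact_mod_cast Fintype.card_pos_iff.2 ⟨j₀⟩
  set c : ℝ := (∑ j, G i₀ j - ∑ i, (G i j₀ - G i₀ j₀)) / (Fintype.card ι + Fintype.card κ) with hc
  refine ⟨(fun i => G i j₀ - G i₀ j₀ + c, fun j => G i₀ j - c), ⟨?_, fun i j => ?_⟩, ?_⟩
  · have hc' : c * (Fintype.card ι + Fintype.card κ) =
        ∑ j, G i₀ j - ∑ i, (G i j₀ - G i₀ j₀) := div_mul_cancel₀ _ (by positivity)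
    rw [Finset.sum_add_distrib (f := fun i => G i j₀ - G i₀ j₀),
      Finset.sum_sub_distrib (g := fun _ => c)]
    simp only [Finset.sum_const, Finset.card_univ, nsmul_eq_mul]
    linarith
  · have := hG i i₀ j j₀
    simp only
    linarith
  · rintro ⟨u, w⟩ ⟨hsum, hadd⟩
    simp only at hsum hadd
    have hu : ∀ i, u i = G i j₀ - w j₀ := fun i => by linarith [hadd i j₀]
    have hw : ∀ j, w j = G i₀ j - G i₀ j₀ + w j₀ := fun j => by
      linarith [hadd i₀ j, hadd i₀ j₀]
    have hshift : c = G i₀ j₀ - w j₀ := by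
      rw [hc, div_eq_iff (by positivity)]
      rw [Finset.sum_congr rfl fun i _ => hu i, Finset.sum_congr rfl fun j _ => hw j] at hsum
      simp only [Finset.sum_sub_distrib, Finset.sum_add_distrib, Finset.sum_const,
        Finset.card_univ, nsmul_eq_mul] at hsum ⊢
      linarith
    refine Prod.ext (funext fun i => ?_) (funext fun j => ?_)
    · simp only [hu i, hshift]
      ring
    · simp only [hw j, hshift]
      ring

/-- The barrier relaxation `τ_β(C,P,ε)` is achieved at a unique matrix `U ∈ V_o(P)`, of the
form `u_{j₁j₂} = ε/(c_{j₁j₂} − u_{j₁,1} − u_{j₂,2})` with balanced potentials `u₁, u₂`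
that are unique under the normalization `Σ u₁ = Σ u₂`. -/
theorem stmt_3 (n₁ n₂ : ℕ) (hn₁ : 1 < n₁) (hn₂ : 1 < n₂)
    (p₁ : Fin n₁ → ℝ) (p₂ : Fin n₂ → ℝ)
    (hp₁ : ∀ i, 0 < p₁ i) (hp₂ : ∀ j, 0 < p₂ j)
    (hbal : ∑ i, p₁ i = ∑ j, p₂ j)
    (C : Matrix (Fin n₁) (Fin n₂) ℝ) (ε : ℝ) (hε : 0 < ε) :
    let couplingsPos : Set (Matrix (Fin n₁) (Fin n₂) ℝ) :=
      {V | (∀ i j, 0 < V i j) ∧ (∀ i, ∑ j, V i j = p₁ i) ∧ (∀ j, ∑ i, V i j = p₂ j)}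
    let obj : Matrix (Fin n₁) (Fin n₂) ℝ → ℝ := fun V =>
      (∑ i, ∑ j, C i j * V i j) + ε * (-∑ i, ∑ j, Real.log (V i j))
    ∃! U : Matrix (Fin n₁) (Fin n₂) ℝ,
      U ∈ couplingsPos ∧ (∀ V ∈ couplingsPos, obj U ≤ obj V) ∧
      ∃! u : (Fin n₁ → ℝ) × (Fin n₂ → ℝ),
        (∑ i, u.1 i = ∑ j, u.2 j) ∧
        ∀ i j, U i j = ε / (C i j - u.1 i - u.2 j) := by
  intro couplingsPos obj
  have : Nonempty (Fin n₁) := ⟨⟨0, by omega⟩⟩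
  have : Nonempty (Fin n₂) := ⟨⟨0, by omega⟩⟩
  obtain ⟨U, hU, hmin⟩ := exists_isMinOn_barrierObjective hp₁ hp₂ hbal hε C
  refine ⟨U, ⟨hU, fun V hV => hmin hV, ?_⟩, fun V ⟨hV, hVmin, _⟩ => ?_⟩
  · refine (existsUnique_congr fun u => and_congr_right' (forall₂_congr fun i j => ?_)).1
      (existsUnique_balanced_potentials (gradient_exchange hU hmin))
    have hpos := hU.1 i j
    constructor
    · intro h
      have hdiv : C i j - u.1 i - u.2 j = ε / U i j := by linarith
      rw [hdiv, div_div_cancel₀ hε.ne']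
    · intro h
      rw [h, div_div_cancel₀ hε.ne']
      ring
  · exact (strictConvexOn_barrierObjective hε C p₁ p₂).eq_of_isMinOn
      (fun W hW => hVmin W hW) hmin hV hU
end

section
/- Let p₁ ∈ ℝ^{n₁}, p₂ ∈ ℝ^{n₂} be positive vectors with 𝟙_{n₁}ᵀp₁ = 𝟙_{n₂}ᵀp₂, C ∈ ℝ^{n₁×n₂}, ε > 0. Define C(x,y) = C − x𝟙_{n₂}ᵀ − 𝟙_{n₁}yᵀ, D̂ = {(x,y) : C(x,y) entrywise positive}, D = {(x,y) ∈ D̂ : 𝟙_{n₁}ᵀx = 𝟙_{n₂}ᵀy}, β_C(x,y) = −Σ_{j₁,j₂} log(c_{j₁,j₂} − x_{j₁} − y_{j₂}), and φ(x,y,C) = p₁ᵀx + p₂ᵀy − ε·β_C(x,y) + n₁n₂ε(1 − log ε). Then: (i) φ is concave on D̂ and strictly concave on D; (ii) max_{(x,y)∈D̂} φ(x,y,C) = max_{(x,y)∈D} φ(x,y,C) = τ_β(C,P,ε); (iii) φ attains its maximum on D̂ exactly on the line L = {(u₁,u₂) + t(𝟙_{n₁}, −𝟙_{n₂}) : t ∈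 ℝ}, which intersects D at the unique point (u₁,u₂), the normalized potentials of the unique barrier-relaxed minimizer. -/
namespace BarrierTransport

variable {ι κ : Type*}

lemma eq_shift_of_add_eq [Nonempty ι] [Nonempty κ] {u q : (ι → ℝ) × (κ → ℝ)}
    (h : ∀ i j, q.1 i + q.2 j = u.1 i + u.2 j) :
    ∃ t : ℝ, q = (fun i => u.1 i + t, fun j => u.2 j - t) := by
  obtain ⟨a⟩ := ‹Nonempty ι›
  obtain ⟨b⟩ := ‹Nonempty κ›
  refine ⟨u.2 b - q.2 b, Prod.ext (funext fun i => ?_) (funext fun j => ?_)⟩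
  · linarith [h i b]
  · linarith [h a b, h a j]

lemma slack_combo {C : Matrix ι κ ℝ} {a b : ℝ} (hab : a + b = 1) (q r : (ι → ℝ) × (κ → ℝ)) (i : ι) (j : κ) :
    C i j - (a • q + b • r).1 i - (a • q + b • r).2 j =
      a • (C i j - q.1 i - q.2 j) + b • (C i j - r.1 i - r.2 j) := by
  simp only [Prod.fst_add, Prod.snd_add, Prod.smul_fst, Prod.smul_snd, Pi.add_apply,
    Pi.smul_apply, smul_eq_mul]
  linear_combination (-(C i j)) * hab

/-- The domain of the dual function. -/
def dualDomain (C : Matrix ι κ ℝ) : Set ((ι → ℝ) × (κ → ℝ)) :=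
  {q | ∀ i j, 0 < C i j - q.1 i - q.2 j}

lemma convex_dualDomain (C : Matrix ι κ ℝ) : Convex ℝ (dualDomain C) := by
  intro q hq r hr a b ha hb hab i j
  rw [slack_combo hab]
  exact convex_Ioi (0 : ℝ) (hq i j) (hr i j) ha hb hab

variable [Fintype ι] [Fintype κ]

/-- Positive matrices with row sums `p₁` and column sums `p₂`. -/
def plans (p₁ : ι → ℝ) (p₂ : κ → ℝ) : Set (Matrix ι κ ℝ) :=
  {V | (∀ i j, 0 < V i j) ∧ (∀ i, ∑ j, V i j = p₁ i) ∧ (∀ j, ∑ i, V i j = p₂ j)}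

/-- The transport cost relaxed by the logarithmic barrier. -/
noncomputable def cost (C : Matrix ι κ ℝ) (ε : ℝ) (V : Matrix ι κ ℝ) : ℝ :=
  (∑ i, ∑ j, C i j * V i j) + ε * (-∑ i, ∑ j, Real.log (V i j))

/-- The normalized part of the dual domain. -/
def normalizedDomain (C : Matrix ι κ ℝ) : Set ((ι → ℝ) × (κ → ℝ)) :=
  {q | q ∈ dualDomain C ∧ ∑ i, q.1 i = ∑ j, q.2 j}

/-- The dual function of the barrier relaxation. -/
noncomputable def dual (p₁ : ι → ℝ) (p₂ : κ → ℝ) (C : Matrix ι κ ℝ) (ε : ℝ)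
    (q : (ι → ℝ) × (κ → ℝ)) : ℝ :=
  (∑ i, p₁ i * q.1 i) + (∑ j, p₂ j * q.2 j)
    - ε * (-∑ i, ∑ j, Real.log (C i j - q.1 i - q.2 j))
    + (Fintype.card ι : ℝ) * Fintype.card κ * ε * (1 - Real.log ε)

variable {p₁ : ι → ℝ} {p₂ : κ → ℝ} {C : Matrix ι κ ℝ} {ε : ℝ}

lemma sum_slack_mul {V : Matrix ι κ ℝ} (hr : ∀ i, ∑ j, V i j = p₁ i)
    (hc : ∀ j, ∑ i, V i j = p₂ j) (x : ι → ℝ) (y : κ → ℝ) :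
    ∑ i, ∑ j, (C i j - x i - y j) * V i j =
      (∑ i, ∑ j, C i j * V i j) - (∑ i, p₁ i * x i) - ∑ j, p₂ j * y j := by
  have h1 : ∑ i, p₁ i * x i = ∑ i, ∑ j, x i * V i j :=
    Finset.sum_congr rfl fun i _ => by rw [← hr i, ← Finset.mul_sum, mul_comm]
  have h2 : ∑ j, p₂ j * y j = ∑ i, ∑ j, y j * V i j := by
    rw [Finset.sum_comm]
    exact Finset.sum_congr rfl fun j _ => by rw [← hc j, ← Finset.mul_sum, mul_comm]
  rw [h1, h2]
  simp only [sub_mul, Finset.sum_sub_distrib]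

lemma cost_sub_dual (hε : 0 < ε) {V : Matrix ι κ ℝ} (hV : V ∈ plans p₁ p₂)
    {q : (ι → ℝ) × (κ → ℝ)} (hq : q ∈ dualDomain C) :
    cost C ε V - dual p₁ p₂ C ε q = ∑ i, ∑ j, ε * ((C i j - q.1 i - q.2 j) * V i j / ε - 1
      - Real.log ((C i j - q.1 i - q.2 j) * V i j / ε)) := by
  obtain ⟨hpos, hr, hc⟩ := hV
  have hterm : ∀ i j, ε * ((C i j - q.1 i - q.2 j) * V i j / ε - 1
      - Real.log ((C i j - q.1 i - q.2 j) * V i j / ε)) =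
      (C i j - q.1 i - q.2 j) * V i j - ε * Real.log (C i j - q.1 i - q.2 j)
        - ε * Real.log (V i j) - ε * (1 - Real.log ε) := by
    intro i j
    rw [Real.log_div (mul_pos (hq i j) (hpos i j)).ne' hε.ne',
      Real.log_mul (hq i j).ne' (hpos i j).ne']
    field_simp
    ring
  simp only [hterm, Finset.sum_sub_distrib, sum_slack_mul hr hc, ← Finset.mul_sum,
    Finset.sum_const, Finset.card_univ, nsmul_eq_mul, cost, dual]
  ring

lemma gap_nonneg (hε : 0 < ε) {r : ℝ} (hr : 0 < r) : 0 ≤ ε * (r - 1 - Real.log r) :=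
  mul_nonneg hε.le (sub_nonneg.2 (Real.log_le_sub_one_of_pos hr))

lemma dual_le_cost (hε : 0 < ε) {V : Matrix ι κ ℝ} (hV : V ∈ plans p₁ p₂)
    {q : (ι → ℝ) × (κ → ℝ)} (hq : q ∈ dualDomain C) : dual p₁ p₂ C ε q ≤ cost C ε V := by
  rw [← sub_nonneg, cost_sub_dual hε hV hq]
  exact Finset.sum_nonneg fun i _ => Finset.sum_nonneg fun j _ =>
    gap_nonneg hε (div_pos (mul_pos (hq i j) (hV.1 i j)) hε)

lemma dual_eq_cost_iff (hε : 0 < ε) {V : Matrix ι κ ℝ} (hV : V ∈ plans p₁ p₂)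
    {q : (ι → ℝ) × (κ → ℝ)} (hq : q ∈ dualDomain C) :
    dual p₁ p₂ C ε q = cost C ε V ↔ ∀ i j, (C i j - q.1 i - q.2 j) * V i j = ε := by
  have hr : ∀ i j, 0 < (C i j - q.1 i - q.2 j) * V i j / ε := fun i j =>
    div_pos (mul_pos (hq i j) (hV.1 i j)) hε
  rw [eq_comm, ← sub_eq_zero, cost_sub_dual hε hV hq]
  constructor
  · intro h i j
    rw [Finset.sum_eq_zero_iff_of_nonneg fun i _ => Finset.sum_nonneg fun j _ =>
      gap_nonneg hε (hr i j)] at h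
    have h' := (Finset.sum_eq_zero_iff_of_nonneg fun j _ => gap_nonneg hε (hr i j)).1
      (h i (Finset.mem_univ i)) j (Finset.mem_univ j)
    by_contra hne
    have hlt := Real.log_lt_sub_one_of_pos (hr i j) fun h1 => hne ((div_eq_one_iff_eq hε.ne').1 h1)
    exact (mul_pos hε (sub_pos.2 hlt)).ne' h'
  · intro h
    simp [h, hε.ne']

lemma exists_isMinOn_cost [Nonempty ι] [Nonempty κ] (hp₁ : ∀ i, 0 < p₁ i) (hp₂ : ∀ j, 0 < p₂ j)
    (hbal : ∑ i, p₁ i = ∑ j, p₂ j) (C : Matrix ι κ ℝ) (hε : 0 < ε) :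
    ∃ V ∈ plans p₁ p₂, IsMinOn (cost C ε) (plans p₁ p₂) V := by
  set S := ∑ i, p₁ i with hS
  have hSpos : 0 < S := Finset.sum_pos (fun i _ => hp₁ i) Finset.univ_nonempty
  let V₀ : Matrix ι κ ℝ := fun i j => p₁ i * p₂ j / S
  have hV₀ : V₀ ∈ plans p₁ p₂ := by
    refine ⟨fun i j => div_pos (mul_pos (hp₁ i) (hp₂ j)) hSpos, fun i => ?_, fun j => ?_⟩
    · rw [← Finset.sum_div, ← Finset.mul_sum, ← hbal, mul_div_cancel_right₀ _ hSpos.ne']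
    · rw [← Finset.sum_div, ← Finset.sum_mul, ← hS, mul_div_cancel_left₀ _ hSpos.ne']
  have entry_le : ∀ V : Matrix ι κ ℝ, (∀ i j, 0 ≤ V i j) → (∀ i, ∑ j, V i j = p₁ i) →
      ∀ i j, V i j ≤ S := fun V h0 hr i j =>
    calc V i j ≤ ∑ j, V i j := Finset.single_le_sum (fun j _ => h0 i j) (Finset.mem_univ j)
      _ = p₁ i := hr i
      _ ≤ S := Finset.single_le_sum (fun i _ => (hp₁ i).le) (Finset.mem_univ i)
  set A := (∑ i, ∑ j, |C i j|) * S + ε * S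
  set δ := Real.exp (-(cost C ε V₀ + A) / ε) with hδ
  have lower : ∀ V ∈ plans p₁ p₂, cost C ε V ≤ cost C ε V₀ → ∀ i j, δ ≤ V i j := by
    rintro V ⟨hpos, hr, hc⟩ hle i j
    have h1 : -((∑ i, ∑ j, |C i j|) * S) ≤ ∑ i, ∑ j, C i j * V i j := by
      simp only [Finset.sum_mul, ← Finset.sum_neg_distrib]
      refine Finset.sum_le_sum fun i _ => Finset.sum_le_sum fun j _ => ?_
      have ha := abs_nonneg (C i j)
      have hb := neg_abs_le (C i j)
      have hc := entry_le V (fun i j => (hpos i j).le) hr i j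
      nlinarith [hpos i j]
    have hnn : ∀ i j, 0 ≤ V i j - Real.log (V i j) := fun i j => by
      linarith [Real.log_le_sub_one_of_pos (hpos i j)]
    have h2 : V i j - Real.log (V i j) ≤ ∑ i, ∑ j, (V i j - Real.log (V i j)) :=
      (Finset.single_le_sum (fun j _ => hnn i j) (Finset.mem_univ j)).trans
        (Finset.single_le_sum (f := fun i => ∑ j, (V i j - Real.log (V i j)))
          (fun i _ => Finset.sum_nonneg fun j _ => hnn i j) (Finset.mem_univ i))
    simp only [Finset.sum_sub_distrib, hr] at h2
    rw [hδ, ← Real.le_log_iff_exp_le (hpos i j), div_le_iff₀ hε]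
    have h3 : -Real.log (V i j) - S ≤ -∑ i, ∑ j, Real.log (V i j) := by
      linarith [hpos i j]
    have h4 := mul_le_mul_of_nonneg_left h3 hε.le
    have h5 : cost C ε V = (∑ i, ∑ j, C i j * V i j) + ε * (-∑ i, ∑ j, Real.log (V i j)) := rfl
    linarith
  let K : Set (Matrix ι κ ℝ) :=
    {V | (∀ i j, V i j ∈ Set.Icc δ S) ∧ (∀ i, ∑ j, V i j = p₁ i) ∧ (∀ j, ∑ i, V i j = p₂ j)}
  have hentry : ∀ i j, Continuous fun V : Matrix ι κ ℝ => V i j := fun i j =>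
    (continuous_apply j).comp (continuous_apply i)
  have hbox : IsCompact {V : ι → κ → ℝ | ∀ i j, V i j ∈ Set.Icc δ S} := by
    have h := isCompact_univ_pi fun _ : ι => isCompact_univ_pi fun _ : κ =>
      isCompact_Icc (a := δ) (b := S)
    convert h using 1
    ext V
    simp only [Set.mem_ofPred_eq, Set.mem_univ_pi]
  have hK : IsCompact K := by
    refine hbox.inter_right (t := {V | (∀ i, ∑ j, V i j = p₁ i) ∧ ∀ j, ∑ i, V i j = p₂ j}) ?_
    simp only [Set.ofPred_and, Set.ofPred_forall]
    exact (isClosed_iInter fun i => isClosed_eq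
        (continuous_finsetSum _ fun j _ => hentry i j) continuous_const).inter
      (isClosed_iInter fun j => isClosed_eq
        (continuous_finsetSum _ fun i _ => hentry i j) continuous_const)
  have mem_K : ∀ V ∈ plans p₁ p₂, cost C ε V ≤ cost C ε V₀ → V ∈ K := fun V hV hle =>
    ⟨fun i j => ⟨lower V hV hle i j, entry_le V (fun i j => (hV.1 i j).le) hV.2.1 i j⟩, hV.2⟩
  have hδpos : 0 < δ := Real.exp_pos _
  have hcont : ContinuousOn (cost C ε) K := by
    unfold cost
    refine ContinuousOn.add ?_ (continuousOn_const.mul (ContinuousOn.neg ?_))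
    · exact continuousOn_finsetSum _ fun i _ => continuousOn_finsetSum _ fun j _ =>
        continuousOn_const.mul (hentry i j).continuousOn
    · exact continuousOn_finsetSum _ fun i _ => continuousOn_finsetSum _ fun j _ =>
        (hentry i j).continuousOn.log fun V hV => (hδpos.trans_le (hV.1 i j).1).ne'
  obtain ⟨V, hVK, hmin⟩ := hK.exists_isMinOn ⟨V₀, mem_K V₀ hV₀ le_rfl⟩ hcont
  refine ⟨V, ⟨fun i j => hδpos.trans_le (hVK.1 i j).1, hVK.2⟩, fun W hW => ?_⟩
  by_cases hle : cost C ε W ≤ cost C ε V₀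
  · exact hmin (mem_K W hW hle)
  · exact (hmin (mem_K V₀ hV₀ le_rfl)).trans (not_le.1 hle).le

lemma hasDerivAt_cost_line {V : Matrix ι κ ℝ} (hpos : ∀ i j, 0 < V i j) (E : Matrix ι κ ℝ) :
    HasDerivAt (fun t : ℝ => cost C ε fun i j => V i j + t * E i j)
      (∑ i, ∑ j, (C i j - ε / V i j) * E i j) 0 := by
  have hline : ∀ i j, HasDerivAt (fun t : ℝ => V i j + t * E i j) (E i j) 0 := fun i j => by
    simpa using ((hasDerivAt_id (0 : ℝ)).mul_const (E i j)).const_add (V i j)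
  have hlog : ∀ i j, HasDerivAt (fun t : ℝ => Real.log (V i j + t * E i j))
      (E i j / V i j) 0 := fun i j => by
    simpa using (hline i j).log (by simpa using (hpos i j).ne')
  have h := (HasDerivAt.fun_sum (u := Finset.univ) fun i _ =>
      HasDerivAt.fun_sum (u := Finset.univ) fun j _ => (hline i j).const_mul (C i j)).add
    ((HasDerivAt.fun_sum (u := Finset.univ) fun i _ =>
      HasDerivAt.fun_sum (u := Finset.univ) fun j _ => hlog i j).neg.const_mul ε)
  refine h.congr_deriv ?_
  simp only [sub_mul, Finset.sum_sub_distrib, mul_neg, Finset.mul_sum, ← sub_eq_add_neg]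
  congr 1
  exact Finset.sum_congr rfl fun i _ => Finset.sum_congr rfl fun j _ => by ring

lemma sum_grad_mul_eq_zero {V : Matrix ι κ ℝ} (hV : V ∈ plans p₁ p₂)
    (hmin : IsMinOn (cost C ε) (plans p₁ p₂) V) {E : Matrix ι κ ℝ}
    (hr : ∀ i, ∑ j, E i j = 0) (hc : ∀ j, ∑ i, E i j = 0) :
    ∑ i, ∑ j, (C i j - ε / V i j) * E i j = 0 := by
  refine IsLocalMin.hasDerivAt_eq_zero ?_ (hasDerivAt_cost_line hV.1 E)
  have hpos : ∀ᶠ t : ℝ in nhds 0, ∀ i j, 0 < V i j + t * E i j := by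
    simp only [Filter.eventually_all]
    intro i j
    have hcont : Continuous fun t : ℝ => V i j + t * E i j := by fun_prop
    exact hcont.continuousAt.eventually_const_lt (by simpa using hV.1 i j)
  filter_upwards [hpos] with t ht
  have hmem : (fun i j => V i j + t * E i j : Matrix ι κ ℝ) ∈ plans p₁ p₂ := by
    refine ⟨ht, fun i => ?_, fun j => ?_⟩
    · rw [Finset.sum_add_distrib, ← Finset.mul_sum, hr, hV.2.1 i, mul_zero, add_zero]
    · rw [Finset.sum_add_distrib, ← Finset.mul_sum, hc, hV.2.2 j, mul_zero, add_zero]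
  simpa using show cost C ε V ≤ _ from hmin hmem

lemma exists_potentials [Nonempty ι] [Nonempty κ] (hε : 0 < ε) {V : Matrix ι κ ℝ}
    (hV : V ∈ plans p₁ p₂) (hmin : IsMinOn (cost C ε) (plans p₁ p₂) V) :
    ∃ u ∈ normalizedDomain C, ∀ i j, (C i j - u.1 i - u.2 j) = ε / V i j := by
  classical
  obtain ⟨a⟩ := ‹Nonempty ι›
  obtain ⟨b⟩ := ‹Nonempty κ›
  set W : Matrix ι κ ℝ := fun i j => C i j - ε / V i j with hW
  have hcross : ∀ i j, W i j - W i b - (W a j - W a b) = 0 := by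
    intro i j
    have h := sum_grad_mul_eq_zero hV hmin
      (E := fun k l => ((Pi.single i 1 - Pi.single a 1 : ι → ℝ) k) *
        ((Pi.single j 1 - Pi.single b 1 : κ → ℝ) l))
      (fun k => by rw [← Finset.mul_sum]; simp) (fun l => by rw [← Finset.sum_mul]; simp)
    rw [← h]
    simp [hW, Pi.single_apply, mul_sub, Finset.sum_sub_distrib]
    ring
  set t : ℝ := (∑ j, (W a j - W a b) - ∑ i, W i b) / (Fintype.card ι + Fintype.card κ) with ht
  have hcard : (Fintype.card ι + Fintype.card κ : ℝ) ≠ 0 := by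
    have : 0 < Fintype.card ι := Fintype.card_pos_iff.2 ⟨a⟩
    positivity
  have hslack : ∀ i j, C i j - (W i b + t) - (W a j - W a b - t) = ε / V i j := by
    intro i j
    have h := hcross i j
    have h' : W i j = C i j - ε / V i j := rfl
    linarith
  refine ⟨(fun i => W i b + t, fun j => W a j - W a b - t), ⟨fun i j => ?_, ?_⟩, hslack⟩
  · rw [hslack]
    exact div_pos hε (hV.1 i j)
  · have h := div_mul_cancel₀ (∑ j, (W a j - W a b) - ∑ i, W i b) hcard
    rw [← ht] at h
    rw [Finset.sum_add_distrib, Finset.sum_sub_distrib (f := fun j => W a j - W a b)]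
    simp only [Finset.sum_const, Finset.card_univ, nsmul_eq_mul]
    linarith

lemma shift_eq_zero [Nonempty ι] {u : (ι → ℝ) × (κ → ℝ)} {t : ℝ}
    (hu : ∑ i, u.1 i = ∑ j, u.2 j) (ht : ∑ i, (u.1 i + t) = ∑ j, (u.2 j - t)) : t = 0 := by
  simp only [Finset.sum_add_distrib, Finset.sum_sub_distrib, Finset.sum_const, Finset.card_univ,
    nsmul_eq_mul, hu] at ht
  have hcard : (0 : ℝ) < Fintype.card ι + Fintype.card κ := by
    have : 0 < Fintype.card ι := Fintype.card_pos
    positivity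
  have h : (Fintype.card ι + Fintype.card κ : ℝ) * t = 0 := by linarith
  exact (mul_eq_zero.1 h).resolve_left hcard.ne'

lemma eq_of_add_eq [Nonempty ι] [Nonempty κ] {u q : (ι → ℝ) × (κ → ℝ)}
    (hu : ∑ i, u.1 i = ∑ j, u.2 j) (hq : ∑ i, q.1 i = ∑ j, q.2 j)
    (h : ∀ i j, q.1 i + q.2 j = u.1 i + u.2 j) : q = u := by
  obtain ⟨t, rfl⟩ := eq_shift_of_add_eq h
  simp [shift_eq_zero hu hq]

lemma convex_normalizedDomain (C : Matrix ι κ ℝ) : Convex ℝ (normalizedDomain C) := by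
  intro q hq r hr a b ha hb hab
  refine ⟨convex_dualDomain C hq.1 hr.1 ha hb hab, ?_⟩
  simp only [Prod.fst_add, Prod.snd_add, Prod.smul_fst, Prod.smul_snd, Pi.add_apply,
    Pi.smul_apply, smul_eq_mul, Finset.sum_add_distrib, ← Finset.mul_sum, hq.2, hr.2]

lemma dual_combo_sub {a b : ℝ} (hab : a + b = 1) (q r : (ι → ℝ) × (κ → ℝ)) :
    dual p₁ p₂ C ε (a • q + b • r) - (a • dual p₁ p₂ C ε q + b • dual p₁ p₂ C ε r) =
      ε * (∑ i, ∑ j, Real.log (a • (C i j - q.1 i - q.2 j) + b • (C i j - r.1 i - r.2 j)) -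
        ∑ i, ∑ j, (a • Real.log (C i j - q.1 i - q.2 j) +
          b • Real.log (C i j - r.1 i - r.2 j))) := by
  simp only [dual, slack_combo hab]
  simp only [Prod.fst_add, Prod.snd_add, Prod.smul_fst, Prod.smul_snd, Pi.add_apply,
    Pi.smul_apply, smul_eq_mul, mul_add, Finset.sum_add_distrib, mul_left_comm _ a,
    mul_left_comm _ b, ← Finset.mul_sum]
  linear_combination
    (-((Fintype.card ι : ℝ) * Fintype.card κ * ε * (1 - Real.log ε))) * hab

lemma log_combo_le {x y a b : ℝ} (hx : 0 < x) (hy : 0 < y) (ha : 0 ≤ a) (hb : 0 ≤ b)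
    (hab : a + b = 1) : a • Real.log x + b • Real.log y ≤ Real.log (a • x + b • y) :=
  strictConcaveOn_log_Ioi.concaveOn.2 hx hy ha hb hab

lemma concaveOn_dual (hε : 0 < ε) : ConcaveOn ℝ (dualDomain C) (dual p₁ p₂ C ε) := by
  refine ⟨convex_dualDomain C, fun q hq r hr a b ha hb hab => ?_⟩
  rw [← sub_nonneg, dual_combo_sub hab]
  exact mul_nonneg hε.le (sub_nonneg.2 (Finset.sum_le_sum fun i _ => Finset.sum_le_sum fun j _ =>
    log_combo_le (hq i j) (hr i j) ha hb hab))

lemma strictConcaveOn_dual [Nonempty ι] [Nonempty κ] (hε : 0 < ε) :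
    StrictConcaveOn ℝ (normalizedDomain C) (dual p₁ p₂ C ε) := by
  refine ⟨convex_normalizedDomain C, fun q hq r hr hne a b ha hb hab => ?_⟩
  have hle : ∀ i j, _ := fun i j => log_combo_le (hq.1 i j) (hr.1 i j) ha.le hb.le hab
  obtain ⟨i, j, hij⟩ : ∃ i j, q.1 i + q.2 j ≠ r.1 i + r.2 j := by
    by_contra! h
    exact hne (eq_of_add_eq hr.2 hq.2 h)
  rw [← sub_pos, dual_combo_sub hab]
  refine mul_pos hε (sub_pos.2 (Finset.sum_lt_sum (fun i _ => Finset.sum_le_sum fun j _ => hle i j)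
    ⟨i, Finset.mem_univ i, Finset.sum_lt_sum (fun j _ => hle i j) ⟨j, Finset.mem_univ j, ?_⟩⟩))
  exact strictConcaveOn_log_Ioi.2 (hq.1 i j) (hr.1 i j) (fun h => hij (by linarith)) ha hb hab

theorem duality [Nonempty ι] [Nonempty κ] (hp₁ : ∀ i, 0 < p₁ i) (hp₂ : ∀ j, 0 < p₂ j)
    (hbal : ∑ i, p₁ i = ∑ j, p₂ j) (C : Matrix ι κ ℝ) (hε : 0 < ε) :
    IsGreatest (dual p₁ p₂ C ε '' dualDomain C) (sInf (cost C ε '' plans p₁ p₂)) ∧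
    IsGreatest (dual p₁ p₂ C ε '' normalizedDomain C) (sInf (cost C ε '' plans p₁ p₂)) ∧
    ∃ u : (ι → ℝ) × (κ → ℝ),
      u ∈ normalizedDomain C ∧
      ((fun i j => ε / (C i j - u.1 i - u.2 j)) : Matrix ι κ ℝ) ∈ plans p₁ p₂ ∧
      (∀ V ∈ plans p₁ p₂, cost C ε (fun i j => ε / (C i j - u.1 i - u.2 j)) ≤ cost C ε V) ∧
      {q ∈ dualDomain C | dual p₁ p₂ C ε q = sInf (cost C ε '' plans p₁ p₂)}
        = {q | ∃ t : ℝ, q = (fun i => u.1 i + t, fun j => u.2 j - t)} ∧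
      {q | ∃ t : ℝ, q = (fun i => u.1 i + t, fun j => u.2 j - t)} ∩ normalizedDomain C = {u} := by
  obtain ⟨V, hV, hmin⟩ := exists_isMinOn_cost hp₁ hp₂ hbal C hε
  obtain ⟨u, hu, hslack⟩ := exists_potentials hε hV hmin
  have hτ : sInf (cost C ε '' plans p₁ p₂) = cost C ε V :=
    IsLeast.csInf_eq ⟨Set.mem_image_of_mem _ hV, Set.forall_mem_image.2 fun W hW => hmin hW⟩
  have hVu : (fun i j => ε / (C i j - u.1 i - u.2 j) : Matrix ι κ ℝ) = V := by
    ext i j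
    rw [hslack, div_div_cancel₀ hε.ne']
  have hdual : dual p₁ p₂ C ε u = cost C ε V :=
    (dual_eq_cost_iff hε hV hu.1).2 fun i j => by
      rw [hslack, div_mul_cancel₀ _ (hV.1 i j).ne']
  rw [hτ]
  refine ⟨⟨⟨u, hu.1, hdual⟩, Set.forall_mem_image.2 fun q hq => dual_le_cost hε hV hq⟩,
    ⟨⟨u, hu, hdual⟩, Set.forall_mem_image.2 fun q hq => dual_le_cost hε hV hq.1⟩,
    u, hu, hVu.symm ▸ hV, fun W hW => hVu.symm ▸ hmin hW, ?_, ?_⟩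
  · ext q
    constructor
    · rintro ⟨hq, hqV⟩
      rw [dual_eq_cost_iff hε hV hq] at hqV
      refine eq_shift_of_add_eq fun i j => ?_
      have h := hslack i j
      have h' := (eq_div_iff (hV.1 i j).ne').2 (hqV i j)
      linarith
    · rintro ⟨t, rfl⟩
      have hs : ∀ i j, C i j - (u.1 i + t) - (u.2 j - t) = ε / V i j := fun i j => by
        rw [← hslack]; ring
      have hq : ((fun i => u.1 i + t, fun j => u.2 j - t) : (ι → ℝ) × (κ → ℝ)) ∈ dualDomain C :=
        fun i j => by
          rw [hs]
          exact div_pos hε (hV.1 i j)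
      exact ⟨hq, (dual_eq_cost_iff hε hV hq).2 fun i j => by
        rw [hs, div_mul_cancel₀ _ (hV.1 i j).ne']⟩
  · ext q
    constructor
    · rintro ⟨⟨t, rfl⟩, -, hq⟩
      simp [shift_eq_zero hu.2 hq]
    · rintro rfl
      exact ⟨⟨0, by simp⟩, hu⟩

end BarrierTransport


/-- Duality for the barrier relaxation of the classical bi-partite OTP (Theorem 1.1):
the dual function `φ` is concave on `D̂`, strictly concave on `D`, its maximum over `D̂`
(and over `D`) equals `τ_β(C,P,ε)`, and the maximum is attained exactly on the line
`L = {(u₁,u₂) + t(𝟙,−𝟙)}` which meets `D` at the unique point `(u₁,u₂)`, the potentials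
of the unique barrier-relaxed minimizer. -/
theorem stmt_4 (n₁ n₂ : ℕ) (hn₁ : 1 < n₁) (hn₂ : 1 < n₂)
    (p₁ : Fin n₁ → ℝ) (p₂ : Fin n₂ → ℝ)
    (hp₁ : ∀ i, 0 < p₁ i) (hp₂ : ∀ j, 0 < p₂ j)
    (hbal : ∑ i, p₁ i = ∑ j, p₂ j)
    (C : Matrix (Fin n₁) (Fin n₂) ℝ) (ε : ℝ) (hε : 0 < ε) :
    let Vo : Set (Matrix (Fin n₁) (Fin n₂) ℝ) :=
      {V | (∀ i j, 0 < V i j) ∧ (∀ i, ∑ j, V i j = p₁ i) ∧ (∀ j, ∑ i, V i j = p₂ j)}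
    let obj : Matrix (Fin n₁) (Fin n₂) ℝ → ℝ := fun V =>
      (∑ i, ∑ j, C i j * V i j) + ε * (-∑ i, ∑ j, Real.log (V i j))
    let τβ : ℝ := sInf (obj '' Vo)
    let Dhat : Set ((Fin n₁ → ℝ) × (Fin n₂ → ℝ)) :=
      {q | ∀ i j, 0 < C i j - q.1 i - q.2 j}
    let D : Set ((Fin n₁ → ℝ) × (Fin n₂ → ℝ)) :=
      {q | q ∈ Dhat ∧ ∑ i, q.1 i = ∑ j, q.2 j}
    let φ : (Fin n₁ → ℝ) × (Fin n₂ → ℝ) → ℝ := fun q =>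
      (∑ i, p₁ i * q.1 i) + (∑ j, p₂ j * q.2 j)
        - ε * (-∑ i, ∑ j, Real.log (C i j - q.1 i - q.2 j))
        + (n₁ : ℝ) * n₂ * ε * (1 - Real.log ε)
    ConcaveOn ℝ Dhat φ ∧ StrictConcaveOn ℝ D φ ∧
    IsGreatest (φ '' Dhat) τβ ∧ IsGreatest (φ '' D) τβ ∧
    ∃ u : (Fin n₁ → ℝ) × (Fin n₂ → ℝ),
      u ∈ D ∧
      ((fun i j => ε / (C i j - u.1 i - u.2 j)) : Matrix (Fin n₁) (Fin n₂) ℝ) ∈ Vo ∧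
      (∀ V ∈ Vo, obj (fun i j => ε / (C i j - u.1 i - u.2 j)) ≤ obj V) ∧
      {q ∈ Dhat | φ q = τβ}
        = {q | ∃ t : ℝ, q = (fun i => u.1 i + t, fun j => u.2 j - t)} ∧
      {q | ∃ t : ℝ, q = (fun i => u.1 i + t, fun j => u.2 j - t)} ∩ D = {u} := by
  have : NeZero n₁ := ⟨by omega⟩
  have : NeZero n₂ := ⟨by omega⟩
  intro Vo obj τβ Dhat D φ
  have hφ : φ = BarrierTransport.dual p₁ p₂ C ε := by
    funext q
    simp only [φ, BarrierTransport.dual, Fintype.card_fin]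
  rw [hφ]
  exact ⟨BarrierTransport.concaveOn_dual hε, BarrierTransport.strictConcaveOn_dual hε,
    BarrierTransport.duality hp₁ hp₂ hbal C hε⟩
end

section
/- Let n₁,n₂ ≥ 2, 0 ≠ C ∈ ℝ^{n₁×n₂}, c = max_{j₁,j₂} |c_{j₁,j₂}|, c_min = min_{j₁,j₂} c_{j₁,j₂}, and let p₁ ∈ Δ^{n₁}, p₂ ∈ Δ^{n₂} be probability vectors with all entries positive. Suppose (x,y) ∈ ℝ^{n₁}×ℝ^{n₂} satisfies: C − x𝟙_{n₂}ᵀ − 𝟙_{n₁}yᵀ ≥ 0 entrywise, p₁ᵀx + p₂ᵀy ≥ c_min, and 𝟙_{n₁}ᵀx = 𝟙_{n₂}ᵀy. Then Σ_{j₁,j₂} (x_{j₁} + y_{j₂})² < n₁n₂·(2c/((min_{j₁} p_{j₁,1})(min_{j₂} p_{j₂,2})))², and consequently √(‖x‖² + ‖y‖²) < √(max(n₁,n₂))·2c/((min_{j₁} p_{j₁,1})(min_{j₂} p_{j₂,2})). -/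
/-- If `x i + y j ≤ c` throughout, then each weighted slack `p i * q j * (c - (x i + y j))` is at
most the mean slack under the product of the probability vectors `p` and `q`. -/
theorem mul_sub_le_of_weights {ι κ : Type*} [Fintype ι] [Fintype κ]
    {p : ι → ℝ} {q : κ → ℝ} (hp : ∀ i, 0 ≤ p i) (hq : ∀ j, 0 ≤ q j)
    (hsp : ∑ i, p i = 1) (hsq : ∑ j, q j = 1) {x : ι → ℝ} {y : κ → ℝ} {c : ℝ}
    (h : ∀ i j, x i + y j ≤ c) (i : ι) (j : κ) :
    p i * q j * (c - (x i + y j)) ≤ c - (∑ i, p i * x i + ∑ j, q j * y j) := by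
  have hnn : ∀ i j, 0 ≤ p i * q j * (c - (x i + y j)) := fun i j =>
    mul_nonneg (mul_nonneg (hp i) (hq j)) (sub_nonneg.2 (h i j))
  have hinner : ∀ i, ∑ j, p i * q j * (c - (x i + y j))
      = p i * c - p i * x i - p i * ∑ j, q j * y j := by
    intro i
    have : ∀ j, p i * q j * (c - (x i + y j))
        = (p i * c - p i * x i) * q j - p i * (q j * y j) := fun j => by ring
    simp_rw [this, Finset.sum_sub_distrib, ← Finset.mul_sum, hsq]
    ring
  calc p i * q j * (c - (x i + y j))
      ≤ ∑ j, p i * q j * (c - (x i + y j)) :=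
        Finset.single_le_sum (f := fun j => p i * q j * (c - (x i + y j)))
          (fun j _ => hnn i j) (Finset.mem_univ j)
    _ ≤ ∑ i, ∑ j, p i * q j * (c - (x i + y j)) :=
        Finset.single_le_sum (f := fun i => ∑ j, p i * q j * (c - (x i + y j)))
          (fun i _ => Finset.sum_nonneg fun j _ => hnn i j) (Finset.mem_univ i)
    _ = c - (∑ i, p i * x i + ∑ j, q j * y j) := by
        simp_rw [hinner, Finset.sum_sub_distrib, ← Finset.sum_mul, hsp]
        ring

theorem sum_sum_add_sq {ι κ : Type*} [Fintype ι] [Fintype κ] (x : ι → ℝ) (y : κ → ℝ) :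
    ∑ i, ∑ j, (x i + y j) ^ 2 = Fintype.card κ * ∑ i, x i ^ 2
      + Fintype.card ι * ∑ j, y j ^ 2 + 2 * (∑ i, x i) * ∑ j, y j := by
  have hinner : ∀ i, ∑ j, (x i + y j) ^ 2
      = Fintype.card κ * x i ^ 2 + ∑ j, y j ^ 2 + x i * (2 * ∑ j, y j) := by
    intro i
    simp_rw [add_sq, Finset.sum_add_distrib, ← Finset.mul_sum]
    simp
    ring
  simp_rw [hinner, Finset.sum_add_distrib, ← Finset.mul_sum, ← Finset.sum_mul]
  simp
  ring

/-- A priori bound on the dual variables of the bi-partite OTP: if `C − x𝟙ᵀ − 𝟙yᵀ ≥ 0`,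
`p₁ᵀx + p₂ᵀy ≥ c_min` and `𝟙ᵀx = 𝟙ᵀy`, then
`Σ (x_{j₁}+y_{j₂})² < n₁n₂ (2c/(min p₁ · min p₂))²` and
`√(‖x‖²+‖y‖²) < √(max(n₁,n₂)) · 2c/(min p₁ · min p₂)`. -/
theorem stmt_7 (n₁ n₂ : ℕ) (hn₁ : 2 ≤ n₁) (hn₂ : 2 ≤ n₂)
    (C : Matrix (Fin n₁) (Fin n₂) ℝ) (hC : C ≠ 0)
    (c : ℝ) (hc : IsGreatest {v : ℝ | ∃ i j, v = |C i j|} c)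
    (cmin : ℝ) (hcmin : IsLeast {v : ℝ | ∃ i j, v = C i j} cmin)
    (p₁ : Fin n₁ → ℝ) (p₂ : Fin n₂ → ℝ)
    (hp₁ : ∀ i, 0 < p₁ i) (hp₂ : ∀ j, 0 < p₂ j)
    (hs₁ : ∑ i, p₁ i = 1) (hs₂ : ∑ j, p₂ j = 1)
    (pm₁ pm₂ : ℝ) (hpm₁ : IsLeast {v : ℝ | ∃ i, v = p₁ i} pm₁)
    (hpm₂ : IsLeast {v : ℝ | ∃ j, v = p₂ j} pm₂)
    (x : Fin n₁ → ℝ) (y : Fin n₂ → ℝ)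
    (hpos : ∀ i j, 0 ≤ C i j - x i - y j)
    (hpay : (∑ i, p₁ i * x i) + (∑ j, p₂ j * y j) ≥ cmin)
    (hbalxy : ∑ i, x i = ∑ j, y j) :
    (∑ i, ∑ j, (x i + y j) ^ 2 < (n₁ : ℝ) * n₂ * (2 * c / (pm₁ * pm₂)) ^ 2) ∧
    Real.sqrt ((∑ i, (x i) ^ 2) + ∑ j, (y j) ^ 2)
      < Real.sqrt (max n₁ n₂ : ℕ) * (2 * c / (pm₁ * pm₂)) := by
  obtain ⟨⟨i₁, hi₁⟩, hmin₁⟩ := hpm₁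
  obtain ⟨⟨j₂, hj₂⟩, hmin₂⟩ := hpm₂
  have hpm₁pos : 0 < pm₁ := hi₁ ▸ hp₁ i₁
  have hpm₂pos : 0 < pm₂ := hj₂ ▸ hp₂ j₂
  have hpm₁le : pm₁ ≤ 1 := by
    rw [hi₁, ← hs₁]
    exact Finset.single_le_sum (fun i _ => (hp₁ i).le) (Finset.mem_univ i₁)
  have hpm₂le : pm₂ ≤ 1 := by
    rw [hj₂, ← hs₂]
    exact Finset.single_le_sum (fun j _ => (hp₂ j).le) (Finset.mem_univ j₂)
  have habs : ∀ i j, |C i j| ≤ c := fun i j => hc.2 ⟨i, j, rfl⟩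
  have hcpos : 0 < c := by
    by_contra! hle
    refine hC (Matrix.ext fun i j => ?_)
    exact abs_nonpos_iff.1 ((habs i j).trans hle)
  have hcmin_ge : -c ≤ cmin := by
    obtain ⟨i, j, hij⟩ := hcmin.1
    rw [hij]
    exact (abs_le.1 (habs i j)).1
  have hle : ∀ i j, x i + y j ≤ c := fun i j => by
    linarith [hpos i j, (abs_le.1 (habs i j)).2]
  have hprod : 0 < pm₁ * pm₂ := mul_pos hpm₁pos hpm₂pos
  set B := 2 * c / (pm₁ * pm₂) with hB
  have hBge : 2 * c ≤ B :=
    le_div_self (by positivity) hprod (mul_le_one₀ hpm₁le hpm₂pos.le hpm₂le)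
  have hBpos : 0 < B := by linarith
  have hlow : ∀ i j, c - (x i + y j) ≤ B := by
    intro i j
    rw [hB, le_div_iff₀ hprod]
    have h₁ := mul_sub_le_of_weights (fun i => (hp₁ i).le) (fun j => (hp₂ j).le) hs₁ hs₂ hle i j
    have h₂ : pm₁ * pm₂ ≤ p₁ i * p₂ j :=
      mul_le_mul (hmin₁ ⟨i, rfl⟩) (hmin₂ ⟨j, rfl⟩) hpm₂pos.le (hp₁ i).le
    have h₃ := mul_le_mul_of_nonneg_right h₂ (sub_nonneg.2 (hle i j))
    linarith
  have hsq : ∀ i j, (x i + y j) ^ 2 < B ^ 2 := fun i j =>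
    sq_lt_sq' (by linarith [hlow i j]) (by linarith [hle i j])
  have hsum : ∑ i, ∑ j, (x i + y j) ^ 2 < (n₁ : ℝ) * n₂ * B ^ 2 := by
    calc ∑ i, ∑ j, (x i + y j) ^ 2 < ∑ _i : Fin n₁, ∑ _j : Fin n₂, B ^ 2 :=
          Finset.sum_lt_sum_of_nonempty ⟨i₁, Finset.mem_univ _⟩ fun i _ =>
            Finset.sum_lt_sum_of_nonempty ⟨j₂, Finset.mem_univ _⟩ fun j _ => hsq i j
      _ = (n₁ : ℝ) * n₂ * B ^ 2 := by simp [mul_assoc]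
  refine ⟨hsum, ?_⟩
  have hminpos : (0 : ℝ) < (min n₁ n₂ : ℕ) := by
    exact_mod_cast lt_min (by omega : 0 < n₁) (by omega : 0 < n₂)
  have hmm : (n₁ : ℝ) * n₂ = (min n₁ n₂ : ℕ) * (max n₁ n₂ : ℕ) := by
    exact_mod_cast (min_mul_max n₁ n₂).symm
  have hm₁ : ((min n₁ n₂ : ℕ) : ℝ) ≤ n₁ := by exact_mod_cast min_le_left n₁ n₂
  have hm₂ : ((min n₁ n₂ : ℕ) : ℝ) ≤ n₂ := by exact_mod_cast min_le_right n₁ n₂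
  have hx : 0 ≤ ∑ i, x i ^ 2 := Finset.sum_nonneg fun i _ => sq_nonneg _
  have hy : 0 ≤ ∑ j, y j ^ 2 := Finset.sum_nonneg fun j _ => sq_nonneg _
  have hnorm : ∑ i, x i ^ 2 + ∑ j, y j ^ 2 < (max n₁ n₂ : ℕ) * B ^ 2 := by
    rw [sum_sum_add_sq, hbalxy, hmm, Fintype.card_fin, Fintype.card_fin] at hsum
    refine lt_of_mul_lt_mul_left ?_ hminpos.le
    linarith [mul_le_mul_of_nonneg_right hm₂ hx, mul_le_mul_of_nonneg_right hm₁ hy,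
      mul_self_nonneg (∑ j, y j)]
  calc √(∑ i, x i ^ 2 + ∑ j, y j ^ 2) < √((max n₁ n₂ : ℕ) * B ^ 2) :=
        Real.sqrt_lt_sqrt (add_nonneg hx hy) hnorm
    _ = √(max n₁ n₂ : ℕ) * B := by
        rw [Real.sqrt_mul (Nat.cast_nonneg _), Real.sqrt_sq hBpos.le]
end

section
/- Let n₁,n₂ ≥ 2, C ∈ ℝ^{n₁×n₂}, c_min = min_{j₁,j₂} c_{j₁,j₂}. Set x₀ = (t/n₁)𝟙_{n₁}, y₀ = (t/n₂)𝟙_{n₂} with t = n₁n₂(−1 + c_min)/(n₁+n₂), let r > 1, and let D = {(x,y) : C − x𝟙_{n₂}ᵀ − 𝟙_{n₁}yᵀ entrywise positive, 𝟙_{n₁}ᵀx = 𝟙_{n₂}ᵀy} and D₁ = D ∩ B_o((x₀,y₀),r), the intersection with the open Euclidean ball of radius r around (x₀,y₀). Then (x₀,y₀) ∈ D, and every boundary point (x,y) of D₁ satisfies ‖(x₀,y₀) − (x,y)‖ ≥ 1/√2. -/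
/-- The centered point `(x₀,y₀)` lies in the dual domain `D`, and every (relative)
boundary point of `D₁ = D ∩ B_o((x₀,y₀),r)` (a point in the closure of `D₁` that is also
in the closure of the complement of `D₁` within the balance hyperplane `H`) is at
Euclidean distance at least `1/√2` from `(x₀,y₀)`. -/
theorem stmt_8 (n₁ n₂ : ℕ) (hn₁ : 2 ≤ n₁) (hn₂ : 2 ≤ n₂)
    (C : Matrix (Fin n₁) (Fin n₂) ℝ)
    (cmin : ℝ) (hcmin : IsLeast {v : ℝ | ∃ i j, v = C i j} cmin)
    (r : ℝ) (hr : 1 < r) :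
    let t : ℝ := (n₁ : ℝ) * n₂ * (-1 + cmin) / ((n₁ : ℝ) + n₂)
    let x₀ : Fin n₁ → ℝ := fun _ => t / n₁
    let y₀ : Fin n₂ → ℝ := fun _ => t / n₂
    let dist2 : (Fin n₁ → ℝ) × (Fin n₂ → ℝ) → ℝ := fun q =>
      (∑ i, (q.1 i - x₀ i) ^ 2) + ∑ j, (q.2 j - y₀ j) ^ 2
    let H : Set ((Fin n₁ → ℝ) × (Fin n₂ → ℝ)) := {q | ∑ i, q.1 i = ∑ j, q.2 j}
    let D : Set ((Fin n₁ → ℝ) × (Fin n₂ → ℝ)) :=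
      {q | (∀ i j, 0 < C i j - q.1 i - q.2 j) ∧ q ∈ H}
    let D₁ : Set ((Fin n₁ → ℝ) × (Fin n₂ → ℝ)) := D ∩ {q | dist2 q < r ^ 2}
    (x₀, y₀) ∈ D ∧
    ∀ q, q ∈ closure D₁ → q ∈ closure (H \ D₁) →
      1 / Real.sqrt 2 ≤ Real.sqrt (dist2 q) := by
  intro t x₀ y₀ dist2 H D D₁
  have h₁ : (0 : ℝ) < n₁ := by exact_mod_cast (by omega : 0 < n₁)
  have h₂ : (0 : ℝ) < n₂ := by exact_mod_cast (by omega : 0 < n₂)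
  have hsum : t / n₁ + t / n₂ = cmin - 1 := by
    simp only [t]
    field_simp
    ring
  have hle (i : Fin n₁) (j : Fin n₂) : cmin ≤ C i j := hcmin.2 ⟨i, j, rfl⟩
  refine ⟨⟨fun i j => ?_, ?_⟩, fun q _ hq => ?_⟩
  · have := hle i j
    simp only [x₀, y₀]
    linarith
  · simp only [H, x₀, y₀, Set.mem_ofPred_eq, Finset.sum_const, Finset.card_univ,
      Fintype.card_fin, nsmul_eq_mul]
    field_simp
  · have hclosed : IsClosed {p | 1 / 2 ≤ dist2 p} :=
      isClosed_le continuous_const (by simp only [dist2]; fun_prop)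
    have hsub : H \ D₁ ⊆ {p | 1 / 2 ≤ dist2 p} := by
      rintro p ⟨hpH, hpD⟩
      by_cases hball : dist2 p < r ^ 2
      · have hp : ∃ i j, C i j - p.1 i - p.2 j ≤ 0 := by
          by_contra! h
          exact hpD ⟨⟨h, hpH⟩, hball⟩
        obtain ⟨i, j, hij⟩ := hp
        have hx : (p.1 i - x₀ i) ^ 2 ≤ ∑ i, (p.1 i - x₀ i) ^ 2 :=
          Finset.single_le_sum (f := fun i => (p.1 i - x₀ i) ^ 2)
            (fun _ _ => sq_nonneg _) (Finset.mem_univ i)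
        have hy : (p.2 j - y₀ j) ^ 2 ≤ ∑ j, (p.2 j - y₀ j) ^ 2 :=
          Finset.single_le_sum (f := fun j => (p.2 j - y₀ j) ^ 2)
            (fun _ _ => sq_nonneg _) (Finset.mem_univ j)
        have hab : 1 ≤ (p.1 i - x₀ i) + (p.2 j - y₀ j) := by
          have := hle i j
          simp only [x₀, y₀]
          linarith
        simp only [Set.mem_ofPred_eq, dist2]
        nlinarith [sq_nonneg ((p.1 i - x₀ i) - (p.2 j - y₀ j))]
      · simp only [Set.mem_ofPred_eq]
        nlinarith
    have hdist : 1 / 2 ≤ dist2 q := closure_minimal hsub hclosed hq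
    rw [← Real.sqrt_one, ← Real.sqrt_div zero_le_one]
    exact Real.sqrt_le_sqrt hdist
end

section
/- Let d ≥ 2 be an integer and x_i = (x_{1,i},…,x_{n_i,i})ᵀ ∈ ℝ^{n_i} for i ∈ [d]. Assume the balance condition 𝟙_{n_i}ᵀx_i = 𝟙_{n_{i+1}}ᵀx_{i+1} for i ∈ [d−1]. Then (n₁⋯n_d / max_i n_i)·Σ_{i=1}^d ‖x_i‖² ≤ Σ_{j₁,…,j_d} (x_{j₁,1} + ⋯ + x_{j_d,d})² ≤ Σ_{i=1}^d (d·n₁⋯n_d / n_i)·‖x_i‖² ≤ (d·n₁⋯n_d / max_i n_i)·Σ_{i=1}^d ‖x_i‖². -/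
/-- Summing over all choice functions a product that only involves the coordinates in `S`. -/
theorem sum_pi_prod_mem {ι : Type*} [Fintype ι] [DecidableEq ι] {α : ι → Type*}
    [∀ i, Fintype (α i)] (S : Finset ι) (f : (i : ι) → α i → ℝ) :
    ∑ j : (i : ι) → α i, ∏ i ∈ S, f i (j i) =
      (∏ i ∈ S, ∑ k, f i k) * ∏ i ∈ Sᶜ, (Fintype.card (α i) : ℝ) := by
  have h := Finset.prod_univ_sum (fun i => (Finset.univ : Finset (α i)))
    (fun i k => if i ∈ S then f i k else 1)
  rw [Fintype.piFinset_univ] at h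
  simp only [Finset.prod_ite_mem, Finset.univ_inter] at h
  rw [← h, ← Finset.prod_mul_prod_compl S]
  congr 1
  · exact Finset.prod_congr rfl fun i hi => by simp [hi]
  · exact Finset.prod_congr rfl fun i hi => by simp [Finset.mem_compl.mp hi]

/-- Summing over all choice functions a function of a single coordinate. -/
theorem sum_pi_apply_eq {ι : Type*} [Fintype ι] [DecidableEq ι] {α : ι → Type*}
    [∀ i, Fintype (α i)] (f : (i : ι) → α i → ℝ) (i : ι) :
    ∑ j : (i : ι) → α i, f i (j i) =
      (∏ i', (Fintype.card (α i') : ℝ)) / Fintype.card (α i) * ∑ k, f i k := by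
  have h := sum_pi_prod_mem {i} f
  simp only [Finset.prod_singleton] at h
  rw [h, ← Finset.prod_mul_prod_compl {i} (fun i' => (Fintype.card (α i') : ℝ)),
    Finset.prod_singleton]
  rcases isEmpty_or_nonempty (α i) with hi | hi
  · simp
  · have : (Fintype.card (α i) : ℝ) ≠ 0 := by exact_mod_cast Fintype.card_ne_zero
    field_simp

/-- Distinct coordinates with equal sums have nonnegative correlation. -/
theorem sum_pi_mul_apply_nonneg {ι : Type*} [Fintype ι] [DecidableEq ι] {α : ι → Type*}
    [∀ i, Fintype (α i)] (x : (i : ι) → α i → ℝ) {i i' : ι}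
    (h : ∑ k, x i k = ∑ k, x i' k) :
    0 ≤ ∑ j : (i : ι) → α i, x i (j i) * x i' (j i') := by
  rcases eq_or_ne i i' with rfl | hne
  · exact Finset.sum_nonneg fun j _ => mul_self_nonneg _
  · have hp := sum_pi_prod_mem {i, i'} x
    simp only [Finset.prod_pair hne] at hp
    rw [hp, h]
    exact mul_nonneg (mul_self_nonneg _) (Finset.prod_nonneg fun _ _ => Nat.cast_nonneg _)

/-- If all coordinate vectors have equal sums, dropping the cross terms decreases the sum of
squares. -/
theorem sum_pi_sum_sq_le_sum_pi_sq_sum {ι : Type*} [Fintype ι] [DecidableEq ι] {α : ι → Type*}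
    [∀ i, Fintype (α i)] (x : (i : ι) → α i → ℝ)
    (h : ∀ i i', ∑ k, x i k = ∑ k, x i' k) :
    ∑ i, ∑ j : (i : ι) → α i, x i (j i) ^ 2 ≤
      ∑ j : (i : ι) → α i, (∑ i, x i (j i)) ^ 2 := by
  simp only [pow_two (∑ i, _), Finset.sum_mul_sum]
  rw [Finset.sum_comm (s := (Finset.univ : Finset ((i : ι) → α i)))]
  refine Finset.sum_le_sum fun i _ => ?_
  rw [Finset.sum_comm (s := (Finset.univ : Finset ((i : ι) → α i)))]
  simp only [pow_two]
  exact Finset.single_le_sum (f := fun i' => ∑ j : (i : ι) → α i, x i (j i) * x i' (j i'))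
    (fun i' _ => sum_pi_mul_apply_nonneg x (h i i')) (Finset.mem_univ i)

/-- Quadratic form estimate for balanced vectors (Lemma 1.4): if
`𝟙ᵀx_i = 𝟙ᵀx_{i+1}` for all `i`, then
`(n₁⋯n_d / max_i n_i) Σ_i ‖x_i‖² ≤ Σ_{j₁,…,j_d} (x_{j₁,1}+⋯+x_{j_d,d})²
  ≤ Σ_i (d n₁⋯n_d / n_i) ‖x_i‖²`. -/
theorem stmt_9 (d : ℕ) (hd : 2 ≤ d) (n : Fin d → ℕ)
    (x : (i : Fin d) → Fin (n i) → ℝ)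
    (hbal : ∀ (i : ℕ) (h : i + 1 < d),
      ∑ k, x ⟨i, by omega⟩ k = ∑ k, x ⟨i + 1, h⟩ k) :
    ((∏ i, (n i : ℝ)) / ((Finset.univ.sup n : ℕ) : ℝ)) * ∑ i, ∑ k, (x i k) ^ 2
      ≤ ∑ j : (i : Fin d) → Fin (n i), (∑ i, x i (j i)) ^ 2 ∧
    ∑ j : (i : Fin d) → Fin (n i), (∑ i, x i (j i)) ^ 2
      ≤ ∑ i, ((d : ℝ) * (∏ i', (n i' : ℝ)) / (n i : ℝ)) * ∑ k, (x i k) ^ 2 := by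
  have heq : ∀ i i' : Fin d, ∑ k, x i k = ∑ k, x i' k := by
    have h0 : ∀ (m : ℕ) (hm : m < d), ∑ k, x ⟨m, hm⟩ k = ∑ k, x ⟨0, by omega⟩ k := by
      intro m
      induction m with
      | zero => intro _; rfl
      | succ m ih => intro hm; rw [← hbal m hm, ih]
    exact fun i i' => (h0 i i.2).trans (h0 i' i'.2).symm
  have hsq : ∀ i, ∑ j : (i : Fin d) → Fin (n i), x i (j i) ^ 2 =
      (∏ i', (n i' : ℝ)) / (n i : ℝ) * ∑ k, x i k ^ 2 := fun i => by
    simpa using sum_pi_apply_eq (fun i k => x i k ^ 2) i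
  constructor
  · refine le_trans ?_ (sum_pi_sum_sq_le_sum_pi_sq_sum x heq)
    rw [Finset.mul_sum]
    refine Finset.sum_le_sum fun i _ => ?_
    rw [hsq]
    refine mul_le_mul_of_nonneg_right ?_ (Finset.sum_nonneg fun _ _ => sq_nonneg _)
    rcases Nat.eq_zero_or_pos (n i) with hi | hi
    · have hN : ∏ i', (n i' : ℝ) = 0 := Finset.prod_eq_zero (Finset.mem_univ i) (by simp [hi])
      simp [hN]
    · have hle : n i ≤ Finset.univ.sup n := Finset.le_sup (Finset.mem_univ i)
      gcongr
  · calc ∑ j : (i : Fin d) → Fin (n i), (∑ i, x i (j i)) ^ 2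
        ≤ ∑ j : (i : Fin d) → Fin (n i), (d : ℝ) * ∑ i, x i (j i) ^ 2 :=
          Finset.sum_le_sum fun j _ => by
            simpa using sq_sum_le_card_mul_sum_sq (s := Finset.univ) (f := fun i => x i (j i))
      _ = ∑ i, ((d : ℝ) * (∏ i', (n i' : ℝ)) / (n i : ℝ)) * ∑ k, (x i k) ^ 2 := by
          rw [← Finset.mul_sum, Finset.sum_comm, Finset.mul_sum]
          refine Finset.sum_congr rfl fun i _ => ?_
          rw [hsq]
          ring
end

section
/- Let C ∈ ℝ^{n₁×n₂} and let d₁ ∈ ℝ^{n₁}, d₂ ∈ ℝ^{n₂} be entrywise positive vectors with 𝟙_{n₁}ᵀd₁ = 𝟙_{n₂}ᵀd₂. Then there exists a unique (x,y) ∈ D = {(x,y) : C − x𝟙_{n₂}ᵀ − 𝟙_{n₁}yᵀ entrywise positive, 𝟙_{n₁}ᵀx = 𝟙_{n₂}ᵀy} such that the matrix C(x,y)^{−∘} = [(c_{j₁,j₂} − x_{j₁} − y_{j₂})^{−1}] has row sums equal to the entries of d₁ and column sums equal to the entries of d₂. -/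
open Finset Filter Topology

/-- On a closed set containing a positive point, the function `∑ k, (log (t k) - a k * t k)` with
positive weights `a` attains its maximum over the positive points. -/
theorem exists_pos_isMax_sum_log_sub {ι : Type*} [Fintype ι] {S : Set (ι → ℝ)} (hS : IsClosed S)
    {a p : ι → ℝ} (ha : ∀ k, 0 < a k) (hpS : p ∈ S) (hp : ∀ k, 0 < p k) :
    ∃ s ∈ S, (∀ k, 0 < s k) ∧ ∀ t ∈ S, (∀ k, 0 < t k) →
      ∑ k, (Real.log (t k) - a k * t k) ≤ ∑ k, (Real.log (s k) - a k * s k) := by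
  set f : (ι → ℝ) → ℝ := fun t => ∑ k, (Real.log (t k) - a k * t k) with hf
  set F : (ι → ℝ) → ℝ := fun t => ∏ k, (t k * Real.exp (-(a k * t k))) with hF
  have F_pos : ∀ t : ι → ℝ, (∀ k, 0 < t k) → 0 < F t := fun t ht =>
    prod_pos fun k _ => mul_pos (ht k) (Real.exp_pos _)
  have log_F : ∀ t : ι → ℝ, (∀ k, 0 < t k) → Real.log (F t) = f t := by
    intro t ht
    rw [hF, hf, Real.log_prod fun k _ => (mul_pos (ht k) (Real.exp_pos _)).ne']
    refine sum_congr rfl fun k _ => ?_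
    rw [Real.log_mul (ht k).ne' (Real.exp_pos _).ne', Real.log_exp]
    ring
  set R : ℝ := ∑ k, Real.log (2 / a k) - f p with hR
  set M : ι → ℝ := fun k => 2 * R / a k with hM
  have mem_box : ∀ t : ι → ℝ, (∀ k, 0 < t k) → f p ≤ f t → t ∈ Set.Icc 0 M := by
    intro t ht hle
    have hsum : ∑ k, a k * t k / 2 ≤ R := by
      have : f t ≤ ∑ k, (Real.log (2 / a k) - a k * t k / 2) := by
        refine sum_le_sum fun k _ => ?_
        have h := Real.log_le_sub_one_of_pos (half_pos (mul_pos (ha k) (ht k)))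
        have e : Real.log (t k) = Real.log (2 / a k) + Real.log (a k * t k / 2) := by
          rw [← Real.log_mul (div_pos two_pos (ha k)).ne'
            (half_pos (mul_pos (ha k) (ht k))).ne']
          congr 1
          field_simp [(ha k).ne']
        linarith
      rw [sum_sub_distrib] at this
      linarith
    refine ⟨fun k => (ht k).le, fun k => ?_⟩
    have hk : a k * t k / 2 ≤ ∑ k, a k * t k / 2 :=
      single_le_sum (f := fun k => a k * t k / 2)
        (fun i _ => (half_pos (mul_pos (ha i) (ht i))).le) (mem_univ k)
    rw [hM, le_div_iff₀ (ha k)]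
    linarith
  obtain ⟨s, ⟨hsS, hs0⟩, hmax⟩ := (isCompact_Icc.inter_left hS).exists_isMaxOn
    ⟨p, hpS, mem_box p hp le_rfl⟩ (f := F) (by fun_prop)
  have hFp : F p ≤ F s := hmax ⟨hpS, mem_box p hp le_rfl⟩
  have hs : ∀ k, 0 < s k := by
    intro k
    refine lt_of_le_of_ne (hs0.1 k) fun h => ?_
    have : F s = 0 := prod_eq_zero (mem_univ k) (by rw [← h]; simp)
    linarith [F_pos p hp]
  have le_of_F_le : ∀ t : ι → ℝ, (∀ k, 0 < t k) → F t ≤ F s → f t ≤ f s := by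
    intro t ht h
    rw [← log_F t ht, ← log_F s hs]
    exact Real.log_le_log (F_pos t ht) h
  refine ⟨s, hsS, hs, fun t htS ht => ?_⟩
  rcases le_total (f p) (f t) with h | h
  · exact le_of_F_le t ht (hmax ⟨htS, mem_box t ht h⟩)
  · exact h.trans (le_of_F_le p hp hFp)

/-- First-order condition for a positive maximizer of `∑ k, (log (t k) - a k * t k)` along a
feasible line. -/
theorem sum_inv_sub_mul_eq_zero_of_isMax {ι : Type*} [Fintype ι] {S : Set (ι → ℝ)}
    {a s h : ι → ℝ} (hs : ∀ k, 0 < s k)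
    (hmax : ∀ t ∈ S, (∀ k, 0 < t k) →
      ∑ k, (Real.log (t k) - a k * t k) ≤ ∑ k, (Real.log (s k) - a k * s k))
    (hh : ∀ r : ℝ, (fun k => s k + r * h k) ∈ S) :
    ∑ k, ((s k)⁻¹ - a k) * h k = 0 := by
  have hline : ∀ k, HasDerivAt (fun r : ℝ => s k + r * h k) (h k) 0 := fun k => by
    simpa using ((hasDerivAt_id (0 : ℝ)).mul_const (h k)).const_add (s k)
  have hderiv : HasDerivAt
      (fun r : ℝ => ∑ k, (Real.log (s k + r * h k) - a k * (s k + r * h k)))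
      (∑ k, ((s k)⁻¹ - a k) * h k) 0 := by
    refine HasDerivAt.fun_sum fun k _ => ?_
    convert ((hline k).log (by simpa using (hs k).ne')).fun_sub ((hline k).const_mul (a k)) using 1
    rw [zero_mul, add_zero]
    ring
  refine IsLocalMax.hasDerivAt_eq_zero ?_ hderiv
  have hev : ∀ᶠ r : ℝ in 𝓝 0, ∀ k, 0 < s k + r * h k := by
    rw [eventually_all]
    intro k
    exact (hline k).continuousAt.eventually (lt_mem_nhds (by simpa using hs k))
  filter_upwards [hev] with r hr
  simpa using hmax _ (hh r) hr

/-- Two positive matrices differing by a matrix of the form `u i + v j` coincide if their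
entrywise reciprocals have the same row and column sums. -/
theorem add_eq_zero_of_sum_inv_eq {ι κ : Type*} [Fintype ι] [Fintype κ] {s t : ι → κ → ℝ}
    {u : ι → ℝ} {v : κ → ℝ} (hs : ∀ i j, 0 < s i j) (ht : ∀ i j, 0 < t i j)
    (hst : ∀ i j, s i j - t i j = u i + v j)
    (hrow : ∀ i, ∑ j, (s i j)⁻¹ = ∑ j, (t i j)⁻¹)
    (hcol : ∀ j, ∑ i, (s i j)⁻¹ = ∑ i, (t i j)⁻¹) (i : ι) (j : κ) :
    u i + v j = 0 := by
  have hzero : ∑ i, ∑ j, ((t i j)⁻¹ - (s i j)⁻¹) * (u i + v j) = 0 := by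
    have h1 : ∑ i, ∑ j, ((t i j)⁻¹ - (s i j)⁻¹) * u i = 0 := by
      simp only [← sum_mul, sum_sub_distrib, hrow, sub_self, zero_mul, sum_const_zero]
    have h2 : ∑ i, ∑ j, ((t i j)⁻¹ - (s i j)⁻¹) * v j = 0 := by
      rw [sum_comm]
      simp only [← sum_mul, sum_sub_distrib, hcol, sub_self, zero_mul, sum_const_zero]
    simp only [mul_add, sum_add_distrib, h1, h2, add_zero]
  have hterm : ∀ i j, ((t i j)⁻¹ - (s i j)⁻¹) * (u i + v j)
      = (u i + v j) ^ 2 / (s i j * t i j) := by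
    intro i j
    have := (hs i j).ne'
    have := (ht i j).ne'
    rw [← hst]
    field_simp
  have hnonneg : ∀ i j, 0 ≤ ((t i j)⁻¹ - (s i j)⁻¹) * (u i + v j) := fun i j => by
    rw [hterm]
    exact div_nonneg (sq_nonneg _) (mul_pos (hs i j) (ht i j)).le
  have hij := (sum_eq_zero_iff_of_nonneg fun j _ => hnonneg i j).1
    ((sum_eq_zero_iff_of_nonneg fun i _ => sum_nonneg fun j _ => hnonneg i j).1 hzero i
      (mem_univ i)) j (mem_univ j)
  rw [hterm, div_eq_zero_iff] at hij
  exact pow_eq_zero_iff two_ne_zero |>.1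
    (hij.resolve_right (mul_pos (hs i j) (ht i j)).ne')

/-- Potentials `x, y` such that the entrywise reciprocal of `C i j - x i - y j` has prescribed
positive row and column sums. -/
theorem exists_potentials_sum_inv_eq {ι κ : Type*} [Fintype ι] [Fintype κ] [Nonempty ι]
    [Nonempty κ] (C : ι → κ → ℝ) {d₁ : ι → ℝ} {d₂ : κ → ℝ} (hd₁ : ∀ i, 0 < d₁ i)
    (hd₂ : ∀ j, 0 < d₂ j) (hbal : ∑ i, d₁ i = ∑ j, d₂ j) :
    ∃ (x : ι → ℝ) (y : κ → ℝ), (∀ i j, 0 < C i j - x i - y j) ∧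
      (∀ i, ∑ j, (C i j - x i - y j)⁻¹ = d₁ i) ∧
      (∀ j, ∑ i, (C i j - x i - y j)⁻¹ = d₂ j) := by
  classical
  obtain ⟨i₀⟩ := ‹Nonempty ι›
  obtain ⟨j₀⟩ := ‹Nonempty κ›
  set T : ℝ := ∑ i, d₁ i with hT
  have hTpos : 0 < T := sum_pos (fun i _ => hd₁ i) ⟨i₀, mem_univ _⟩
  set a : ι × κ → ℝ := fun k => d₁ k.1 * d₂ k.2 / T with ha_def
  have ha : ∀ k, 0 < a k := fun k => div_pos (mul_pos (hd₁ _) (hd₂ _)) hTpos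
  have a_row : ∀ i, ∑ j, a (i, j) = d₁ i := fun i => by
    simp only [ha_def]
    rw [← sum_div, ← mul_sum, ← hbal, mul_div_cancel_right₀ _ hTpos.ne']
  have a_col : ∀ j, ∑ i, a (i, j) = d₂ j := fun j => by
    simp only [ha_def]
    rw [← sum_div, ← sum_mul, ← hT, mul_div_cancel_left₀ _ hTpos.ne']
  set S : Set (ι × κ → ℝ) := {s | ∀ i j, C i j - s (i, j) =
    (C i j₀ - s (i, j₀)) + (C i₀ j - s (i₀, j) - (C i₀ j₀ - s (i₀, j₀)))} with hS_def
  have hS : IsClosed S := by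
    simp only [hS_def, Set.ofPred_forall]
    exact isClosed_iInter fun i => isClosed_iInter fun j =>
      isClosed_eq (by fun_prop) (by fun_prop)
  set p : ι × κ → ℝ := fun k => C k.1 k.2 + (∑ i, ∑ j, |C i j| + 1) with hp_def
  have hp : ∀ k, 0 < p k := by
    rintro ⟨i, j⟩
    have h1 : |C i j| ≤ ∑ j, |C i j| :=
      single_le_sum (f := fun j => |C i j|) (fun _ _ => abs_nonneg _) (mem_univ j)
    have h2 : ∑ j, |C i j| ≤ ∑ i, ∑ j, |C i j| :=
      single_le_sum (f := fun i => ∑ j, |C i j|)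
        (fun _ _ => sum_nonneg fun _ _ => abs_nonneg _) (mem_univ i)
    have h3 := neg_abs_le (C i j)
    simp only [hp_def]
    linarith
  have hpS : p ∈ S := fun i j => by
    simp only [hp_def]
    ring
  obtain ⟨s, hsS, hs, hmax⟩ := exists_pos_isMax_sum_log_sub hS ha hpS hp
  have stationary : ∀ (u : ι → ℝ) (v : κ → ℝ),
      ∑ i, ∑ j, ((s (i, j))⁻¹ - a (i, j)) * (u i + v j) = 0 := by
    intro u v
    rw [← Fintype.sum_prod_type' (f := fun i j => ((s (i, j))⁻¹ - a (i, j)) * (u i + v j))]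
    refine sum_inv_sub_mul_eq_zero_of_isMax (h := fun k => u k.1 + v k.2) hs hmax fun r i j => ?_
    have := hsS i j
    linear_combination this
  have hxy : ∀ i j, C i j - (C i j₀ - s (i, j₀)) -
      (C i₀ j - s (i₀, j) - (C i₀ j₀ - s (i₀, j₀))) = s (i, j) := fun i j => by
    linear_combination hsS i j
  refine ⟨fun i => C i j₀ - s (i, j₀), fun j => C i₀ j - s (i₀, j) - (C i₀ j₀ - s (i₀, j₀)),
    ?_, ?_, ?_⟩
  · intro i j
    simpa only [hxy] using hs (i, j)
  · intro i
    have h := stationary (Pi.single i 1) 0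
    simp only [Pi.zero_apply, add_zero, ← sum_mul, sum_sub_distrib, a_row] at h
    simp only [hxy]
    simpa [Pi.single_apply, sub_eq_zero] using h
  · intro j
    have h := stationary 0 (Pi.single j 1)
    rw [sum_comm] at h
    simp only [Pi.zero_apply, zero_add, ← sum_mul, sum_sub_distrib, a_col] at h
    simp only [hxy]
    simpa [Pi.single_apply, sub_eq_zero] using h


/-- Menon-type scaling theorem for the barrier relaxation (Corollary 2.8): given positive
`d₁, d₂` with equal total mass, there is a unique `(x,y) ∈ D` such that the entrywise
reciprocal matrix `[(c_{j₁j₂} − x_{j₁} − y_{j₂})⁻¹]` has row sums `d₁` and column sums `d₂`. -/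
theorem stmt_13 (n₁ n₂ : ℕ) (C : Matrix (Fin n₁) (Fin n₂) ℝ)
    (d₁ : Fin n₁ → ℝ) (d₂ : Fin n₂ → ℝ)
    (hd₁ : ∀ i, 0 < d₁ i) (hd₂ : ∀ j, 0 < d₂ j)
    (hbal : ∑ i, d₁ i = ∑ j, d₂ j) :
    ∃! q : (Fin n₁ → ℝ) × (Fin n₂ → ℝ),
      (∀ i j, 0 < C i j - q.1 i - q.2 j) ∧
      (∑ i, q.1 i = ∑ j, q.2 j) ∧
      (∀ i, ∑ j, (C i j - q.1 i - q.2 j)⁻¹ = d₁ i) ∧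
      (∀ j, ∑ i, (C i j - q.1 i - q.2 j)⁻¹ = d₂ j) := by
  rcases isEmpty_or_nonempty (Fin n₁) with h₁ | h₁
  · have h₂ : IsEmpty (Fin n₂) := by
      by_contra h
      rw [not_isEmpty_iff] at h
      have := sum_pos (fun j _ => hd₂ j) (univ_nonempty (α := Fin n₂))
      simp [← hbal] at this
    exact ⟨(0, 0), by simp, fun q _ => Subsingleton.elim _ _⟩
  have h₂ : Nonempty (Fin n₂) := by
    by_contra h
    rw [not_nonempty_iff] at h
    have := sum_pos (fun i _ => hd₁ i) (univ_nonempty (α := Fin n₁))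
    simp [hbal] at this
  obtain ⟨i₀⟩ := id h₁
  obtain ⟨j₀⟩ := id h₂
  have hn₁ : (0 : ℝ) < n₁ := by exact_mod_cast i₀.pos
  have hn₂ : (0 : ℝ) < n₂ := by exact_mod_cast j₀.pos
  obtain ⟨x, y, hpos, hrow, hcol⟩ := exists_potentials_sum_inv_eq C hd₁ hd₂ hbal
  set α : ℝ := (∑ j, y j - ∑ i, x i) / (n₁ + n₂) with hα
  have hshift : ∀ i j, C i j - (x i + α) - (y j - α) = C i j - x i - y j := fun i j => by ring
  refine ⟨(fun i => x i + α, fun j => y j - α), ⟨?_, ?_, ?_, ?_⟩, ?_⟩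
  · simpa only [hshift] using hpos
  · simp only [sum_add_distrib, sum_sub_distrib, sum_const, card_univ, Fintype.card_fin,
      nsmul_eq_mul]
    have : α * (n₁ + n₂) = ∑ j, y j - ∑ i, x i := div_mul_cancel₀ _ (by positivity)
    linarith
  · simpa only [hshift] using hrow
  · simpa only [hshift] using hcol
  rintro ⟨x', y'⟩ ⟨hpos', hsum', hrow', hcol'⟩
  dsimp only at hpos' hsum' hrow' hcol'
  have key : ∀ i j, (x i - x' i) + (y j - y' j) = 0 :=
    add_eq_zero_of_sum_inv_eq (u := fun i => x i - x' i) (v := fun j => y j - y' j) hpos' hpos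
      (fun i j => by ring) (fun i => (hrow' i).trans (hrow i).symm)
      fun j => (hcol' j).trans (hcol j).symm
  have hx : ∀ i, x' i = x i + (y j₀ - y' j₀) := fun i => by linarith [key i j₀]
  have hy : ∀ j, y' j = y j - (y j₀ - y' j₀) := fun j => by
    linarith [key i₀ j, key i₀ j₀]
  have hβ : y j₀ - y' j₀ = α := by
    rw [sum_congr rfl fun i _ => hx i, sum_congr rfl fun j _ => hy j] at hsum'
    simp only [sum_add_distrib, sum_sub_distrib, sum_const, card_univ, Fintype.card_fin,
      nsmul_eq_mul] at hsum'
    rw [hα, eq_div_iff (by positivity)]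
    linarith
  rw [hβ] at hx hy
  exact Prod.ext (funext hx) (funext hy)
end

section
/- Let n ≥ 2, d ≥ 2, 0 ≠ 𝒞 = [c_{j₁,…,j_d}] ∈ ⊗^d ℝ^n, c = max |c_{j₁,…,j_d}|, c_min = min c_{j₁,…,j_d}, and let p_i ∈ Δⁿ (i ∈ [d]) be positive probability vectors. Suppose (x₁,…,x_d) ∈ (ℝⁿ)^d satisfies: 𝒞(x₁,…,x_d) ≥ 0 entrywise, Σ_{i=1}^d p_iᵀx_i ≥ c_min, and 𝟙ᵀx₁ = ⋯ = 𝟙ᵀx_d. Then √(Σ_{i=1}^d ‖x_i‖²) < 2c√n / ∏_{i=1}^d (min_{j_i∈[n]} p_{j_i,i}). -/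
open Finset in
/-- Mean of a function of one coordinate under a product of weights of total mass one. -/
theorem sum_prod_mul_apply {ι κ : Type*} [Fintype ι] [DecidableEq ι] [Fintype κ]
    (w : ι → κ → ℝ) (hw : ∀ i, ∑ k, w i k = 1) (i : ι) (f : κ → ℝ) :
    ∑ j : ι → κ, (∏ l, w l (j l)) * f (j i) = ∑ k, w i k * f k := by
  have h := prod_univ_sum (fun _ : ι => (univ : Finset κ))
    (fun l k => w l k * if l = i then f k else 1)
  simp only [prod_mul_distrib, prod_ite_eq', mem_univ, if_true, Fintype.piFinset_univ] at h
  rw [← h, prod_eq_single i]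
  · simp
  · intro l _ hl
    simp [hl, hw]
  · simp

open Finset in
/-- Distinct coordinates are independent under a product of weights of total mass one. -/
theorem sum_prod_mul_apply_mul_apply {ι κ : Type*} [Fintype ι] [DecidableEq ι] [Fintype κ]
    (w : ι → κ → ℝ) (hw : ∀ i, ∑ k, w i k = 1) {i i' : ι} (hii : i ≠ i') (f g : κ → ℝ) :
    ∑ j : ι → κ, (∏ l, w l (j l)) * (f (j i) * g (j i')) =
      (∑ k, w i k * f k) * ∑ k, w i' k * g k := by
  have h := prod_univ_sum (fun _ : ι => (univ : Finset κ))
    (fun l k => w l k * ((if l = i then f k else 1) * if l = i' then g k else 1))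
  simp only [prod_mul_distrib, prod_ite_eq', mem_univ, if_true, Fintype.piFinset_univ] at h
  rw [← h, prod_eq_mul i i' hii]
  · simp [hii, hii.symm]
  · rintro l - ⟨hl, hl'⟩
    simp [hl, hl', hw]
  · simp
  · simp

open Finset in
/-- If the vectors `x i` have equal coordinate sums, the sum of their squared norms is at most the
normalized squared norm of the tensor with entries `∑ i, x i (j i)`. -/
theorem sum_sq_le_card_mul_sum_sq {n d : ℕ} (hn : n ≠ 0) (x : Fin d → Fin n → ℝ)
    (hx : ∀ i i', ∑ k, x i k = ∑ k, x i' k) :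
    ∑ i, ∑ k, x i k ^ 2 ≤
      n * ∑ j : Fin d → Fin n, (∏ _l : Fin d, (n : ℝ)⁻¹) * (∑ i, x i (j i)) ^ 2 := by
  have hn' : (n : ℝ) ≠ 0 := Nat.cast_ne_zero.mpr hn
  have hw : ∀ _ : Fin d, ∑ _k : Fin n, (n : ℝ)⁻¹ = 1 := by simp [hn']
  have hexp : ∑ j : Fin d → Fin n, (∏ _l : Fin d, (n : ℝ)⁻¹) * (∑ i, x i (j i)) ^ 2 =
      ∑ i, ∑ i', ∑ j : Fin d → Fin n,
        (∏ _l : Fin d, (n : ℝ)⁻¹) * (x i (j i) * x i' (j i')) := by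
    simp_rw [sq, sum_mul_sum, mul_sum]
    rw [sum_comm]
    exact sum_congr rfl fun i _ => sum_comm
  rw [hexp, mul_sum]
  refine sum_le_sum fun i _ => ?_
  have hdiag : ∑ k, x i k ^ 2 =
      n * ∑ j : Fin d → Fin n, (∏ _l : Fin d, (n : ℝ)⁻¹) * (x i (j i) * x i (j i)) := by
    rw [sum_prod_mul_apply (fun _ _ => (n : ℝ)⁻¹) hw i (fun k => x i k * x i k), ← mul_sum,
      mul_inv_cancel_left₀ hn']
    simp_rw [sq]
  rw [hdiag]
  refine mul_le_mul_of_nonneg_left ?_ n.cast_nonneg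
  refine single_le_sum (f := fun i' => ∑ j : Fin d → Fin n,
    (∏ _l : Fin d, (n : ℝ)⁻¹) * (x i (j i) * x i' (j i'))) (fun i' _ => ?_) (mem_univ i)
  by_cases hii : i = i'
  · subst hii
    exact sum_nonneg fun j _ => mul_nonneg (by positivity) (mul_self_nonneg _)
  · rw [sum_prod_mul_apply_mul_apply (fun _ _ => (n : ℝ)⁻¹) hw hii, ← mul_sum, ← mul_sum,
      hx i i']
    exact mul_self_nonneg _

/-- If a function bounded above by `c > 0` has mean at least `-c` for a positive probability
weight `q`, its values are greater than `-2c / q j`. -/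
theorem neg_two_mul_lt_weight_mul {α : Type*} [Fintype α] (q a : α → ℝ)
    (hq : ∀ j, 0 < q j) (hq1 : ∑ j, q j = 1) {c : ℝ} (hc : 0 < c) (ha : ∀ j, a j ≤ c)
    (hmean : -c ≤ ∑ j, q j * a j) (j : α) : -(2 * c) < q j * a j := by
  have h : q j * (c - a j) ≤ ∑ j, q j * (c - a j) :=
    Finset.single_le_sum (f := fun j => q j * (c - a j))
      (fun j _ => mul_nonneg (hq j).le (sub_nonneg.mpr (ha j))) (Finset.mem_univ j)
  simp only [mul_sub, Finset.sum_sub_distrib, ← Finset.sum_mul, hq1] at h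
  linarith [mul_pos (hq j) hc]


/-- A priori bound on the dual variables of the multi-partite OTP (Lemma 3.3 (c)): if
`𝒞(x₁,…,x_d) ≥ 0` entrywise, `Σ p_iᵀx_i ≥ c_min` and `𝟙ᵀx₁ = ⋯ = 𝟙ᵀx_d`, then
`√(Σ_i ‖x_i‖²) < 2c√n / ∏_i min_k p_{k,i}`. -/
theorem stmt_15 (n d : ℕ) (hn : 2 ≤ n) (hd : 2 ≤ d)
    (C : (Fin d → Fin n) → ℝ) (hC : C ≠ 0)
    (c : ℝ) (hc : IsGreatest {v : ℝ | ∃ j, v = |C j|} c)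
    (cmin : ℝ) (hcmin : IsLeast {v : ℝ | ∃ j, v = C j} cmin)
    (p : Fin d → Fin n → ℝ) (hp : ∀ i k, 0 < p i k)
    (hps : ∀ i, ∑ k, p i k = 1)
    (pm : Fin d → ℝ) (hpm : ∀ i, IsLeast {v : ℝ | ∃ k, v = p i k} (pm i))
    (x : Fin d → Fin n → ℝ)
    (hpos : ∀ j : Fin d → Fin n, 0 ≤ C j - ∑ i, x i (j i))
    (hpay : (∑ i, ∑ k, p i k * x i k) ≥ cmin)
    (hbalx : ∀ i i' : Fin d, ∑ k, x i k = ∑ k, x i' k) :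
    Real.sqrt (∑ i, ∑ k, (x i k) ^ 2) < 2 * c * Real.sqrt n / ∏ i, pm i := by
  have hn0 : n ≠ 0 := by omega
  have hn' : (0 : ℝ) < n := by positivity
  have hCle : ∀ j, |C j| ≤ c := fun j => hc.2 ⟨j, rfl⟩
  have hc0 : 0 < c := by
    obtain ⟨j, hj⟩ := Function.ne_iff.mp hC
    exact (abs_pos.mpr hj).trans_le (hCle j)
  have hcm : -c ≤ cmin := by
    obtain ⟨j, rfl⟩ := hcmin.1
    exact (abs_le.mp (hCle j)).1
  have hpm0 : ∀ i, 0 < pm i := fun i => by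
    obtain ⟨k, hk⟩ := (hpm i).1
    exact hk ▸ hp i k
  have hpmle : ∀ i k, pm i ≤ p i k := fun i k => (hpm i).2 ⟨k, rfl⟩
  have hple : ∀ i k, p i k ≤ 1 := fun i k => hps i ▸
    Finset.single_le_sum (fun l _ => (hp i l).le) (Finset.mem_univ k)
  have hP0 : 0 < ∏ i, pm i := Finset.prod_pos fun i _ => hpm0 i
  have hP1 : ∏ i, pm i ≤ 1 := Finset.prod_le_one (fun i _ => (hpm0 i).le)
    fun i _ => (hpmle i ⟨0, by omega⟩).trans (hple i _)
  set P := ∏ i, pm i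
  set a : (Fin d → Fin n) → ℝ := fun j => ∑ i, x i (j i) with ha
  have hac : ∀ j, a j ≤ c := fun j =>
    (sub_nonneg.mp (hpos j)).trans ((le_abs_self _).trans (hCle j))
  have hmean : ∑ j : Fin d → Fin n, (∏ l, p l (j l)) * a j = ∑ i, ∑ k, p i k * x i k := by
    simp_rw [ha, Finset.mul_sum]
    rw [Finset.sum_comm]
    exact Finset.sum_congr rfl fun i _ => sum_prod_mul_apply p hps i (x i)
  have hq1 : ∑ j : Fin d → Fin n, ∏ l, p l (j l) = 1 := by
    simpa [hps] using (Finset.prod_univ_sum (fun _ : Fin d => (Finset.univ : Finset (Fin n))) p).symm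
  have hlow := neg_two_mul_lt_weight_mul (fun j : Fin d → Fin n => ∏ l, p l (j l)) a
    (fun j => Finset.prod_pos fun i _ => hp i _) hq1 hc0 hac
    (hmean ▸ hcm.trans hpay)
  have habs : ∀ j, |a j| < 2 * c / P := fun j => by
    rw [lt_div_iff₀ hP0, ← abs_of_pos hP0, ← abs_mul, abs_lt]
    constructor
    · rcases le_total 0 (a j) with h | h
      · linarith [mul_nonneg h hP0.le]
      · have hPq : P ≤ ∏ l, p l (j l) :=
          Finset.prod_le_prod (fun i _ => (hpm0 i).le) fun i _ => hpmle i _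
        linarith [hlow j, mul_le_mul_of_nonpos_right hPq h]
    · nlinarith [mul_le_mul_of_nonneg_right (hac j) hP0.le]
  have hB : 0 < 2 * c / P := by positivity
  have : Nonempty (Fin n) := ⟨⟨0, by omega⟩⟩
  have hmass : ∑ _j : Fin d → Fin n, ∏ _l : Fin d, (n : ℝ)⁻¹ = 1 := by
    simp [hn0]
  have hlt : ∑ j : Fin d → Fin n, (∏ _l : Fin d, (n : ℝ)⁻¹) * a j ^ 2 < (2 * c / P) ^ 2 := by
    rw [← one_mul ((2 * c / P) ^ 2), ← hmass, Finset.sum_mul]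
    refine Finset.sum_lt_sum_of_nonempty Finset.univ_nonempty fun j _ => ?_
    exact mul_lt_mul_of_pos_left (sq_lt_sq.mpr ((habs j).trans_le (le_abs_self _)))
      (Finset.prod_pos fun _ _ => inv_pos.mpr hn')
  have hrhs : 2 * c * √n / P = √(n * (2 * c / P) ^ 2) := by
    rw [Real.sqrt_mul hn'.le, Real.sqrt_sq hB.le]
    ring
  rw [hrhs]
  refine Real.sqrt_lt_sqrt (by positivity) ?_
  exact (sum_sq_le_card_mul_sum_sq hn0 x hbalx).trans_lt (mul_lt_mul_of_pos_left hlt hn')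
end

section
/- Let n₁,n₂ > 1, let ρ₁ ∈ H_{n₁,++,1}, ρ₂ ∈ H_{n₂,++,1} be positive definite density matrices, R = (ρ₁,ρ₂), C ∈ H_{n₁n₂} a Hermitian matrix on ℂ^{n₁}⊗ℂ^{n₂}, and ε > 0. Then: (a) κ(C,R) < κ_β(C,R,ε); (b) the minimizer ρ* ∈ Γ_o(R) of κ_β(C,R,ε) is unique and has the form ρ* = ε·(C − U₁⊗I_{n₂} − I_{n₁}⊗U₂)^{−1} with U₁ ∈ H_{n₁}, U₂ ∈ H_{n₂}; moreover there is a unique such pair (U₁,U₂) satisfying tr U₁ = tr U₂. -/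
open scoped Kronecker ComplexOrder

namespace QuantumTransport

open Matrix Filter Topology

section General

variable {k : Type*} [Fintype k] [DecidableEq k]

open scoped MatrixOrder in
lemma exists_eq_conjTranspose_mul_self {A : Matrix k k ℂ} (hA : A.PosSemidef) :
    ∃ B : Matrix k k ℂ, A = Bᴴ * B :=
  CStarAlgebra.nonneg_iff_eq_star_mul_self.mp hA.nonneg

lemma exists_isUnit_eq_conjTranspose_mul_self {A : Matrix k k ℂ} (hA : A.PosDef) :
    ∃ B : Matrix k k ℂ, IsUnit B ∧ A = Bᴴ * B := by
  obtain ⟨B, rfl⟩ := exists_eq_conjTranspose_mul_self hA.posSemidef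
  refine ⟨B, ?_, rfl⟩
  have h := hA.det_pos.ne'
  rw [det_mul] at h
  exact (isUnit_iff_isUnit_det _).2 (right_ne_zero_of_mul h).isUnit

/-- The entries of a positive semidefinite matrix are bounded by its trace. -/
lemma norm_apply_le_trace {A : Matrix k k ℂ} (hA : A.PosSemidef) (i j : k) :
    ‖A i j‖ ≤ A.trace.re := by
  obtain ⟨B, rfl⟩ := exists_eq_conjTranspose_mul_self hA
  have hdiag (l : k) : ∑ r, ‖B r l‖ ^ 2 ≤ (Bᴴ * B).trace.re := by
    have (l : k) : ((Bᴴ * B) l l).re = ∑ r, ‖B r l‖ ^ 2 := by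
      simp only [mul_apply, conjTranspose_apply, Complex.re_sum]
      refine Finset.sum_congr rfl fun r _ => ?_
      rw [RCLike.star_def, ← Complex.normSq_eq_conj_mul_self, Complex.ofReal_re,
        Complex.normSq_eq_norm_sq]
    rw [trace, Complex.re_sum]
    simp only [diag_apply, this]
    exact Finset.single_le_sum (f := fun l => ∑ r, ‖B r l‖ ^ 2)
      (fun l _ => Finset.sum_nonneg fun r _ => sq_nonneg _) (Finset.mem_univ l)
  have h : ‖(Bᴴ * B) i j‖ ≤ ∑ r, (‖B r i‖ ^ 2 + ‖B r j‖ ^ 2) / 2 := by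
    rw [mul_apply]
    refine (norm_sum_le _ _).trans (Finset.sum_le_sum fun r _ => ?_)
    rw [norm_mul, conjTranspose_apply, norm_star]
    nlinarith [sq_nonneg (‖B r i‖ - ‖B r j‖)]
  rw [← Finset.sum_div, Finset.sum_add_distrib] at h
  linarith [hdiag i, hdiag j]

omit [DecidableEq k] in
lemma isClosed_setOf_posSemidef : IsClosed {A : Matrix k k ℂ | A.PosSemidef} := by
  simp only [posSemidef_iff_dotProduct_mulVec, IsHermitian, Set.ofPred_and, Set.ofPred_forall]
  refine (isClosed_eq (by fun_prop) continuous_id).inter (isClosed_iInter fun x => ?_)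
  refine isClosed_le continuous_const ?_
  fun_prop

/-- A Hermitian perturbation of a positive definite matrix stays positive definite. -/
lemma eventually_posDef_one_add_smul {A : Matrix k k ℂ} (hA : A.IsHermitian) :
    ∀ᶠ t : ℝ in 𝓝 0, (1 + (t : ℂ) • A).PosDef := by
  have h : ∀ᶠ t : ℝ in 𝓝 0, ∀ i, 0 < 1 + t * hA.eigenvalues i := by
    refine eventually_all.2 fun i => ?_
    have : Tendsto (fun t : ℝ => 1 + t * hA.eigenvalues i) (𝓝 0) (𝓝 1) := by
      have : Continuous (fun t : ℝ => 1 + t * hA.eigenvalues i) := by fun_prop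
      simpa using this.tendsto 0
    exact this.eventually (lt_mem_nhds one_pos)
  filter_upwards [h] with t ht
  have e : 1 + (t : ℂ) • A = Unitary.conjStarAlgAut ℂ _ hA.eigenvectorUnitary
      (diagonal fun i => ((1 + t * hA.eigenvalues i : ℝ) : ℂ)) := by
    have : (diagonal fun i => ((1 + t * hA.eigenvalues i : ℝ) : ℂ))
        = 1 + (t : ℂ) • diagonal (RCLike.ofReal ∘ hA.eigenvalues) := by
      ext i j
      rcases eq_or_ne i j with rfl | hij
      · simp
      · simp [hij]
    rw [this, map_add, map_one, map_smul, ← hA.spectral_theorem]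
  rw [e, Unitary.conjStarAlgAut_apply,
    (Unitary.isUnit_coe (U := hA.eigenvectorUnitary)).posDef_star_right_conjugate_iff,
    posDef_diagonal_iff]
  exact fun i => by exact_mod_cast ht i

lemma eventually_posDef_add_smul {A H : Matrix k k ℂ} (hA : A.PosDef) (hH : H.IsHermitian) :
    ∀ᶠ t : ℝ in 𝓝 0, (A + (t : ℂ) • H).PosDef := by
  obtain ⟨B, hB, rfl⟩ := exists_isUnit_eq_conjTranspose_mul_self hA
  have hdet := (isUnit_iff_isUnit_det _).1 hB
  have hdet' : IsUnit Bᴴ.det := (isUnit_iff_isUnit_det _).1 hB.star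
  have hX : (B⁻¹ᴴ * H * B⁻¹).IsHermitian := isHermitian_conjTranspose_mul_mul _ hH
  filter_upwards [eventually_posDef_one_add_smul hX] with t ht
  have e : Bᴴ * B + (t : ℂ) • H = star B * (1 + (t : ℂ) • (B⁻¹ᴴ * H * B⁻¹)) * B := by
    rw [star_eq_conjTranspose, conjTranspose_nonsing_inv, mul_add, add_mul, mul_one, mul_smul_comm,
      smul_mul_assoc, mul_assoc, mul_assoc, mul_assoc, nonsing_inv_mul _ hdet, mul_one,
      mul_nonsing_inv_cancel_left _ _ hdet']
  rw [e, hB.posDef_star_left_conjugate_iff]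
  exact ht

lemma log_det_re_eq {A : Matrix k k ℂ} (hA : A.PosDef) :
    Real.log A.det.re = ∑ i, Real.log (hA.1.eigenvalues i) := by
  rw [hA.1.det_eq_prod_eigenvalues]
  have : (∏ i, ((hA.1.eigenvalues i : ℝ) : ℂ)).re = ∏ i, hA.1.eigenvalues i := by
    rw [← Complex.ofReal_prod, Complex.ofReal_re]
  exact (congrArg Real.log this).trans
    (Real.log_prod fun i _ => (hA.eigenvalues_pos i).ne')

lemma trace_re_eq {A : Matrix k k ℂ} (hA : A.IsHermitian) :
    A.trace.re = ∑ i, hA.eigenvalues i := by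
  rw [hA.trace_eq_sum_eigenvalues, Complex.re_sum]
  simp

lemma log_det_re_le_trace {A : Matrix k k ℂ} (hA : A.PosDef) :
    Real.log A.det.re ≤ A.trace.re - Fintype.card k := by
  rw [log_det_re_eq hA, trace_re_eq hA.1]
  calc _ ≤ ∑ i, (hA.1.eigenvalues i - 1) :=
        Finset.sum_le_sum fun i _ => Real.log_le_sub_one_of_pos (hA.eigenvalues_pos i)
    _ = _ := by simp [Finset.sum_sub_distrib]

lemma eq_one_of_log_det_re_eq {A : Matrix k k ℂ} (hA : A.PosDef)
    (h : Real.log A.det.re = A.trace.re - Fintype.card k) : A = 1 := by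
  rw [log_det_re_eq hA, trace_re_eq hA.1] at h
  have h' : ∑ i, Real.log (hA.1.eigenvalues i) = ∑ i, (hA.1.eigenvalues i - 1) := by
    simpa [Finset.sum_sub_distrib] using h
  have key := (Finset.sum_eq_sum_iff_of_le fun i _ =>
    Real.log_le_sub_one_of_pos (hA.eigenvalues_pos i)).1 h'
  have hone (i : k) : hA.1.eigenvalues i = 1 := by
    by_contra hne
    exact (Real.log_lt_sub_one_of_pos (hA.eigenvalues_pos i) hne).ne (key i (Finset.mem_univ i))
  have hdiag : (diagonal (RCLike.ofReal ∘ hA.1.eigenvalues) : Matrix k k ℂ) = 1 := by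
    rw [← diagonal_one]
    congr 1
    ext i
    simp [hone]
  rw [hA.1.spectral_theorem, hdiag, map_one]

/-- Gradient inequality for the concave function `log det`, with its equality case. -/
lemma log_det_sub_le {A S : Matrix k k ℂ} (hA : A.PosDef) (hS : S.PosDef) :
    Real.log S.det.re - Real.log A.det.re ≤ (A⁻¹ * (S - A)).trace.re ∧
      (Real.log S.det.re - Real.log A.det.re = (A⁻¹ * (S - A)).trace.re → S = A) := by
  obtain ⟨B, hB, rfl⟩ := exists_isUnit_eq_conjTranspose_mul_self hA
  have hdet := (isUnit_iff_isUnit_det _).1 hB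
  have hdet' : IsUnit Bᴴ.det := (isUnit_iff_isUnit_det _).1 hB.star
  obtain ⟨X, hXdef⟩ : ∃ X, X = B⁻¹ᴴ * S * B⁻¹ := ⟨_, rfl⟩
  have e : S = Bᴴ * X * B := by
    rw [hXdef, conjTranspose_nonsing_inv, mul_assoc, mul_assoc, mul_assoc, nonsing_inv_mul _ hdet,
      mul_one, mul_nonsing_inv_cancel_left _ _ hdet']
  have hX : X.PosDef := by
    rw [← hB.posDef_star_left_conjugate_iff, star_eq_conjTranspose, ← e]
    exact hS
  have hdetS : S.det = (Bᴴ * B).det * X.det := by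
    rw [e, det_mul, det_mul, det_mul]
    ring
  have hlog : Real.log S.det.re - Real.log (Bᴴ * B).det.re = Real.log X.det.re := by
    have h1 := Complex.pos_iff.1 hA.det_pos
    have h2 := Complex.pos_iff.1 hX.det_pos
    rw [hdetS, Complex.mul_re, ← h1.2, zero_mul, sub_zero, Real.log_mul h1.1.ne' h2.1.ne']
    ring
  have htr : ((Bᴴ * B)⁻¹ * (S - Bᴴ * B)).trace.re = X.trace.re - Fintype.card k := by
    have hAd : IsUnit (Bᴴ * B).det := (isUnit_iff_isUnit_det _).1 hA.isUnit
    rw [mul_sub, nonsing_inv_mul _ hAd, trace_sub, trace_one, Matrix.mul_inv_rev, mul_assoc,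
      trace_mul_comm, ← conjTranspose_nonsing_inv, ← hXdef]
    simp
  rw [hlog, htr]
  refine ⟨log_det_re_le_trace hX, fun h => ?_⟩
  rw [e, eq_one_of_log_det_re_eq hX h, mul_one]

lemma hasDerivAt_log_det {A H : Matrix k k ℂ} (hA : A.PosDef) :
    HasDerivAt (fun t : ℝ => Real.log (A + (t : ℂ) • H).det.re) (A⁻¹ * H).trace.re 0 := by
  have hAd : IsUnit A.det := (isUnit_iff_isUnit_det _).1 hA.isUnit
  have hpos := Complex.pos_iff.1 hA.det_pos
  obtain ⟨p, hp⟩ : ∃ p : Polynomial ℂ, ∀ z : ℂ,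
      (A + z • H).det = A.det * (1 + (A⁻¹ * H).trace * z + p.eval z * z ^ 2) := by
    refine ⟨(det (1 + (Polynomial.X : Polynomial ℂ) •
      (A⁻¹ * H).map Polynomial.C)).divX.divX, fun z => ?_⟩
    rw [← det_one_add_smul, ← det_mul, mul_add, mul_one, mul_smul_comm,
      mul_nonsing_inv_cancel_left _ _ hAd]
  have hd : HasDerivAt (fun z : ℂ => (A + z • H).det) (A.det * (A⁻¹ * H).trace) ((0 : ℝ) : ℂ) := by
    simp only [hp]
    have := (((hasDerivAt_id (0 : ℂ)).const_mul (A⁻¹ * H).trace).const_add 1).add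
      ((p.hasDerivAt 0).mul ((hasDerivAt_id (0 : ℂ)).pow 2)) |>.const_mul A.det
    simpa using this
  have hr := hd.real_of_complex.log (by simpa using hpos.1.ne')
  convert hr using 1
  rw [Complex.mul_re, ← hpos.2]
  simp [hpos.1.ne']

end General

section Bipartite

variable {m n : Type*} [Fintype m] [Fintype n]

/-- The partial trace over the second factor. -/
def ptrRight : Matrix (m × n) (m × n) ℂ →ₗ[ℂ] Matrix m m ℂ where
  toFun ρ := of fun i k => ∑ j, ρ (i, j) (k, j)
  map_add' A B := by ext; simp [Finset.sum_add_distrib]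
  map_smul' c A := by ext; simp [Finset.mul_sum]

/-- The partial trace over the first factor. -/
def ptrLeft : Matrix (m × n) (m × n) ℂ →ₗ[ℂ] Matrix n n ℂ where
  toFun ρ := of fun j l => ∑ i, ρ (i, j) (i, l)
  map_add' A B := by ext; simp [Finset.sum_add_distrib]
  map_smul' c A := by ext; simp [Finset.mul_sum]

omit [Fintype m] in
lemma ptrRight_apply (A : Matrix (m × n) (m × n) ℂ) (i k : m) :
    ptrRight A i k = ∑ j, A (i, j) (k, j) := rfl

omit [Fintype n] in
lemma ptrLeft_apply (A : Matrix (m × n) (m × n) ℂ) (j l : n) :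
    ptrLeft A j l = ∑ i, A (i, j) (i, l) := rfl

lemma continuous_ptrRight : Continuous (ptrRight (m := m) (n := n)) :=
  LinearMap.continuous_of_finiteDimensional _

lemma continuous_ptrLeft : Continuous (ptrLeft (m := m) (n := n)) :=
  LinearMap.continuous_of_finiteDimensional _

omit [Fintype m] in
lemma ptrRight_kronecker (U : Matrix m m ℂ) (V : Matrix n n ℂ) :
    ptrRight (U ⊗ₖ V) = V.trace • U := by
  ext i k
  simp [ptrRight_apply, trace, ← Finset.mul_sum, mul_comm]

omit [Fintype n] in
lemma ptrLeft_kronecker (U : Matrix m m ℂ) (V : Matrix n n ℂ) :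
    ptrLeft (U ⊗ₖ V) = U.trace • V := by
  ext j l
  simp [ptrLeft_apply, trace, ← Finset.sum_mul]

lemma trace_ptrRight (A : Matrix (m × n) (m × n) ℂ) : (ptrRight A).trace = A.trace := by
  simp [trace, ptrRight_apply, Fintype.sum_prod_type]

lemma trace_ptrLeft (A : Matrix (m × n) (m × n) ℂ) : (ptrLeft A).trace = A.trace := by
  simp [trace, ptrLeft_apply, Fintype.sum_prod_type_right]

omit [Fintype m] in
lemma isHermitian_ptrRight {A : Matrix (m × n) (m × n) ℂ} (hA : A.IsHermitian) :
    (ptrRight A).IsHermitian := by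
  ext i k
  simp only [conjTranspose_apply, ptrRight_apply, star_sum, hA.apply]

omit [Fintype n] in
lemma isHermitian_ptrLeft {A : Matrix (m × n) (m × n) ℂ} (hA : A.IsHermitian) :
    (ptrLeft A).IsHermitian := by
  ext i k
  simp only [conjTranspose_apply, ptrLeft_apply, star_sum, hA.apply]

lemma isHermitian_smul {k : Type*} {A : Matrix k k ℂ} (hA : A.IsHermitian) {c : ℂ}
    (hc : star c = c) : (c • A).IsHermitian := by
  rw [IsHermitian, conjTranspose_smul, hA.eq, hc]

variable [DecidableEq m] [DecidableEq n]

omit [DecidableEq m] in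
lemma trace_kronecker_one_mul (U : Matrix m m ℂ) (A : Matrix (m × n) (m × n) ℂ) :
    ((U ⊗ₖ (1 : Matrix n n ℂ)) * A).trace = (U * ptrRight A).trace := by
  simp only [trace, diag_apply, mul_apply, Fintype.sum_prod_type, kronecker_apply, one_apply,
    ptrRight_apply, mul_ite, mul_one, mul_zero, ite_mul, zero_mul, Finset.sum_ite_eq,
    Finset.mem_univ, if_true, Finset.mul_sum]
  exact Finset.sum_congr rfl fun i _ => Finset.sum_comm

omit [DecidableEq n] in
lemma trace_one_kronecker_mul (V : Matrix n n ℂ) (A : Matrix (m × n) (m × n) ℂ) :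
    (((1 : Matrix m m ℂ) ⊗ₖ V) * A).trace = (V * ptrLeft A).trace := by
  simp only [trace, diag_apply, mul_apply, Fintype.sum_prod_type_right, kronecker_apply, one_apply,
    ptrLeft_apply, one_mul, zero_mul, ite_mul, Finset.sum_ite_eq,
    Finset.mem_univ, if_true, Finset.mul_sum]
  exact Finset.sum_congr rfl fun i _ => Finset.sum_comm

/-- The element `U ⊗ 1 + 1 ⊗ V`. -/
def kroneckerSum (U : Matrix m m ℂ) (V : Matrix n n ℂ) : Matrix (m × n) (m × n) ℂ :=
  U ⊗ₖ (1 : Matrix n n ℂ) + (1 : Matrix m m ℂ) ⊗ₖ V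

omit [Fintype m] in
lemma ptrRight_kroneckerSum (U : Matrix m m ℂ) (V : Matrix n n ℂ) :
    ptrRight (kroneckerSum U V) = (Fintype.card n : ℂ) • U + V.trace • 1 := by
  rw [kroneckerSum, map_add, ptrRight_kronecker, ptrRight_kronecker, trace_one]

omit [Fintype n] in
lemma ptrLeft_kroneckerSum (U : Matrix m m ℂ) (V : Matrix n n ℂ) :
    ptrLeft (kroneckerSum U V) = U.trace • 1 + (Fintype.card m : ℂ) • V := by
  rw [kroneckerSum, map_add, ptrLeft_kronecker, ptrLeft_kronecker, trace_one]

omit [Fintype m] [Fintype n] in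
lemma isHermitian_kroneckerSum {U : Matrix m m ℂ} {V : Matrix n n ℂ} (hU : U.IsHermitian)
    (hV : V.IsHermitian) : (kroneckerSum U V).IsHermitian := by
  rw [kroneckerSum, IsHermitian, conjTranspose_add, conjTranspose_kronecker,
    conjTranspose_kronecker, hU.eq, hV.eq, conjTranspose_one, conjTranspose_one]

lemma trace_kroneckerSum_mul {U : Matrix m m ℂ} {V : Matrix n n ℂ}
    {H : Matrix (m × n) (m × n) ℂ} (h₁ : ptrRight H = 0) (h₂ : ptrLeft H = 0) :
    (kroneckerSum U V * H).trace = 0 := by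
  rw [kroneckerSum, add_mul, trace_add, trace_kronecker_one_mul, trace_one_kronecker_mul, h₁, h₂]
  simp

variable [Nonempty m] [Nonempty n]

/-- A Hermitian matrix orthogonal to all Hermitian matrices with vanishing partial traces is a
Kronecker sum. -/
lemma exists_eq_kroneckerSum {A : Matrix (m × n) (m × n) ℂ} (hA : A.IsHermitian)
    (h : ∀ H : Matrix (m × n) (m × n) ℂ, H.IsHermitian → ptrRight H = 0 → ptrLeft H = 0 →
      (A * H).trace.re = 0) :
    ∃ (U : Matrix m m ℂ) (V : Matrix n n ℂ), U.IsHermitian ∧ V.IsHermitian ∧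
      A = kroneckerSum U V := by
  have hm : (Fintype.card m : ℂ) ≠ 0 := by exact_mod_cast Fintype.card_ne_zero
  have hn : (Fintype.card n : ℂ) ≠ 0 := by exact_mod_cast Fintype.card_ne_zero
  have htr : star A.trace = A.trace := by rw [← trace_conjTranspose, hA.eq]
  obtain ⟨U, hUdef⟩ : ∃ U : Matrix m m ℂ, U = (Fintype.card n : ℂ)⁻¹ • ptrRight A -
    ((Fintype.card m : ℂ)⁻¹ * (Fintype.card n : ℂ)⁻¹ * A.trace) • 1 := ⟨_, rfl⟩
  obtain ⟨V, hVdef⟩ : ∃ V : Matrix n n ℂ, V = (Fintype.card m : ℂ)⁻¹ • ptrLeft A := ⟨_, rfl⟩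
  have hU : U.IsHermitian := by
    rw [hUdef]
    refine (isHermitian_smul (isHermitian_ptrRight hA) (by simp)).sub
      (isHermitian_smul isHermitian_one ?_)
    rw [star_mul', htr]
    simp
  have hV : V.IsHermitian := by
    rw [hVdef]
    exact isHermitian_smul (isHermitian_ptrLeft hA) (by simp)
  refine ⟨U, V, hU, hV, ?_⟩
  have hUtr : U.trace = 0 := by
    rw [hUdef, trace_sub, trace_smul, trace_smul, trace_ptrRight, trace_one]
    simp only [smul_eq_mul]
    field_simp
    simp
  have hVtr : V.trace = (Fintype.card m : ℂ)⁻¹ * A.trace := by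
    rw [hVdef, trace_smul, trace_ptrLeft, smul_eq_mul]
  have h₁ : ptrRight (A - kroneckerSum U V) = 0 := by
    rw [map_sub, ptrRight_kroneckerSum, hVtr, hUdef, smul_sub, smul_smul, smul_smul,
      mul_inv_cancel₀ hn, one_smul]
    have : (Fintype.card n : ℂ) * ((Fintype.card m : ℂ)⁻¹ * (Fintype.card n : ℂ)⁻¹ * A.trace)
        = (Fintype.card m : ℂ)⁻¹ * A.trace := by field_simp
    rw [this]
    abel
  have h₂ : ptrLeft (A - kroneckerSum U V) = 0 := by
    rw [map_sub, ptrLeft_kroneckerSum, hUtr, hVdef, smul_smul, mul_inv_cancel₀ hm]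
    simp
  have hP := hA.sub (isHermitian_kroneckerSum hU hV)
  have hre : ((A - kroneckerSum U V)ᴴ * (A - kroneckerSum U V)).trace.re = 0 := by
    rw [hP.eq]
    nth_rewrite 1 [sub_mul]
    rw [trace_sub, trace_kroneckerSum_mul h₁ h₂, sub_zero]
    exact h _ hP h₁ h₂
  have hnonneg := Complex.nonneg_iff.1
    (posSemidef_conjTranspose_mul_self (A - kroneckerSum U V)).trace_nonneg
  exact sub_eq_zero.1 (trace_conjTranspose_mul_self_eq_zero_iff.1 (Complex.ext hre hnonneg.2.symm))

omit [Nonempty n] in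
/-- A Kronecker sum of Hermitian matrices can be written so that both summands have equal trace. -/
lemma exists_kroneckerSum_trace_eq {U : Matrix m m ℂ} {V : Matrix n n ℂ} (hU : U.IsHermitian)
    (hV : V.IsHermitian) : ∃ (U' : Matrix m m ℂ) (V' : Matrix n n ℂ), U'.IsHermitian ∧
      V'.IsHermitian ∧ U'.trace = V'.trace ∧ kroneckerSum U' V' = kroneckerSum U V := by
  have hmn : (Fintype.card m + Fintype.card n : ℂ) ≠ 0 := by
    exact_mod_cast (Nat.add_pos_left (Fintype.card_pos (α := m)) (Fintype.card n)).ne'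
  have hUtr : star U.trace = U.trace := by rw [← trace_conjTranspose, hU.eq]
  have hVtr : star V.trace = V.trace := by rw [← trace_conjTranspose, hV.eq]
  obtain ⟨a, ha⟩ : ∃ a : ℂ, a = (V.trace - U.trace) / (Fintype.card m + Fintype.card n) :=
    ⟨_, rfl⟩
  have hstar : star a = a := by
    rw [ha, star_div₀, star_sub, star_add, hUtr, hVtr]
    simp
  refine ⟨U + a • 1, V - a • 1, hU.add (isHermitian_smul isHermitian_one hstar),
    hV.sub (isHermitian_smul isHermitian_one hstar), ?_, ?_⟩
  · simp only [trace_add, trace_sub, trace_smul, trace_one, smul_eq_mul]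
    rw [ha]
    field_simp
    ring
  · simp only [kroneckerSum, sub_eq_add_neg, add_kronecker, kronecker_add, ← neg_smul,
      smul_kronecker, kronecker_smul]
    rw [neg_smul]
    abel

lemma kroneckerSum_injective_of_trace_eq {U U' : Matrix m m ℂ} {V V' : Matrix n n ℂ}
    (h : kroneckerSum U V = kroneckerSum U' V') (ht : U.trace = V.trace)
    (ht' : U'.trace = V'.trace) : U = U' ∧ V = V' := by
  have hm : (Fintype.card m : ℂ) ≠ 0 := by exact_mod_cast Fintype.card_ne_zero
  have hn : (Fintype.card n : ℂ) ≠ 0 := by exact_mod_cast Fintype.card_ne_zero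
  have hmn : (Fintype.card m + Fintype.card n : ℂ) ≠ 0 := by
    exact_mod_cast (Nat.add_pos_left (Fintype.card_pos (α := m)) (Fintype.card n)).ne'
  have h₁ := congrArg ptrRight h
  have h₂ := congrArg ptrLeft h
  rw [ptrRight_kroneckerSum, ptrRight_kroneckerSum] at h₁
  rw [ptrLeft_kroneckerSum, ptrLeft_kroneckerSum] at h₂
  have htr := congrArg trace h₁
  simp only [trace_add, trace_smul, trace_one, smul_eq_mul] at htr
  have hVV : V.trace = V'.trace := by
    rw [ht, ht'] at htr
    refine mul_left_cancel₀ hmn ?_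
    linear_combination htr
  have hUU : U.trace = U'.trace := by rw [ht, ht', hVV]
  rw [hVV] at h₁
  rw [hUU] at h₂
  exact ⟨smul_right_injective _ hn (add_right_cancel h₁),
    smul_right_injective _ hm (add_left_cancel h₂)⟩

end Bipartite

section Transport

variable {m n : Type*} [Fintype m] [Fintype n]

/-- The positive semidefinite couplings of two marginals. -/
def couplings (ρ₁ : Matrix m m ℂ) (ρ₂ : Matrix n n ℂ) : Set (Matrix (m × n) (m × n) ℂ) :=
  {ρ | ρ.PosSemidef ∧ ptrRight ρ = ρ₁ ∧ ptrLeft ρ = ρ₂}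

/-- The positive definite couplings of two marginals. -/
def posCouplings (ρ₁ : Matrix m m ℂ) (ρ₂ : Matrix n n ℂ) : Set (Matrix (m × n) (m × n) ℂ) :=
  {ρ | ρ.PosDef ∧ ptrRight ρ = ρ₁ ∧ ptrLeft ρ = ρ₂}

/-- The linear transport cost. -/
def cost (C ρ : Matrix (m × n) (m × n) ℂ) : ℝ := (C * ρ).trace.re

variable {ρ₁ : Matrix m m ℂ} {ρ₂ : Matrix n n ℂ} {C : Matrix (m × n) (m × n) ℂ}

lemma posCouplings_subset : posCouplings ρ₁ ρ₂ ⊆ couplings ρ₁ ρ₂ :=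
  fun _ h => ⟨h.1.posSemidef, h.2⟩

lemma continuous_cost : Continuous (cost C) := by
  unfold cost
  fun_prop

lemma cost_add_smul (ρ H : Matrix (m × n) (m × n) ℂ) (t : ℝ) :
    cost C (ρ + (t : ℂ) • H) = cost C ρ + t * cost C H := by
  simp [cost, mul_add]

variable [DecidableEq m] [DecidableEq n]

/-- The transport cost regularized by the logarithmic barrier. -/
noncomputable def barrierCost (C : Matrix (m × n) (m × n) ℂ) (ε : ℝ)
    (ρ : Matrix (m × n) (m × n) ℂ) : ℝ :=
  cost C ρ + ε * (-Real.log ρ.det.re)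

lemma norm_apply_le_one (h₁ : ρ₁.trace = 1) {ρ : Matrix (m × n) (m × n) ℂ}
    (hρ : ρ ∈ couplings ρ₁ ρ₂) (i j : m × n) : ‖ρ i j‖ ≤ 1 := by
  refine (norm_apply_le_trace hρ.1 i j).trans ?_
  rw [← trace_ptrRight, hρ.2.1, h₁, Complex.one_re]

lemma isCompact_couplings (h₁ : ρ₁.trace = 1) : IsCompact (couplings ρ₁ ρ₂) := by
  have hK : IsCompact (Set.pi Set.univ fun _ => Set.pi Set.univ fun _ => Metric.closedBall 0 1 :
      Set (m × n → m × n → ℂ)) :=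
    isCompact_univ_pi fun _ => isCompact_univ_pi fun _ => isCompact_closedBall _ _
  refine hK.of_isClosed_subset ?_ fun ρ hρ i _ j _ => ?_
  · exact isClosed_setOf_posSemidef.inter
      ((isClosed_eq continuous_ptrRight continuous_const).inter
        (isClosed_eq continuous_ptrLeft continuous_const))
  · exact mem_closedBall_zero_iff.2 (norm_apply_le_one h₁ hρ i j)

omit [DecidableEq m] [DecidableEq n] in
lemma kronecker_mem_posCouplings (hρ₁ : ρ₁.PosDef) (hρ₂ : ρ₂.PosDef) (h₁ : ρ₁.trace = 1)
    (h₂ : ρ₂.trace = 1) : ρ₁ ⊗ₖ ρ₂ ∈ posCouplings ρ₁ ρ₂ :=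
  ⟨hρ₁.kronecker hρ₂, by rw [ptrRight_kronecker, h₂, one_smul],
    by rw [ptrLeft_kronecker, h₁, one_smul]⟩

lemma exists_minimizer (hρ₁ : ρ₁.PosDef) (hρ₂ : ρ₂.PosDef) (h₁ : ρ₁.trace = 1)
    (h₂ : ρ₂.trace = 1) (C : Matrix (m × n) (m × n) ℂ) {ε : ℝ} (hε : 0 < ε) :
    ∃ ρ ∈ posCouplings ρ₁ ρ₂, ∀ σ ∈ posCouplings ρ₁ ρ₂,
      barrierCost C ε ρ ≤ barrierCost C ε σ := by
  have hmem := kronecker_mem_posCouplings hρ₁ hρ₂ h₁ h₂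
  have hcont : Continuous fun ρ : Matrix (m × n) (m × n) ℂ =>
      ρ.det.re * Real.exp (-(cost C ρ / ε)) := by
    have := continuous_cost (C := C)
    fun_prop
  obtain ⟨ρ, hρ, hmax⟩ := (isCompact_couplings h₁).exists_isMaxOn
    ⟨_, posCouplings_subset hmem⟩ hcont.continuousOn
  have hdet {σ : Matrix (m × n) (m × n) ℂ} (hσ : σ ∈ posCouplings ρ₁ ρ₂) : 0 < σ.det.re :=
    (Complex.pos_iff.1 hσ.1.det_pos).1
  have hpos : 0 < ρ.det.re :=
    pos_of_mul_pos_left ((mul_pos (hdet hmem) (Real.exp_pos _)).trans_le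
      (hmax (posCouplings_subset hmem))) (Real.exp_pos _).le
  have hlog {σ : Matrix (m × n) (m × n) ℂ} (hσ : 0 < σ.det.re) :
      Real.log (σ.det.re * Real.exp (-(cost C σ / ε))) = -(barrierCost C ε σ / ε) := by
    rw [Real.log_mul hσ.ne' (Real.exp_pos _).ne', Real.log_exp, barrierCost]
    field_simp
    ring
  refine ⟨ρ, ⟨hρ.1.posDef_iff_det_ne_zero.2 fun h => ?_, hρ.2⟩, fun σ hσ => ?_⟩
  · simp [h] at hpos
  · have := Real.log_le_log (mul_pos (hdet hσ) (Real.exp_pos _)) (hmax (posCouplings_subset hσ))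
    rw [hlog hpos, hlog (hdet hσ), neg_le_neg_iff] at this
    exact (div_le_div_iff_of_pos_right hε).1 this

/-- The first-order optimality condition at a minimizer. -/
lemma exists_kroneckerSum_of_minimizer [Nonempty m] [Nonempty n] (hC : C.IsHermitian) {ε : ℝ}
    {ρ : Matrix (m × n) (m × n) ℂ} (hρ : ρ ∈ posCouplings ρ₁ ρ₂)
    (hmin : ∀ σ ∈ posCouplings ρ₁ ρ₂, barrierCost C ε ρ ≤ barrierCost C ε σ) :
    ∃ (U : Matrix m m ℂ) (V : Matrix n n ℂ), U.IsHermitian ∧ V.IsHermitian ∧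
      C - (ε : ℂ) • ρ⁻¹ = kroneckerSum U V := by
  refine exists_eq_kroneckerSum (hC.sub (isHermitian_smul hρ.1.1.inv (by simp)))
    fun H hH hR hL => ?_
  have hderiv : HasDerivAt (fun t : ℝ => barrierCost C ε (ρ + (t : ℂ) • H))
      (cost C H + ε * (-(ρ⁻¹ * H).trace.re)) 0 := by
    have := (((hasDerivAt_id (0 : ℝ)).mul_const (cost C H)).const_add (cost C ρ)).add
      ((hasDerivAt_log_det (H := H) hρ.1).neg.const_mul ε)
    rw [one_mul] at this
    refine this.congr_of_eventuallyEq (Eventually.of_forall fun t => ?_)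
    simp only [barrierCost, cost_add_smul, Pi.add_apply, Pi.neg_apply, id]
  have hloc : IsLocalMin (fun t : ℝ => barrierCost C ε (ρ + (t : ℂ) • H)) 0 := by
    filter_upwards [eventually_posDef_add_smul hρ.1 hH] with t ht
    simpa using hmin _ ⟨ht, by simp [hR, hρ.2.1], by simp [hL, hρ.2.2]⟩
  have := hloc.hasDerivAt_eq_zero hderiv
  rw [sub_mul, trace_sub, Complex.sub_re, smul_mul_assoc, trace_smul, smul_eq_mul,
    Complex.re_ofReal_mul]
  rw [cost] at this
  linarith

/-- A stationary point of the regularized problem is its unique minimizer. -/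
lemma eq_of_barrierCost_le {ε : ℝ} (hε : 0 < ε) {ρ σ : Matrix (m × n) (m × n) ℂ}
    (hρ : ρ ∈ posCouplings ρ₁ ρ₂) (hσ : σ ∈ posCouplings ρ₁ ρ₂) {U : Matrix m m ℂ}
    {V : Matrix n n ℂ} (hU : C - (ε : ℂ) • ρ⁻¹ = kroneckerSum U V)
    (hle : barrierCost C ε σ ≤ barrierCost C ε ρ) : σ = ρ := by
  have hR : ptrRight (σ - ρ) = 0 := by rw [map_sub, hσ.2.1, hρ.2.1, sub_self]
  have hL : ptrLeft (σ - ρ) = 0 := by rw [map_sub, hσ.2.2, hρ.2.2, sub_self]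
  have hcost : cost C σ - cost C ρ = ε * (ρ⁻¹ * (σ - ρ)).trace.re := by
    have h := trace_kroneckerSum_mul (U := U) (V := V) hR hL
    rw [← hU, sub_mul, trace_sub, sub_eq_zero, smul_mul_assoc, trace_smul, smul_eq_mul] at h
    rw [← Complex.re_ofReal_mul, ← h, mul_sub, trace_sub, Complex.sub_re, cost, cost]
  obtain ⟨hlog, heq⟩ := log_det_sub_le hρ.1 hσ.1
  refine heq (hlog.antisymm ?_)
  refine le_of_mul_le_mul_left ?_ hε
  rw [← hcost]
  unfold barrierCost at hle
  linarith

lemma cost_lt_barrierCost (hcard : 1 < Fintype.card (m × n)) (h₁ : ρ₁.trace = 1) {ε : ℝ}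
    (hε : 0 < ε) {ρ : Matrix (m × n) (m × n) ℂ} (hρ : ρ ∈ posCouplings ρ₁ ρ₂) :
    cost C ρ < barrierCost C ε ρ := by
  have h := log_det_re_le_trace hρ.1
  rw [← trace_ptrRight, hρ.2.1, h₁, Complex.one_re] at h
  have hcard' : (1 : ℝ) < Fintype.card (m × n) := by exact_mod_cast hcard
  have : 0 < ε * (-Real.log ρ.det.re) := mul_pos hε (by linarith)
  rw [barrierCost]
  linarith

lemma eq_smul_inv_iff {k : Type*} [Fintype k] [DecidableEq k] {ρ M : Matrix k k ℂ}
    (hρ : ρ.PosDef) {ε : ℝ} (hε : ε ≠ 0) : ρ = (ε : ℂ) • M⁻¹ ↔ M = (ε : ℂ) • ρ⁻¹ := by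
  have hε' : (ε : ℂ) ≠ 0 := by exact_mod_cast hε
  have hdet : IsUnit ρ.det := (isUnit_iff_isUnit_det _).1 hρ.isUnit
  have key {A : Matrix k k ℂ} (hA : IsUnit A.det) : ((ε : ℂ) • A⁻¹)⁻¹ = (ε : ℂ)⁻¹ • A := by
    refine inv_eq_left_inv ?_
    rw [smul_mul_smul_comm, inv_mul_cancel₀ hε', one_smul, mul_nonsing_inv _ hA]
  constructor
  · rintro rfl
    have hM : IsUnit M.det := by
      rw [det_smul, isUnit_iff_ne_zero] at hdet
      have := right_ne_zero_of_mul hdet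
      exact isUnit_nonsing_inv_det_iff.1 this.isUnit
    rw [key hM, smul_smul, mul_inv_cancel₀ hε', one_smul]
  · rintro rfl
    rw [key hdet, smul_smul, mul_inv_cancel₀ hε', one_smul]

lemma eq_smul_inv_sub_sub_iff {ρ : Matrix (m × n) (m × n) ℂ} (hρ : ρ.PosDef) {ε : ℝ}
    (hε : ε ≠ 0) {U : Matrix m m ℂ} {V : Matrix n n ℂ} :
    ρ = (ε : ℂ) • (C - U ⊗ₖ (1 : Matrix n n ℂ) - (1 : Matrix m m ℂ) ⊗ₖ V)⁻¹ ↔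
      C - (ε : ℂ) • ρ⁻¹ = kroneckerSum U V := by
  rw [eq_smul_inv_iff hρ hε, kroneckerSum, sub_sub, sub_eq_iff_eq_add, sub_eq_iff_eq_add, add_comm]

end Transport

end QuantumTransport

open QuantumTransport in
/-- Barrier relaxation of the quantum bi-partite OTP (Lemma 4.1):
(a) `κ(C,R) < κ_β(C,R,ε)`; (b) the minimizer `ρ* ∈ Γ_o(R)` is unique and has the form
`ρ* = ε (C − U₁⊗I − I⊗U₂)⁻¹` with Hermitian `U₁, U₂`, and the pair `(U₁,U₂)` with
`tr U₁ = tr U₂` is unique. -/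
theorem stmt_16 (n₁ n₂ : ℕ) (hn₁ : 1 < n₁) (hn₂ : 1 < n₂)
    (ρ₁ : Matrix (Fin n₁) (Fin n₁) ℂ) (ρ₂ : Matrix (Fin n₂) (Fin n₂) ℂ)
    (hρ₁ : ρ₁.PosDef) (hρ₂ : ρ₂.PosDef)
    (htr₁ : ρ₁.trace = 1) (htr₂ : ρ₂.trace = 1)
    (C : Matrix (Fin n₁ × Fin n₂) (Fin n₁ × Fin n₂) ℂ) (hC : C.IsHermitian)
    (ε : ℝ) (hε : 0 < ε) :
    let ptr2 : Matrix (Fin n₁ × Fin n₂) (Fin n₁ × Fin n₂) ℂ → Matrix (Fin n₁) (Fin n₁) ℂ :=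
      fun ρ => Matrix.of fun i k => ∑ j, ρ (i, j) (k, j)
    let ptr1 : Matrix (Fin n₁ × Fin n₂) (Fin n₁ × Fin n₂) ℂ → Matrix (Fin n₂) (Fin n₂) ℂ :=
      fun ρ => Matrix.of fun j l => ∑ i, ρ (i, j) (i, l)
    let Γ : Set (Matrix (Fin n₁ × Fin n₂) (Fin n₁ × Fin n₂) ℂ) :=
      {ρ | ρ.PosSemidef ∧ ptr2 ρ = ρ₁ ∧ ptr1 ρ = ρ₂}
    let Γo : Set (Matrix (Fin n₁ × Fin n₂) (Fin n₁ × Fin n₂) ℂ) :=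
      {ρ | ρ.PosDef ∧ ptr2 ρ = ρ₁ ∧ ptr1 ρ = ρ₂}
    let obj : Matrix (Fin n₁ × Fin n₂) (Fin n₁ × Fin n₂) ℂ → ℝ := fun ρ => ((C * ρ).trace).re
    let objβ : Matrix (Fin n₁ × Fin n₂) (Fin n₁ × Fin n₂) ℂ → ℝ := fun ρ =>
      ((C * ρ).trace).re + ε * (-Real.log (ρ.det.re))
    sInf (obj '' Γ) < sInf (objβ '' Γo) ∧
    ∃! ρstar : Matrix (Fin n₁ × Fin n₂) (Fin n₁ × Fin n₂) ℂ,
      ρstar ∈ Γo ∧ (∀ σ ∈ Γo, objβ ρstar ≤ objβ σ) ∧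
      (∃ (U₁ : Matrix (Fin n₁) (Fin n₁) ℂ) (U₂ : Matrix (Fin n₂) (Fin n₂) ℂ),
        U₁.IsHermitian ∧ U₂.IsHermitian ∧
        ρstar = (ε : ℂ) • (C - U₁ ⊗ₖ (1 : Matrix (Fin n₂) (Fin n₂) ℂ)
          - (1 : Matrix (Fin n₁) (Fin n₁) ℂ) ⊗ₖ U₂)⁻¹) ∧
      (∃! U : Matrix (Fin n₁) (Fin n₁) ℂ × Matrix (Fin n₂) (Fin n₂) ℂ,
        U.1.IsHermitian ∧ U.2.IsHermitian ∧ U.1.trace = U.2.trace ∧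
        ρstar = (ε : ℂ) • (C - U.1 ⊗ₖ (1 : Matrix (Fin n₂) (Fin n₂) ℂ)
          - (1 : Matrix (Fin n₁) (Fin n₁) ℂ) ⊗ₖ U.2)⁻¹) := by
  intro ptr2 ptr1 Γ Γo obj objβ
  have : Nonempty (Fin n₁) := ⟨⟨0, by omega⟩⟩
  have : Nonempty (Fin n₂) := ⟨⟨0, by omega⟩⟩
  have hcard : 1 < Fintype.card (Fin n₁ × Fin n₂) := by
    rw [Fintype.card_prod, Fintype.card_fin, Fintype.card_fin]
    nlinarith
  obtain ⟨ρ, hρ, hmin⟩ := exists_minimizer hρ₁ hρ₂ htr₁ htr₂ C hε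
  obtain ⟨U, V, hU, hV, hUV⟩ := exists_kroneckerSum_of_minimizer hC hρ hmin
  constructor
  · have hinf : sInf (objβ '' Γo) = objβ ρ :=
      IsLeast.csInf_eq ⟨⟨ρ, hρ, rfl⟩, by rintro _ ⟨σ, hσ, rfl⟩; exact hmin σ hσ⟩
    rw [hinf]
    refine lt_of_le_of_lt (csInf_le ?_ ⟨ρ, posCouplings_subset hρ, rfl⟩)
      (cost_lt_barrierCost hcard htr₁ hε hρ)
    exact (isCompact_couplings (ρ₂ := ρ₂) htr₁).bddBelow_image continuous_cost.continuousOn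
  · refine ⟨ρ, ⟨hρ, hmin, ⟨U, V, hU, hV, (eq_smul_inv_sub_sub_iff hρ.1 hε.ne').2 hUV⟩, ?_⟩,
      fun σ hσ => eq_of_barrierCost_le hε hρ hσ.1 hUV (hσ.2.1 ρ hρ)⟩
    obtain ⟨U', V', hU', hV', htr, hsum⟩ := exists_kroneckerSum_trace_eq hU hV
    refine ⟨(U', V'), ⟨hU', hV', htr,
      (eq_smul_inv_sub_sub_iff hρ.1 hε.ne').2 (hUV.trans hsum.symm)⟩, ?_⟩
    rintro ⟨W, X⟩ ⟨-, -, hWX, hρW⟩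
    have hW := (eq_smul_inv_sub_sub_iff hρ.1 hε.ne').1 hρW
    obtain ⟨h₁, h₂⟩ := kroneckerSum_injective_of_trace_eq
      (hW.symm.trans (hUV.trans hsum.symm)) hWX htr
    exact Prod.ext h₁ h₂
end

section
/- Let ρ₁ ∈ H_{n₁,++}, ρ₂ ∈ H_{n₂,++} with tr ρ₁ = tr ρ₂, R = (ρ₁,ρ₂), C ∈ H_{n₁n₂}, ε > 0. Define C(X,Y) = C − X⊗I_{n₂} − I_{n₁}⊗Y for (X,Y) ∈ H_{n₁}×H_{n₂}, D̂ = {(X,Y) : C(X,Y) positive definite}, D = {(X,Y) ∈ D̂ : tr X = tr Y}, β_Q(X,Y) = −log det C(X,Y), and φ(X,Y,C) = tr(ρ₁X) + tr(ρ₂Y) − ε·β_Q(X,Y) + n₁n₂ε(1 − log ε). Then: (i) φ is concave on D̂ and strictly concave on D; (ii) max_{(X,Y)∈D̂} φ(X,Y,C) = max_{(X,Y)∈D} φ(X,Y,C) = κ_β(C,R,ε); (iii) φ attains its maximum on D̂ exactly on the line L = {(U₁,U₂) + t(I_{n₁}, −I_{n₂}) : t ∈ ℝ}, which intersects D at the unique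 point (U₁,U₂); and (iv) ρ* = ε·C(X,Y)^{−1} for (X,Y) ∈ L is the unique point of Γ_o(R) at which κ_β(C,R,ε) is attained. -/
open scoped Kronecker ComplexOrder

namespace BarrierDuality

open Matrix

section LogDet

variable {m : Type*} [Fintype m] [DecidableEq m]

open scoped MatrixOrder in
lemma exists_conjTranspose_mul_self {A : Matrix m m ℂ} (hA : A.PosSemidef) :
    ∃ R : Matrix m m ℂ, A = Rᴴ * R := by
  obtain ⟨R, hR⟩ := CStarAlgebra.nonneg_iff_eq_star_mul_self.mp (nonneg_iff_posSemidef.mpr hA)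
  exact ⟨R, hR⟩

lemma exists_isUnit_conjTranspose_mul_self {A : Matrix m m ℂ} (hA : A.PosDef) :
    ∃ R : Matrix m m ℂ, IsUnit R ∧ A = Rᴴ * R := by
  obtain ⟨R, hR⟩ := exists_conjTranspose_mul_self hA.posSemidef
  refine ⟨R, ?_, hR⟩
  have h := hA.isUnit
  rw [isUnit_iff_isUnit_det, hR, det_mul] at h
  exact (isUnit_iff_isUnit_det _).2 (isUnit_of_mul_isUnit_right h)

open scoped MatrixOrder in
lemma exists_posSemidef_add_smul_one {V : Matrix m m ℂ} (hV : V.IsHermitian) :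
    ∃ K : ℝ, 0 < K ∧ (V + K • (1 : Matrix m m ℂ)).PosSemidef := by
  obtain ⟨b, hb⟩ := (finite_real_spectrum (A := V)).bddBelow
  refine ⟨|b| + 1, by positivity, ?_⟩
  have h : algebraMap ℝ (Matrix m m ℂ) (-(|b| + 1)) ≤ V := by
    rw [algebraMap_le_iff_le_spectrum (ha := hV.isSelfAdjoint)]
    intro x hx
    have := hb hx
    have := neg_abs_le b
    linarith
  rwa [le_iff, Algebra.algebraMap_eq_smul_one, neg_smul, sub_neg_eq_add] at h

lemma det_re_pos {A : Matrix m m ℂ} (hA : A.PosDef) : 0 < A.det.re :=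
  (Complex.pos_iff.mp hA.det_pos).1

lemma ofReal_det_re {A : Matrix m m ℂ} (hA : A.PosDef) : (A.det.re : ℂ) = A.det :=
  Complex.ext rfl (by simpa using (Complex.pos_iff.mp hA.det_pos).2)

lemma log_det_re_mul {A B : Matrix m m ℂ} (hA : A.PosDef) (hB : B.PosDef) :
    Real.log (A * B).det.re = Real.log A.det.re + Real.log B.det.re := by
  rw [← Real.log_mul (det_re_pos hA).ne' (det_re_pos hB).ne', det_mul, ← ofReal_det_re hA,
    ← ofReal_det_re hB, ← Complex.ofReal_mul]
  simp

lemma log_det_re_smul {A : Matrix m m ℂ} (hA : A.PosDef) {c : ℝ} (hc : 0 < c) :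
    Real.log (c • A).det.re = Fintype.card m * Real.log c + Real.log A.det.re := by
  rw [det_smul_of_tower, Complex.smul_re, smul_eq_mul,
    Real.log_mul (pow_pos hc _).ne' (det_re_pos hA).ne', Real.log_pow]

lemma log_det_re_inv {A : Matrix m m ℂ} (hA : A.PosDef) :
    Real.log A⁻¹.det.re = -Real.log A.det.re := by
  have h := log_det_re_mul hA hA.inv
  rw [mul_nonsing_inv _ ((isUnit_iff_isUnit_det _).1 hA.isUnit)] at h
  rw [det_one, Complex.one_re, Real.log_one] at h
  linarith

lemma log_det_re_le_trace {N : Matrix m m ℂ} (hN : N.PosDef) :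
    Real.log N.det.re ≤ N.trace.re - Fintype.card m ∧
      (N.trace.re - Fintype.card m ≤ Real.log N.det.re → N = 1) := by
  have hpos := hN.eigenvalues_pos
  have hdet : Real.log N.det.re = ∑ i, Real.log (hN.1.eigenvalues i) := by
    rw [← Real.log_prod fun i _ => (hpos i).ne', hN.1.det_eq_prod_eigenvalues,
      ← RCLike.ofReal_prod]
    rfl
  have htr : N.trace.re - Fintype.card m = ∑ i, (hN.1.eigenvalues i - 1) := by
    rw [hN.1.trace_eq_sum_eigenvalues]
    simp
  have hle : ∀ i ∈ Finset.univ,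
      Real.log (hN.1.eigenvalues i) ≤ hN.1.eigenvalues i - 1 :=
    fun i _ => Real.log_le_sub_one_of_pos (hpos i)
  rw [hdet, htr]
  refine ⟨Finset.sum_le_sum hle, fun h => ?_⟩
  have heq := (Finset.sum_eq_sum_iff_of_le hle).1 (le_antisymm (Finset.sum_le_sum hle) h)
  have hone : hN.1.eigenvalues = fun _ => 1 := by
    funext i
    by_contra hne
    exact (Real.log_lt_sub_one_of_pos (hpos i) hne).ne (heq i (Finset.mem_univ i))
  rw [hN.1.spectral_theorem, hone]
  have : (diagonal ((RCLike.ofReal : ℝ → ℂ) ∘ fun _ => 1) : Matrix m m ℂ) = 1 := by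
    ext i j; simp [diagonal, one_apply]
  rw [this, map_one]

lemma log_det_re_add_le_trace_mul {A B : Matrix m m ℂ} (hA : A.PosDef) (hB : B.PosDef) :
    Real.log A.det.re + Real.log B.det.re ≤ (A * B).trace.re - Fintype.card m ∧
      ((A * B).trace.re - Fintype.card m ≤ Real.log A.det.re + Real.log B.det.re →
        A * B = 1) := by
  obtain ⟨R, hR, rfl⟩ := exists_isUnit_conjTranspose_mul_self hB
  have hN : (R * A * Rᴴ).PosDef := (IsUnit.posDef_star_right_conjugate_iff hR).2 hA
  have hdet : (R * A * Rᴴ).det = (A * (Rᴴ * R)).det := by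
    simp only [det_mul]; ring
  have htr : (R * A * Rᴴ).trace = (A * (Rᴴ * R)).trace := by
    rw [Matrix.mul_assoc, trace_mul_comm, Matrix.mul_assoc]
  have h := log_det_re_le_trace hN
  rw [hdet, htr, log_det_re_mul hA hB] at h
  refine ⟨h.1, fun he => ?_⟩
  have h1 := h.2 he
  rw [Matrix.mul_assoc] at h1
  rw [← Matrix.mul_assoc]
  exact mul_eq_one_comm.1 h1

lemma mul_log_det_re_add_le_trace_mul {A B : Matrix m m ℂ} (hA : A.PosDef) (hB : B.PosDef)
    {ε : ℝ} (hε : 0 < ε) :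
    ε * (Real.log A.det.re + Real.log B.det.re) ≤
        (A * B).trace.re - Fintype.card m * ε * (1 - Real.log ε) ∧
      ((A * B).trace.re - Fintype.card m * ε * (1 - Real.log ε) ≤
        ε * (Real.log A.det.re + Real.log B.det.re) → B = ε • A⁻¹) := by
  have hB' : (ε⁻¹ • B).PosDef := hB.smul (inv_pos.2 hε)
  have h := log_det_re_add_le_trace_mul hA hB'
  rw [log_det_re_smul hB (inv_pos.2 hε), Matrix.mul_smul, trace_smul, Complex.smul_re,
    smul_eq_mul, Real.log_inv] at h
  have e : (A * B).trace.re = ε * (ε⁻¹ * (A * B).trace.re) := by field_simp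
  constructor
  · have := mul_le_mul_of_nonneg_left h.1 hε.le
    rw [e]; linarith
  · intro he
    have h2 : A * B = ε • (1 : Matrix m m ℂ) := by
      rw [← h.2 (le_of_mul_le_mul_left (by rw [e] at he; linarith) hε), smul_smul,
        mul_inv_cancel₀ hε.ne', one_smul]
    rw [← nonsing_inv_mul_cancel_left A B ((isUnit_iff_isUnit_det _).1 hA.isUnit), h2,
      Matrix.mul_smul, Matrix.mul_one]

lemma strictConcaveOn_log_det_re :
    StrictConcaveOn ℝ {A : Matrix m m ℂ | A.PosDef} fun A => Real.log A.det.re := by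
  have key : ∀ {A Z : Matrix m m ℂ}, A.PosDef → Z.PosDef →
      Real.log A.det.re ≤ Real.log Z.det.re + (A * Z⁻¹).trace.re - Fintype.card m ∧
      (A ≠ Z →
        Real.log A.det.re < Real.log Z.det.re + (A * Z⁻¹).trace.re - Fintype.card m) := by
    intro A Z hA hZ
    have h := log_det_re_add_le_trace_mul hA hZ.inv
    rw [log_det_re_inv hZ] at h
    refine ⟨by linarith [h.1], fun hne => lt_of_not_ge fun hge => hne ?_⟩
    have h1 := h.2 (by linarith)
    have := hZ.isUnit.invertible
    rw [Matrix.mul_inv_eq_iff_eq_mul_of_invertible] at h1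
    simpa using h1
  have hconv : Convex ℝ {A : Matrix m m ℂ | A.PosDef} := by
    rw [convex_iff_forall_pos]
    intro x hx y hy a b ha hb _
    exact (PosDef.smul hx ha).add (PosDef.smul hy hb)
  refine ⟨hconv, fun x hx y hy hxy a b ha hb hab => ?_⟩
  have hz : (a • x + b • y).PosDef := (PosDef.smul hx ha).add (PosDef.smul hy hb)
  have hne : x ≠ a • x + b • y := by
    intro h
    apply hxy
    have : b • x = b • y := by
      have : a • x + b • x = a • x + b • y := by rw [← add_smul, hab, one_smul]; exact h
      exact add_left_cancel this
    exact smul_right_injective _ hb.ne' this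
  have h1 := mul_lt_mul_of_pos_left ((key hx hz).2 hne) ha
  have h2 := mul_le_mul_of_nonneg_left (key hy hz).1 hb.le
  have h3 : a * (x * (a • x + b • y)⁻¹).trace.re + b * (y * (a • x + b • y)⁻¹).trace.re
      = Fintype.card m := by
    have : ((a • x + b • y) * (a • x + b • y)⁻¹).trace.re = Fintype.card m := by
      rw [mul_nonsing_inv _ ((isUnit_iff_isUnit_det _).1 hz.isUnit)]
      simp
    rw [← this]
    generalize (a • x + b • y)⁻¹ = W
    simp [Matrix.add_mul, trace_add]
  have hb' : b = 1 - a := by linarith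
  simp only [smul_eq_mul]
  subst hb'
  linarith

lemma trace_conjTranspose_mul_self_re {k : Type*} [Fintype k] (A : Matrix k k ℂ) :
    (Aᴴ * A).trace.re = ∑ i, ∑ j, ‖A j i‖ ^ 2 := by
  simp [trace, mul_apply, Complex.normSq_eq_norm_sq, ← Complex.normSq_eq_conj_mul_self,
    -Complex.ofReal_pow]

lemma isCompact_posSemidef_trace_mul_le {P : Matrix m m ℂ} (hP : P.PosDef) (T : ℝ) :
    IsCompact {M : Matrix m m ℂ | M.PosSemidef ∧ (P * M).trace.re ≤ T} := by
  have hball : IsCompact {A : Matrix m m ℂ | (Aᴴ * A).trace.re ≤ T} := by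
    refine IsCompact.of_isClosed_subset
      (isCompact_univ_pi fun _ : m => isCompact_univ_pi fun _ : m =>
        isCompact_closedBall (0 : ℂ) (T + 1))
      (isClosed_le (by fun_prop) continuous_const) fun A hA i _ j _ => ?_
    rw [mem_closedBall_zero_iff]
    have hA' : ∑ i, ∑ j, ‖A j i‖ ^ 2 ≤ T := (trace_conjTranspose_mul_self_re A).symm.trans_le hA
    have h1 : ‖A i j‖ ^ 2 ≤ ∑ k, ‖A k j‖ ^ 2 :=
      Finset.single_le_sum (f := fun k => ‖A k j‖ ^ 2) (fun _ _ => by positivity)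
        (Finset.mem_univ i)
    have h2 : ∑ k, ‖A k j‖ ^ 2 ≤ ∑ l, ∑ k, ‖A k l‖ ^ 2 :=
      Finset.single_le_sum (f := fun l => ∑ k, ‖A k l‖ ^ 2) (fun _ _ => by positivity)
        (Finset.mem_univ j)
    nlinarith [sq_nonneg (‖A i j‖ - 1)]
  obtain ⟨R, hR, rfl⟩ := exists_isUnit_conjTranspose_mul_self hP
  have hdet : IsUnit R.det := (isUnit_iff_isUnit_det _).1 hR
  have hdet' : IsUnit Rᴴ.det := by rw [det_conjTranspose]; exact hdet.star
  have htr : ∀ M, (Rᴴ * R * M).trace = (R * M * Rᴴ).trace := fun M => by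
    rw [Matrix.mul_assoc, trace_mul_comm]
  have hcont : Continuous fun A : Matrix m m ℂ => R⁻¹ * (Aᴴ * A) * Rᴴ⁻¹ :=
    (continuous_const.matrix_mul
      (continuous_id.matrix_conjTranspose.matrix_mul continuous_id)).matrix_mul continuous_const
  have himage := hball.image hcont
  convert himage using 1
  have hcancel : ∀ N, R * (R⁻¹ * N * Rᴴ⁻¹) * Rᴴ = N := fun N => by
    rw [← Matrix.mul_assoc, mul_nonsing_inv_cancel_left _ _ hdet,
      nonsing_inv_mul_cancel_right _ _ hdet']
  ext M
  simp only [Set.mem_ofPred_eq, Set.mem_image]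
  constructor
  · rintro ⟨hM, hT⟩
    obtain ⟨A, hA⟩ := exists_conjTranspose_mul_self (hM.mul_mul_conjTranspose_same R)
    refine ⟨A, by rwa [← hA, ← htr], ?_⟩
    rw [← hA, Matrix.mul_assoc R, nonsing_inv_mul_cancel_left _ _ hdet,
      mul_nonsing_inv_cancel_right _ _ hdet']
  · rintro ⟨A, hA, rfl⟩
    refine ⟨?_, by rwa [htr, hcancel]⟩
    have := (posSemidef_conjTranspose_mul_self A).mul_mul_conjTranspose_same R⁻¹
    rwa [conjTranspose_nonsing_inv] at this

lemma eventually_posDef_add_smul {M V : Matrix m m ℂ} (hM : M.PosDef) (hV : V.IsHermitian) :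
    ∀ᶠ t : ℝ in nhdsWithin 0 (Set.Ioi 0), (M + t • V).PosDef := by
  obtain ⟨R, hR, rfl⟩ := exists_isUnit_conjTranspose_mul_self hM
  have hdet : IsUnit R.det := (isUnit_iff_isUnit_det _).1 hR
  have hdet' : IsUnit Rᴴ.det := by rw [det_conjTranspose]; exact hdet.star
  obtain ⟨K, hK, hW⟩ := exists_posSemidef_add_smul_one
    (isHermitian_conjTranspose_mul_mul R⁻¹ hV)
  filter_upwards [Ioo_mem_nhdsGT (inv_pos.2 hK)] with t ht
  have htK : 0 < 1 - t * K := by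
    have := mul_lt_mul_of_pos_right ht.2 hK
    rw [inv_mul_cancel₀ hK.ne'] at this
    linarith
  have h1 : ((1 - t * K) • (1 : Matrix m m ℂ) + t • (R⁻¹ᴴ * V * R⁻¹ + K • 1)).PosDef :=
    (PosDef.one.smul htK).add_posSemidef (hW.smul ht.1.le)
  have h2 := (IsUnit.posDef_star_left_conjugate_iff hR).2 h1
  convert h2 using 1
  have e1 : (1 - t * K) • (1 : Matrix m m ℂ) + t • (R⁻¹ᴴ * V * R⁻¹ + K • 1)
      = 1 + t • (R⁻¹ᴴ * V * R⁻¹) := by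
    module
  rw [e1, star_eq_conjTranspose, Matrix.mul_add, Matrix.add_mul, Matrix.mul_one, Matrix.mul_smul,
    Matrix.smul_mul, conjTranspose_nonsing_inv, Matrix.mul_assoc Rᴴ⁻¹,
    mul_nonsing_inv_cancel_left _ _ hdet', nonsing_inv_mul_cancel_right _ _ hdet]

lemma tendsto_inv_add_smul {M : Matrix m m ℂ} (hM : M.PosDef) (V : Matrix m m ℂ) :
    Filter.Tendsto (fun t : ℝ => (M + t • V)⁻¹) (nhdsWithin 0 (Set.Ioi 0)) (nhds M⁻¹) := by
  have h : ContinuousAt (fun t : ℝ => (M + t • V)⁻¹) 0 := by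
    simp only [inv_def, Ring.inverse_eq_inv']
    have hc : Continuous fun t : ℝ => M + t • V := by fun_prop
    refine ContinuousAt.smul (hc.matrix_det.continuousAt.inv₀ ?_) hc.matrix_adjugate.continuousAt
    simpa using hM.det_pos.ne'
  have := h.tendsto
  simp only [zero_smul, add_zero] at this
  exact this.mono_left nhdsWithin_le_nhds

lemma exists_posDef_stationary (S : Submodule ℝ (Matrix m m ℂ))
    (hS : ∀ V ∈ S, V.IsHermitian) (h1 : 1 ∈ S) {C P : Matrix m m ℂ} (hC : C.IsHermitian)
    (hP : P.PosDef) {ε : ℝ} (hε : 0 < ε) :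
    ∃ M : Matrix m m ℂ, M.PosDef ∧ C - M ∈ S ∧
      ∀ V ∈ S, ε * (V * M⁻¹).trace.re = (P * V).trace.re := by
  set g : Matrix m m ℂ → ℝ := fun M => ε * Real.log M.det.re - (P * M).trace.re with hg
  obtain ⟨k, hk, hk'⟩ := exists_posSemidef_add_smul_one hC
  set M₀ : Matrix m m ℂ := C + (k + 1) • 1 with hM₀
  have hM₀pos : M₀.PosDef := by
    have := PosDef.posSemidef_add hk' PosDef.one
    convert this using 1
    rw [hM₀]; module
  have hM₀mem : C - M₀ ∈ S := by
    have : C - M₀ = -((k + 1) • 1) := by rw [hM₀]; abel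
    rw [this]
    exact S.neg_mem (S.smul_mem _ h1)
  obtain ⟨T, hT⟩ : ∃ T : ℝ, ∀ M : Matrix m m ℂ, M.PosDef → g M₀ ≤ g M →
      (P * M).trace.re ≤ T := by
    have hB : ((2 * ε)⁻¹ • P).PosDef := hP.smul (by positivity)
    refine ⟨-2 * (ε * (Fintype.card m + Real.log ((2 * ε)⁻¹ • P).det.re) + g M₀),
      fun M hM h => ?_⟩
    have h2 := mul_le_mul_of_nonneg_left (log_det_re_add_le_trace_mul hM hB).1 hε.le
    rw [Matrix.mul_smul, trace_smul, Complex.smul_re, smul_eq_mul, trace_mul_comm] at h2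
    have e : ε * ((2 * ε)⁻¹ * (P * M).trace.re) = (P * M).trace.re / 2 := by field_simp
    rw [mul_sub, e] at h2
    simp only [hg] at h ⊢
    linarith
  have htr_nonneg : ∀ M : Matrix m m ℂ, M.PosSemidef → 0 ≤ (P * M).trace.re := by
    intro M hM
    obtain ⟨R, rfl⟩ := exists_conjTranspose_mul_self hP.posSemidef
    rw [Matrix.mul_assoc, trace_mul_comm]
    exact (Complex.le_def.1 (hM.mul_mul_conjTranspose_same R).trace_nonneg).1
  have hdet_le : ∀ M : Matrix m m ℂ, M.PosDef → g M₀ ≤ g M →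
      Real.exp (g M₀ / ε) ≤ M.det.re := by
    intro M hM h
    rw [← Real.le_log_iff_exp_le (det_re_pos hM), div_le_iff₀' hε]
    have := htr_nonneg M hM.posSemidef
    simp only [hg] at h ⊢
    linarith
  set K : Set (Matrix m m ℂ) := {M | M.PosSemidef ∧ (P * M).trace.re ≤ T} ∩
    ({M | C - M ∈ S} ∩ {M | Real.exp (g M₀ / ε) ≤ M.det.re}) with hKdef
  have hmemK : ∀ M : Matrix m m ℂ, M.PosDef → C - M ∈ S → g M₀ ≤ g M → M ∈ K :=
    fun M hM hMS h => ⟨⟨hM.posSemidef, hT M hM h⟩, hMS, hdet_le M hM h⟩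
  have hK : IsCompact K := by
    refine (isCompact_posSemidef_trace_mul_le hP T).inter_right (IsClosed.inter ?_ ?_)
    · exact S.closed_of_finiteDimensional.preimage (by fun_prop : Continuous fun M => C - M)
    · exact isClosed_le continuous_const (Complex.continuous_re.comp (by fun_prop))
  have hdetK : ∀ M ∈ K, 0 < M.det.re := fun M hM => (Real.exp_pos _).trans_le hM.2.2
  have hgK : ContinuousOn g K := by
    refine ContinuousOn.sub (continuousOn_const.mul (ContinuousOn.log
      (Complex.continuous_re.comp (by fun_prop)).continuousOn fun M hM => (hdetK M hM).ne'))
      (Complex.continuous_re.comp (by fun_prop)).continuousOn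
  obtain ⟨M, hMK, hmax⟩ := hK.exists_isMaxOn ⟨M₀, hmemK M₀ hM₀pos hM₀mem le_rfl⟩ hgK
  have hM : M.PosDef := hMK.1.1.posDef_iff_det_ne_zero.2 fun h => by
    have := hdetK M hMK
    rw [h] at this
    exact lt_irrefl _ this
  have hopt : ∀ N : Matrix m m ℂ, N.PosDef → C - N ∈ S → g N ≤ g M := by
    intro N hN hNS
    by_contra! hlt
    have h0 : g M₀ ≤ g M := hmax (hmemK M₀ hM₀pos hM₀mem le_rfl)
    exact hlt.not_ge (hmax (hmemK N hN hNS (h0.trans hlt.le)))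
  have hle : ∀ V ∈ S, ε * (V * M⁻¹).trace.re ≤ (P * V).trace.re := by
    intro V hV
    have hlim : Filter.Tendsto (fun t : ℝ => ε * (V * (M + t • V)⁻¹).trace.re)
        (nhdsWithin 0 (Set.Ioi 0)) (nhds (ε * (V * M⁻¹).trace.re)) := by
      have hc : Continuous fun N : Matrix m m ℂ => ε * (V * N).trace.re :=
        continuous_const.mul (Complex.continuous_re.comp (by fun_prop))
      exact (hc.tendsto _).comp (tendsto_inv_add_smul hM V)
    refine le_of_tendsto hlim ?_
    filter_upwards [eventually_posDef_add_smul hM (hS V hV), self_mem_nhdsWithin] with t hN ht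
    have ht : 0 < t := ht
    have hNS : C - (M + t • V) ∈ S := by
      rw [← sub_sub]
      exact S.sub_mem hMK.2.1 (S.smul_mem _ hV)
    have hg1 := hopt _ hN hNS
    have hg2 := (log_det_re_add_le_trace_mul hM hN.inv).1
    have e1 : (M * (M + t • V)⁻¹).trace.re
        = Fintype.card m - t * (V * (M + t • V)⁻¹).trace.re := by
      have : ((M + t • V) * (M + t • V)⁻¹).trace.re = Fintype.card m := by
        rw [mul_nonsing_inv _ ((isUnit_iff_isUnit_det _).1 hN.isUnit)]
        simp
      rw [← this]
      generalize (M + t • V)⁻¹ = W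
      simp [Matrix.add_mul, trace_add]
    rw [log_det_re_inv hN, e1] at hg2
    have e2 : (P * (M + t • V)).trace.re = (P * M).trace.re + t * (P * V).trace.re := by
      simp [Matrix.mul_add, trace_add]
    simp only [hg] at hg1
    rw [e2] at hg1
    have := mul_le_mul_of_nonneg_left hg2 hε.le
    exact le_of_mul_le_mul_left (by linarith) ht
  refine ⟨M, hM, hMK.2.1, fun V hV => le_antisymm (hle V hV) ?_⟩
  have := hle (-V) (S.neg_mem hV)
  simp only [Matrix.neg_mul, Matrix.mul_neg, trace_neg, Complex.neg_re] at this
  linarith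

end LogDet

section KroneckerSum

variable {p r : Type*}

/-- The map `(X, Y) ↦ X ⊗ I + I ⊗ Y`. -/
def kroneckerSum [DecidableEq p] [DecidableEq r] :
    Matrix p p ℂ × Matrix r r ℂ →ₗ[ℝ] Matrix (p × r) (p × r) ℂ where
  toFun q := q.1 ⊗ₖ (1 : Matrix r r ℂ) + (1 : Matrix p p ℂ) ⊗ₖ q.2
  map_add' q q' := by
    simp only [Prod.fst_add, Prod.snd_add, add_kronecker, kronecker_add]
    abel
  map_smul' a q := by
    simp only [Prod.smul_fst, Prod.smul_snd, smul_kronecker, kronecker_smul, smul_add,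
      RingHom.id_apply]

/-- The partial trace over the second factor. -/
def partialTraceSnd [Fintype r] (ρ : Matrix (p × r) (p × r) ℂ) : Matrix p p ℂ :=
  of fun i k => ∑ j, ρ (i, j) (k, j)

/-- The partial trace over the first factor. -/
def partialTraceFst [Fintype p] (ρ : Matrix (p × r) (p × r) ℂ) : Matrix r r ℂ :=
  of fun j l => ∑ i, ρ (i, j) (i, l)

lemma kroneckerSum_apply [DecidableEq p] [DecidableEq r]
    (q : Matrix p p ℂ × Matrix r r ℂ) :
    kroneckerSum q = q.1 ⊗ₖ (1 : Matrix r r ℂ) + (1 : Matrix p p ℂ) ⊗ₖ q.2 := rfl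

lemma trace_mul_kroneckerSum [Fintype p] [Fintype r] [DecidableEq p] [DecidableEq r]
    (ρ : Matrix (p × r) (p × r) ℂ)
    (q : Matrix p p ℂ × Matrix r r ℂ) :
    (ρ * kroneckerSum q).trace =
      (partialTraceSnd ρ * q.1).trace + (partialTraceFst ρ * q.2).trace := by
  rw [kroneckerSum_apply, Matrix.mul_add, trace_add]
  congr 1
  · simp only [trace, diag_apply, mul_apply, partialTraceSnd, of_apply, Fintype.sum_prod_type,
      kroneckerMap_apply, one_apply, mul_ite, mul_one, mul_zero, Finset.sum_ite_eq',
      Finset.mem_univ, if_true, Finset.sum_mul]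
    exact Finset.sum_congr rfl fun _ _ => Finset.sum_comm
  · have hinner : ∀ i j, ∑ k, ∑ l, ρ (i, j) (k, l) * ((1 : Matrix p p ℂ) k i * q.2 l j)
        = ∑ l, ρ (i, j) (i, l) * q.2 l j := fun i j => by
      rw [Finset.sum_eq_single i (fun k _ hk => by simp [hk]) (by simp)]
      simp
    simp only [trace, diag_apply, mul_apply, partialTraceFst, of_apply, Fintype.sum_prod_type,
      kroneckerMap_apply, hinner, Finset.sum_mul]
    rw [Finset.sum_comm]
    exact Finset.sum_congr rfl fun _ _ => Finset.sum_comm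

lemma isHermitian_kroneckerSum [DecidableEq p] [DecidableEq r]
    {q : Matrix p p ℂ × Matrix r r ℂ} (h1 : q.1.IsHermitian)
    (h2 : q.2.IsHermitian) : (kroneckerSum q).IsHermitian := by
  rw [kroneckerSum_apply, IsHermitian, conjTranspose_add, conjTranspose_kronecker,
    conjTranspose_kronecker, h1.eq, h2.eq, conjTranspose_one, conjTranspose_one]

lemma kroneckerSum_one_neg_one [DecidableEq p] [DecidableEq r] :
    kroneckerSum ((1 : Matrix p p ℂ), -(1 : Matrix r r ℂ)) = 0 := by
  have : (1 : Matrix p p ℂ) ⊗ₖ (-(1 : Matrix r r ℂ)) = -(1 ⊗ₖ 1) := by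
    ext
    simp only [kroneckerMap_apply, Matrix.neg_apply, mul_neg]
  rw [kroneckerSum_apply, this, add_neg_cancel]

lemma eq_smul_one_neg_one_of_kroneckerSum_eq_zero [DecidableEq p] [DecidableEq r]
    [Nonempty p] [Nonempty r]
    {q : Matrix p p ℂ × Matrix r r ℂ} (h1 : q.1.IsHermitian) (h : kroneckerSum q = 0) :
    ∃ t : ℝ, q = t • ((1 : Matrix p p ℂ), -(1 : Matrix r r ℂ)) := by
  obtain ⟨i₀⟩ := ‹Nonempty p›
  obtain ⟨j₀⟩ := ‹Nonempty r›
  have hentry : ∀ i k j l, q.1 i k * (1 : Matrix r r ℂ) j l + (1 : Matrix p p ℂ) i k * q.2 j l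
      = 0 := fun i k j l => congrFun (congrFun h (i, j)) (k, l)
  have hdiag : ∀ i j, q.1 i i + q.2 j j = 0 := fun i j => by simpa using hentry i i j j
  have hreal : ((q.1 i₀ i₀).re : ℂ) = q.1 i₀ i₀ := Complex.conj_eq_iff_re.1 (h1.apply i₀ i₀)
  refine ⟨(q.1 i₀ i₀).re, Prod.ext ?_ ?_⟩
  · ext i k
    by_cases hik : i = k
    · subst hik
      simp only [Prod.smul_fst, Matrix.smul_apply, one_apply_eq, Complex.real_smul, mul_one, hreal]
      linear_combination hdiag i j₀ - hdiag i₀ j₀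
    · simpa [hik] using hentry i k j₀ j₀
  · ext j l
    by_cases hjl : j = l
    · subst hjl
      simp only [Prod.smul_snd, Matrix.smul_apply, Matrix.neg_apply, one_apply_eq,
        Complex.real_smul, hreal]
      linear_combination hdiag i₀ j
    · simpa [hjl] using hentry i₀ i₀ j l

lemma isHermitian_partialTraceSnd [Fintype r] {ρ : Matrix (p × r) (p × r) ℂ} (h : ρ.IsHermitian) :
    (partialTraceSnd ρ).IsHermitian := by
  ext i k
  simp [partialTraceSnd, h.apply]

lemma isHermitian_partialTraceFst [Fintype p] {ρ : Matrix (p × r) (p × r) ℂ} (h : ρ.IsHermitian) :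
    (partialTraceFst ρ).IsHermitian := by
  ext i k
  simp [partialTraceFst, h.apply]

lemma eq_of_trace_mul_re_eq [Fintype p] {A B : Matrix p p ℂ} (hA : A.IsHermitian)
    (hB : B.IsHermitian)
    (h : ∀ X : Matrix p p ℂ, X.IsHermitian → (A * X).trace.re = (B * X).trace.re) : A = B := by
  have h1 := h (A - B) (hA.sub hB)
  have h2 : ((A - B)ᴴ * (A - B)).trace.re = 0 := by
    rw [(hA.sub hB).eq, Matrix.sub_mul, trace_sub, Complex.sub_re, h1, sub_self]
  have h3 := (Complex.le_def.1 (posSemidef_conjTranspose_mul_self (A - B)).trace_nonneg).2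
  exact sub_eq_zero.1 (trace_conjTranspose_mul_self_eq_zero_iff.1
    (Complex.ext h2 h3.symm))

lemma ofReal_trace_re [Fintype p] {A : Matrix p p ℂ} (hA : A.IsHermitian) :
    (A.trace.re : ℂ) = A.trace :=
  Complex.conj_eq_iff_re.1 (by rw [starRingEnd_apply, ← trace_conjTranspose, hA.eq])

/-- The stationarity condition of the dual problem, solved with equal traces. -/
lemma exists_dual_stationary [Fintype p] [Fintype r] [DecidableEq p] [DecidableEq r]
    [Nonempty p] [Nonempty r] {ρ₁ : Matrix p p ℂ} {ρ₂ : Matrix r r ℂ}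
    (hρ₁ : ρ₁.PosDef) (hρ₂ : ρ₂.PosDef) (htr : ρ₁.trace = ρ₂.trace)
    {C : Matrix (p × r) (p × r) ℂ} (hC : C.IsHermitian) {ε : ℝ} (hε : 0 < ε) :
    ∃ q : Matrix p p ℂ × Matrix r r ℂ, q.1.IsHermitian ∧ q.2.IsHermitian ∧
      (C - kroneckerSum q).PosDef ∧ q.1.trace = q.2.trace ∧
      partialTraceSnd (ε • (C - kroneckerSum q)⁻¹) = ρ₁ ∧
      partialTraceFst (ε • (C - kroneckerSum q)⁻¹) = ρ₂ := by
  have hpos : 0 < ρ₁.trace := hρ₁.trace_pos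
  obtain ⟨hτ, him⟩ := Complex.pos_iff.1 hpos
  have hτ' : (ρ₁.trace.re : ℂ) = ρ₁.trace := Complex.ext rfl (by simpa using him)
  set P : Matrix (p × r) (p × r) ℂ := ρ₁.trace.re⁻¹ • (ρ₁ ⊗ₖ ρ₂) with hPdef
  have hP : P.PosDef := (hρ₁.kronecker hρ₂).smul (inv_pos.2 hτ)
  have hP1 : partialTraceSnd P = ρ₁ := by
    ext i k
    have : ∑ j, ρ₁ i k * ρ₂ j j = ρ₁ i k * ρ₁.trace := by
      rw [htr, trace, Finset.mul_sum]; rfl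
    simp only [partialTraceSnd, hPdef, of_apply, Matrix.smul_apply, kroneckerMap_apply,
      Complex.real_smul, ← Finset.mul_sum, Complex.ofReal_inv, hτ']
    rw [Finset.mul_sum, this]
    field_simp [hpos.ne']
  have hP2 : partialTraceFst P = ρ₂ := by
    ext j l
    have : ∑ i, ρ₁ i i * ρ₂ j l = ρ₁.trace * ρ₂ j l := by
      rw [trace, Finset.sum_mul]; rfl
    simp only [partialTraceFst, hPdef, of_apply, Matrix.smul_apply, kroneckerMap_apply,
      Complex.real_smul, ← Finset.mul_sum, Complex.ofReal_inv, hτ']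
    rw [this]
    field_simp [hpos.ne']
  set S : Submodule ℝ (Matrix (p × r) (p × r) ℂ) :=
    ((selfAdjoint.submodule ℝ (Matrix p p ℂ)).prod
      (selfAdjoint.submodule ℝ (Matrix r r ℂ))).map kroneckerSum with hSdef
  have hmem : ∀ q : Matrix p p ℂ × Matrix r r ℂ, q.1.IsHermitian → q.2.IsHermitian →
      kroneckerSum q ∈ S := fun q h1 h2 => Submodule.mem_map_of_mem ⟨h1, h2⟩
  have hS : ∀ V ∈ S, V.IsHermitian := by
    rintro _ ⟨q, ⟨h1, h2⟩, rfl⟩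
    exact isHermitian_kroneckerSum h1 h2
  have h1S : (1 : Matrix (p × r) (p × r) ℂ) ∈ S := by
    have := hmem (1, 0) isHermitian_one isHermitian_zero
    simpa [kroneckerSum_apply] using this
  obtain ⟨M, hM, ⟨q, ⟨hq1, hq2⟩, hqM⟩, hstat⟩ := exists_posDef_stationary S hS h1S hC hP hε
  have hq1 : q.1.IsHermitian := hq1
  have hq2 : q.2.IsHermitian := hq2
  have hρM : (ε • M⁻¹).IsHermitian := (hM.inv.smul hε).1
  have hpair : ∀ q' : Matrix p p ℂ × Matrix r r ℂ, q'.1.IsHermitian → q'.2.IsHermitian →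
      (partialTraceSnd (ε • M⁻¹) * q'.1).trace.re + (partialTraceFst (ε • M⁻¹) * q'.2).trace.re
        = (ρ₁ * q'.1).trace.re + (ρ₂ * q'.2).trace.re := by
    intro q' h1 h2
    have h := hstat _ (hmem q' h1 h2)
    rw [trace_mul_comm, trace_mul_kroneckerSum P, hP1, hP2, ← smul_eq_mul, ← Complex.smul_re,
      ← trace_smul, ← Matrix.smul_mul, trace_mul_kroneckerSum] at h
    simpa using h
  have hmarg1 : partialTraceSnd (ε • M⁻¹) = ρ₁ :=
    eq_of_trace_mul_re_eq (isHermitian_partialTraceSnd hρM) hρ₁.1 fun X hX => by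
      simpa using hpair (X, 0) hX isHermitian_zero
  have hmarg2 : partialTraceFst (ε • M⁻¹) = ρ₂ :=
    eq_of_trace_mul_re_eq (isHermitian_partialTraceFst hρM) hρ₂.1 fun Y hY => by
      simpa using hpair (0, Y) isHermitian_zero hY
  set N : ℝ := Fintype.card p + Fintype.card r with hN
  have hNpos : 0 < N := by have := Fintype.card_pos (α := p); positivity
  set t : ℝ := (q.2.trace.re - q.1.trace.re) / N with ht
  have hCM : C - kroneckerSum (q + t • ((1 : Matrix p p ℂ), -(1 : Matrix r r ℂ))) = M := by
    rw [map_add, map_smul, kroneckerSum_one_neg_one, smul_zero, add_zero, hqM, sub_sub_cancel]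
  have h1 : (q + t • ((1 : Matrix p p ℂ), -(1 : Matrix r r ℂ))).1 = q.1 + t • 1 := rfl
  have h2 : (q + t • ((1 : Matrix p p ℂ), -(1 : Matrix r r ℂ))).2 = q.2 + t • -1 := rfl
  refine ⟨q + t • (1, -1), ?_, ?_, hCM ▸ hM, ?_, hCM ▸ hmarg1, hCM ▸ hmarg2⟩
  · rw [h1]
    exact hq1.add (isHermitian_one.smul (IsSelfAdjoint.all t))
  · rw [h2]
    exact hq2.add (isHermitian_one.neg.smul (IsSelfAdjoint.all t))
  · have e1 := ofReal_trace_re hq1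
    have e2 := ofReal_trace_re hq2
    have e3 : t * N = q.2.trace.re - q.1.trace.re := div_mul_cancel₀ _ hNpos.ne'
    have e4 : ((t * N : ℝ) : ℂ) = q.2.trace - q.1.trace := by rw [e3, Complex.ofReal_sub, e1, e2]
    rw [hN] at e4
    push_cast at e4
    rw [h1, h2, trace_add, trace_add, trace_smul, trace_smul, trace_neg, trace_one, trace_one,
      Complex.real_smul, Complex.real_smul]
    linear_combination e4

end KroneckerSum

end BarrierDuality

open BarrierDuality

/-- Duality for the barrier relaxation of the quantum bi-partite OTP (Theorem 1.2):
the dual function `φ` is concave on `D̂`, strictly concave on `D`, its maximum over `D̂`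
(and over `D`) equals `κ_β(C,R,ε)`, the maximum is attained exactly on the line
`L = {(U₁,U₂) + t(I,−I)}` meeting `D` at the unique point `(U₁,U₂)`, and
`ρ* = ε C(X,Y)⁻¹` for `(X,Y) ∈ L` is the unique minimizer of `κ_β(C,R,ε)` in `Γ_o(R)`. -/
theorem stmt_17 (n₁ n₂ : ℕ) (hn₁ : 1 < n₁) (hn₂ : 1 < n₂)
    (ρ₁ : Matrix (Fin n₁) (Fin n₁) ℂ) (ρ₂ : Matrix (Fin n₂) (Fin n₂) ℂ)
    (hρ₁ : ρ₁.PosDef) (hρ₂ : ρ₂.PosDef) (htr : ρ₁.trace = ρ₂.trace)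
    (C : Matrix (Fin n₁ × Fin n₂) (Fin n₁ × Fin n₂) ℂ) (hC : C.IsHermitian)
    (ε : ℝ) (hε : 0 < ε) :
    let Cm : Matrix (Fin n₁) (Fin n₁) ℂ × Matrix (Fin n₂) (Fin n₂) ℂ →
        Matrix (Fin n₁ × Fin n₂) (Fin n₁ × Fin n₂) ℂ := fun q =>
      C - q.1 ⊗ₖ (1 : Matrix (Fin n₂) (Fin n₂) ℂ) - (1 : Matrix (Fin n₁) (Fin n₁) ℂ) ⊗ₖ q.2
    let ptr2 : Matrix (Fin n₁ × Fin n₂) (Fin n₁ × Fin n₂) ℂ → Matrix (Fin n₁) (Fin n₁) ℂ :=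
      fun ρ => Matrix.of fun i k => ∑ j, ρ (i, j) (k, j)
    let ptr1 : Matrix (Fin n₁ × Fin n₂) (Fin n₁ × Fin n₂) ℂ → Matrix (Fin n₂) (Fin n₂) ℂ :=
      fun ρ => Matrix.of fun j l => ∑ i, ρ (i, j) (i, l)
    let Γo : Set (Matrix (Fin n₁ × Fin n₂) (Fin n₁ × Fin n₂) ℂ) :=
      {ρ | ρ.PosDef ∧ ptr2 ρ = ρ₁ ∧ ptr1 ρ = ρ₂}
    let objβ : Matrix (Fin n₁ × Fin n₂) (Fin n₁ × Fin n₂) ℂ → ℝ := fun ρ =>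
      ((C * ρ).trace).re + ε * (-Real.log (ρ.det.re))
    let κβ : ℝ := sInf (objβ '' Γo)
    let Dhat : Set (Matrix (Fin n₁) (Fin n₁) ℂ × Matrix (Fin n₂) (Fin n₂) ℂ) :=
      {q | q.1.IsHermitian ∧ q.2.IsHermitian ∧ (Cm q).PosDef}
    let D : Set (Matrix (Fin n₁) (Fin n₁) ℂ × Matrix (Fin n₂) (Fin n₂) ℂ) :=
      {q | q ∈ Dhat ∧ q.1.trace = q.2.trace}
    let φ : Matrix (Fin n₁) (Fin n₁) ℂ × Matrix (Fin n₂) (Fin n₂) ℂ → ℝ := fun q =>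
      ((ρ₁ * q.1).trace).re + ((ρ₂ * q.2).trace).re
        - ε * (-Real.log ((Cm q).det.re)) + (n₁ : ℝ) * n₂ * ε * (1 - Real.log ε)
    ConcaveOn ℝ Dhat φ ∧ StrictConcaveOn ℝ D φ ∧
    IsGreatest (φ '' Dhat) κβ ∧ IsGreatest (φ '' D) κβ ∧
    ∃ (U₁ : Matrix (Fin n₁) (Fin n₁) ℂ) (U₂ : Matrix (Fin n₂) (Fin n₂) ℂ),
      (U₁, U₂) ∈ D ∧
      {q ∈ Dhat | φ q = κβ}
        = {q | ∃ t : ℝ, q = (U₁ + (t : ℂ) • (1 : Matrix (Fin n₁) (Fin n₁) ℂ),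
            U₂ - (t : ℂ) • (1 : Matrix (Fin n₂) (Fin n₂) ℂ))} ∧
      {q | ∃ t : ℝ, q = (U₁ + (t : ℂ) • (1 : Matrix (Fin n₁) (Fin n₁) ℂ),
            U₂ - (t : ℂ) • (1 : Matrix (Fin n₂) (Fin n₂) ℂ))} ∩ D = {(U₁, U₂)} ∧
      (∀ q, (∃ t : ℝ, q = (U₁ + (t : ℂ) • (1 : Matrix (Fin n₁) (Fin n₁) ℂ),
            U₂ - (t : ℂ) • (1 : Matrix (Fin n₂) (Fin n₂) ℂ))) →
        (ε : ℂ) • (Cm q)⁻¹ = (ε : ℂ) • (Cm (U₁, U₂))⁻¹) ∧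
      (ε : ℂ) • (Cm (U₁, U₂))⁻¹ ∈ Γo ∧
      (∀ σ ∈ Γo, σ ≠ (ε : ℂ) • (Cm (U₁, U₂))⁻¹ →
        objβ ((ε : ℂ) • (Cm (U₁, U₂))⁻¹) < objβ σ) := by
  intro Cm ptr2 ptr1 Γo objβ κβ Dhat D φ
  have : Nonempty (Fin n₁) := ⟨⟨0, by omega⟩⟩
  have : Nonempty (Fin n₂) := ⟨⟨0, by omega⟩⟩
  have hCm : ∀ q, Cm q = C - kroneckerSum q := fun q => by
    rw [kroneckerSum_apply, ← sub_sub]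
  have hsmul : ∀ A : Matrix (Fin n₁ × Fin n₂) (Fin n₁ × Fin n₂) ℂ, (ε : ℂ) • A = ε • A :=
    fun A => Complex.coe_smul ε A
  have hcard : (Fintype.card (Fin n₁ × Fin n₂) : ℝ) = n₁ * n₂ := by simp
  have hgap : ∀ σ ∈ Γo, ∀ q, objβ σ - φ q = (Cm q * σ).trace.re
      - Fintype.card (Fin n₁ × Fin n₂) * ε * (1 - Real.log ε)
      - ε * (Real.log (Cm q).det.re + Real.log σ.det.re) := by
    rintro σ ⟨-, h1, h2⟩ q
    have h := congrArg Complex.re (trace_mul_kroneckerSum σ q)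
    rw [show partialTraceSnd σ = ρ₁ from h1, show partialTraceFst σ = ρ₂ from h2,
      Complex.add_re] at h
    have hC' : (Cm q * σ).trace.re = (C * σ).trace.re - (σ * kroneckerSum q).trace.re := by
      rw [hCm, Matrix.sub_mul, Matrix.trace_sub, Complex.sub_re,
        Matrix.trace_mul_comm (kroneckerSum q)]
    rw [hC', h, hcard]
    simp only [objβ, φ]
    ring
  have hweak : ∀ σ ∈ Γo, ∀ q ∈ Dhat, φ q ≤ objβ σ := fun σ hσ q hq => by
    have := (mul_log_det_re_add_le_trace_mul hq.2.2 hσ.1 hε).1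
    linarith [hgap σ hσ q]
  have htight : ∀ σ ∈ Γo, ∀ q ∈ Dhat, objβ σ ≤ φ q → σ = (ε : ℂ) • (Cm q)⁻¹ :=
    fun σ hσ q hq h => by
      rw [hsmul]
      exact (mul_log_det_re_add_le_trace_mul hq.2.2 hσ.1 hε).2 (by linarith [hgap σ hσ q])
  have hstrong : ∀ q ∈ Dhat, (ε : ℂ) • (Cm q)⁻¹ ∈ Γo → objβ ((ε : ℂ) • (Cm q)⁻¹) = φ q := by
    intro q hq hσ
    have h := hgap _ hσ q
    rw [hsmul] at h ⊢
    rw [log_det_re_smul hq.2.2.inv hε, log_det_re_inv hq.2.2, Matrix.mul_smul,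
      Matrix.mul_nonsing_inv _ ((Matrix.isUnit_iff_isUnit_det _).1 hq.2.2.isUnit),
      Matrix.trace_smul, Matrix.trace_one, Complex.smul_re, Complex.natCast_re, smul_eq_mul] at h
    linarith
  obtain ⟨⟨U₁, U₂⟩, hU₁, hU₂, hUpos, hUtr, hUsnd, hUfst⟩ :=
    exists_dual_stationary hρ₁ hρ₂ htr hC hε
  rw [← hCm] at hUpos hUsnd hUfst
  have hUhat : (U₁, U₂) ∈ Dhat := ⟨hU₁, hU₂, hUpos⟩
  have hUD : (U₁, U₂) ∈ D := ⟨hUhat, hUtr⟩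
  have hρΓ : (ε : ℂ) • (Cm (U₁, U₂))⁻¹ ∈ Γo := by
    rw [hsmul]
    exact ⟨hUpos.inv.smul hε, hUsnd, hUfst⟩
  have hκ : κβ = φ (U₁, U₂) := by
    have hleast : IsLeast (objβ '' Γo) (φ (U₁, U₂)) :=
      ⟨⟨_, hρΓ, hstrong _ hUhat hρΓ⟩, by rintro _ ⟨σ, hσ, rfl⟩; exact hweak σ hσ _ hUhat⟩
    exact hleast.csInf_eq
  have hmax : ∀ q ∈ Dhat, φ q ≤ κβ := fun q hq => by
    rw [hκ, ← hstrong _ hUhat hρΓ]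
    exact hweak _ hρΓ q hq
  have hline : ∀ q : Matrix (Fin n₁) (Fin n₁) ℂ × Matrix (Fin n₂) (Fin n₂) ℂ, ∀ t : ℝ,
      q = (U₁ + (t : ℂ) • (1 : Matrix (Fin n₁) (Fin n₁) ℂ),
        U₂ - (t : ℂ) • (1 : Matrix (Fin n₂) (Fin n₂) ℂ)) ↔
      q = (U₁, U₂) + t • ((1 : Matrix (Fin n₁) (Fin n₁) ℂ),
        -(1 : Matrix (Fin n₂) (Fin n₂) ℂ)) := fun q t => by
    rw [Complex.coe_smul, Complex.coe_smul, sub_eq_add_neg, ← smul_neg]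
    rfl
  have hCmline : ∀ t : ℝ, Cm ((U₁, U₂) + t • ((1 : Matrix (Fin n₁) (Fin n₁) ℂ),
      -(1 : Matrix (Fin n₂) (Fin n₂) ℂ))) = Cm (U₁, U₂) := fun t => by
    rw [hCm, hCm, map_add, map_smul, kroneckerSum_one_neg_one, smul_zero, add_zero]
  have hfiber : ∀ q q' : Matrix (Fin n₁) (Fin n₁) ℂ × Matrix (Fin n₂) (Fin n₂) ℂ,
      q ∈ Dhat → q' ∈ Dhat → Cm q = Cm q' → ∃ t : ℝ, q = q' +
        t • ((1 : Matrix (Fin n₁) (Fin n₁) ℂ), -(1 : Matrix (Fin n₂) (Fin n₂) ℂ)) := by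
    intro q q' hq hq' h
    rw [hCm, hCm, sub_right_inj, ← sub_eq_zero, ← map_sub] at h
    obtain ⟨t, ht⟩ := eq_smul_one_neg_one_of_kroneckerSum_eq_zero (hq.1.sub hq'.1) h
    exact ⟨t, by rw [← ht]; abel⟩
  have hshift : ∀ q ∈ D, ∀ t : ℝ, q + t • ((1 : Matrix (Fin n₁) (Fin n₁) ℂ),
      -(1 : Matrix (Fin n₂) (Fin n₂) ℂ)) ∈ D → t = 0 := by
    rintro q ⟨-, hq⟩ t ⟨-, ht⟩
    have h : (q.1 + t • (1 : Matrix (Fin n₁) (Fin n₁) ℂ)).trace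
        = (q.2 + t • -(1 : Matrix (Fin n₂) (Fin n₂) ℂ)).trace := ht
    simp only [Matrix.trace_add, Matrix.trace_smul, Matrix.trace_neg, Matrix.trace_one, hq,
      add_right_inj, Fintype.card_fin] at h
    have h' := congrArg Complex.re h
    simp only [Complex.smul_re, Complex.neg_re, Complex.natCast_re, smul_eq_mul] at h'
    have hn : (0 : ℝ) < n₁ + n₂ := by
      have : 0 < n₁ + n₂ := by omega
      exact_mod_cast this
    exact (mul_eq_zero.1 (by linarith : t * ((n₁ : ℝ) + n₂) = 0)).resolve_right hn.ne'
  have hinj : ∀ q ∈ D, ∀ q' ∈ D, Cm q = Cm q' → q = q' := by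
    intro q hq q' hq' h
    obtain ⟨t, rfl⟩ := hfiber q q' hq.1 hq'.1 h
    rw [hshift q' hq' t hq, zero_smul, add_zero]
  have hCmaff : ∀ (q q' : Matrix (Fin n₁) (Fin n₁) ℂ × Matrix (Fin n₂) (Fin n₂) ℂ) (a b : ℝ),
      a + b = 1 → Cm (a • q + b • q') = a • Cm q + b • Cm q' := by
    intro q q' a b hab
    obtain rfl : b = 1 - a := by linarith
    rw [hCm, hCm, hCm, map_add, map_smul, map_smul]
    module
  have hφaff : ∀ (q q' : Matrix (Fin n₁) (Fin n₁) ℂ × Matrix (Fin n₂) (Fin n₂) ℂ) (a b : ℝ),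
      a + b = 1 → φ (a • q + b • q') - (a * φ q + b * φ q')
        = ε * (Real.log (a • Cm q + b • Cm q').det.re
          - (a * Real.log (Cm q).det.re + b * Real.log (Cm q').det.re)) := by
    intro q q' a b hab
    rw [← hCmaff q q' a b hab]
    obtain rfl : b = 1 - a := by linarith
    simp only [φ, Prod.fst_add, Prod.snd_add, Prod.smul_fst, Prod.smul_snd, Matrix.mul_add,
      Matrix.mul_smul, Matrix.trace_add, Matrix.trace_smul, Complex.add_re, Complex.smul_re,
      smul_eq_mul]
    ring
  have hconc := strictConcaveOn_log_det_re (m := Fin n₁ × Fin n₂)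
  have hDhat : Convex ℝ Dhat := by
    intro q hq q' hq' a b ha hb hab
    refine ⟨(hq.1.smul (IsSelfAdjoint.all a)).add (hq'.1.smul (IsSelfAdjoint.all b)),
      (hq.2.1.smul (IsSelfAdjoint.all a)).add (hq'.2.1.smul (IsSelfAdjoint.all b)), ?_⟩
    rw [hCmaff q q' a b hab]
    exact hconc.1 hq.2.2 hq'.2.2 ha hb hab
  have hD : Convex ℝ D := by
    intro q hq q' hq' a b ha hb hab
    refine ⟨hDhat hq.1 hq'.1 ha hb hab, ?_⟩
    simp only [Prod.fst_add, Prod.snd_add, Prod.smul_fst, Prod.smul_snd, Matrix.trace_add,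
      Matrix.trace_smul, hq.2, hq'.2]
  refine ⟨⟨hDhat, ?_⟩, ⟨hD, ?_⟩, ?_, ?_, U₁, U₂, hUD, ?_, ?_, ?_, hρΓ, ?_⟩
  · intro q hq q' hq' a b ha hb hab
    have h := hconc.concaveOn.2 hq.2.2 hq'.2.2 ha hb hab
    have h' := mul_nonneg hε.le (sub_nonneg.2 h)
    simp only [smul_eq_mul] at h' ⊢
    linarith [hφaff q q' a b hab]
  · intro q hq q' hq' hne a b ha hb hab
    have h := hconc.2 hq.1.2.2 hq'.1.2.2 (fun h => hne (hinj q hq q' hq' h)) ha hb hab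
    have h' := mul_pos hε (sub_pos.2 h)
    simp only [smul_eq_mul] at h' ⊢
    linarith [hφaff q q' a b hab]
  · exact ⟨⟨_, hUhat, hκ.symm⟩, by rintro _ ⟨q, hq, rfl⟩; exact hmax q hq⟩
  · exact ⟨⟨_, hUD, hκ.symm⟩, by rintro _ ⟨q, hq, rfl⟩; exact hmax q hq.1⟩
  · ext q
    constructor
    · rintro ⟨hq, hφq⟩
      have h := htight _ hρΓ q hq (by rw [hstrong _ hUhat hρΓ, hφq, hκ])
      have h' : Cm q = Cm (U₁, U₂) := Matrix.inv_inj
        (smul_right_injective _ (Complex.ofReal_ne_zero.2 hε.ne') h.symm)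
        ((Matrix.isUnit_iff_isUnit_det _).1 hq.2.2.isUnit)
      obtain ⟨t, ht⟩ := hfiber q _ hq hUhat h'
      exact ⟨t, (hline q t).2 ht⟩
    · rintro ⟨t, ht⟩
      rw [hline] at ht
      subst ht
      have hq : (U₁, U₂) + t • ((1 : Matrix (Fin n₁) (Fin n₁) ℂ),
          -(1 : Matrix (Fin n₂) (Fin n₂) ℂ)) ∈ Dhat :=
        ⟨hU₁.add (Matrix.isHermitian_one.smul (IsSelfAdjoint.all t)),
          hU₂.add (Matrix.isHermitian_one.neg.smul (IsSelfAdjoint.all t)), by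
            rw [hCmline]; exact hUpos⟩
      have h := hstrong _ hq (by rw [hCmline]; exact hρΓ)
      rw [hCmline, hstrong _ hUhat hρΓ, ← hκ] at h
      exact ⟨hq, h.symm⟩
  · ext q
    constructor
    · rintro ⟨⟨t, ht⟩, hq⟩
      rw [hline] at ht
      subst ht
      rw [hshift _ hUD t hq, zero_smul, add_zero]
      rfl
    · rintro rfl
      exact ⟨⟨0, by simp⟩, hUD⟩
  · rintro q ⟨t, ht⟩
    rw [hline] at ht
    rw [ht, hCmline]
  · intro σ hσ hne
    rw [hstrong _ hUhat hρΓ]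
    exact lt_of_not_ge fun h => hne (htight σ hσ _ hUhat h)
end
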